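/- arXiv:1102.0423 — 3 statements merged into one kernel-verified Lean document; each statement's English description precedes it below -/
import Mathlib

section
/- Let n ≥ 3. Then every bi-invariant metric on SL(n,ℤ) is bounded: for every metric d on SL(n,ℤ) satisfying d(kg, kh) = d(g, h) = d(gk, hk) for all g, h, k ∈ SL(n,ℤ), there exists a constant C with d(g, h) ≤ C for all g, h ∈ SL(n,ℤ). -/
open Matrix

/-- Conjugation-invariant (pseudo-)norms on a group. -/
structure CNorm {G : Type*} [Group G] (ν : G → ℝ) : Prop where
  mul : ∀ g h, ν (g * h) ≤ ν g + ν h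
  inv : ∀ g, ν g⁻¹ = ν g
  conj : ∀ g h, ν (h * g * h⁻¹) = ν g

lemma CNorm.nonneg {G : Type*} [Group G] {ν : G → ℝ} (hν : CNorm ν) (g : G) : 0 ≤ ν g := by
  have h1 := hν.mul 1 1
  have h2 := hν.mul g g⁻¹
  rw [hν.inv] at h2
  simp at h1 h2
  linarith

lemma CNorm.conj_of_eq {G : Type*} [Group G] {ν : G → ℝ} (hν : CNorm ν) {g g' h : G}
    (e : h * g = g' * h) : ν g' = ν g := by
  rw [← hν.conj g h, e]; simp

lemma CNorm.comap {G H : Type*} [Group G] [Group H] {ν : G → ℝ} (hν : CNorm ν) (f : H →* G) :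
    CNorm (fun h => ν (f h)) where
  mul g h := by simpa using hν.mul (f g) (f h)
  inv g := by simpa using hν.inv (f g)
  conj g h := by simpa using hν.conj (f g) (f h)

/-- underlying matrix of the lower right corner embedding -/
def embMat {n : ℕ} (A : Matrix (Fin n) (Fin n) ℤ) : Matrix (Fin (n+1)) (Fin (n+1)) ℤ :=
  Matrix.of (Fin.cons (Fin.cons 1 0) (fun i => Fin.cons 0 (A i)))

@[simp] lemma embMat_zz {n : ℕ} (A : Matrix (Fin n) (Fin n) ℤ) : embMat A 0 0 = 1 := rfl
@[simp] lemma embMat_zs {n : ℕ} (A : Matrix (Fin n) (Fin n) ℤ) (j : Fin n) :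
    embMat A 0 j.succ = 0 := rfl
@[simp] lemma embMat_sz {n : ℕ} (A : Matrix (Fin n) (Fin n) ℤ) (j : Fin n) :
    embMat A j.succ 0 = 0 := rfl
@[simp] lemma embMat_ss {n : ℕ} (A : Matrix (Fin n) (Fin n) ℤ) (i j : Fin n) :
    embMat A i.succ j.succ = A i j := rfl

lemma embMat_det {n : ℕ} (A : Matrix (Fin n) (Fin n) ℤ) : (embMat A).det = A.det := by
  rw [Matrix.det_succ_row_zero, Fin.sum_univ_succ]
  simp
  rfl

lemma embMat_mul {n : ℕ} (A B : Matrix (Fin n) (Fin n) ℤ) :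
    embMat (A * B) = embMat A * embMat B := by
  ext i j
  refine Fin.cases ?_ (fun i => ?_) i <;> refine Fin.cases ?_ (fun j => ?_) j <;>
    simp [Matrix.mul_apply, Fin.sum_univ_succ]

lemma embMat_one {n : ℕ} : embMat (1 : Matrix (Fin n) (Fin n) ℤ) = 1 := by
  ext i j
  refine Fin.cases ?_ (fun i => ?_) i <;> refine Fin.cases ?_ (fun j => ?_) j <;>
    simp [Matrix.one_apply, Fin.succ_ne_zero, (Fin.succ_ne_zero _).symm]

/-- lower right corner embedding -/
def emb (n : ℕ) : SpecialLinearGroup (Fin n) ℤ →* SpecialLinearGroup (Fin (n+1)) ℤ where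
  toFun A := ⟨embMat A.1, by rw [embMat_det]; exact A.2⟩
  map_one' := Subtype.ext embMat_one
  map_mul' A B := Subtype.ext (embMat_mul A.1 B.1)

lemma emb_coe {n : ℕ} (A : SpecialLinearGroup (Fin n) ℤ) : (emb n A).1 = embMat A.1 := rfl

/-- transvections are uniformly bounded -/
lemma transvection_bdd {n : ℕ} (hn : 3 ≤ n) {ν : SpecialLinearGroup (Fin n) ℤ → ℝ}
    (hν : CNorm ν) : ∃ M : ℝ, ∀ (i j : Fin n) (h : i ≠ j) (a : ℤ),
      ν (SpecialLinearGroup.transvection h a) ≤ M := by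
  let f : Fin n → Fin n → ℝ := fun i j =>
    if h : i ≠ j then ν (SpecialLinearGroup.transvection h 1) else 0
  have hf : ∀ i j, 0 ≤ f i j := by
    intro i j
    simp only [f]; split_ifs
    · exact hν.nonneg _
    · rfl
  refine ⟨2 * ∑ i, ∑ j, f i j, fun i j hij a => ?_⟩
  obtain ⟨k, hki, hkj⟩ : ∃ k : Fin n, k ≠ i ∧ k ≠ j := by
    have : ({i, j} : Finset (Fin n)).card < (Finset.univ : Finset (Fin n)).card := by
      simp; exact lt_of_le_of_lt (Finset.card_le_two) (by omega)
    obtain ⟨k, -, hk⟩ := Finset.exists_mem_notMem_of_card_lt_card this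
    simp at hk
    exact ⟨k, hk.1, hk.2⟩
  set X := SpecialLinearGroup.transvection hki.symm a
  set Y := SpecialLinearGroup.transvection hkj (1 : ℤ) with hY
  have e : SpecialLinearGroup.transvection hij a = (X * Y * X⁻¹) * Y⁻¹ := by
    rw [SpecialLinearGroup.transvection_inv, SpecialLinearGroup.transvection_inv]
    apply Subtype.ext
    simp [X, Y, SpecialLinearGroup.transvection_coe, mul_add, add_mul, Matrix.single_mul_single_of_ne,
      hij, hij.symm, hki, hki.symm, hkj, hkj.symm]
    simp only [← Matrix.single_neg]
    abel
  have h1 : ν Y ≤ ∑ i, ∑ j, f i j := by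
    have : ν Y = f k j := by simp [f, hkj, Y]
    rw [this]
    exact (Finset.single_le_sum (fun j _ => hf k j) (Finset.mem_univ j)).trans
      (Finset.single_le_sum (f := fun i => ∑ j, f i j)
        (fun i _ => Finset.sum_nonneg (fun j _ => hf i j)) (Finset.mem_univ k))
  rw [e]
  have := hν.mul (X * Y * X⁻¹) Y⁻¹
  rw [hν.conj, hν.inv] at this
  linarith

/-- two by two matrices -/
def m2 (a b c d : ℤ) (h : a * d - b * c = 1) : SpecialLinearGroup (Fin 2) ℤ :=
  ⟨!![a, b; c, d], by rw [Matrix.det_fin_two_of]; exact h⟩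

lemma m2_coe (a b c d h) : (m2 a b c d h : Matrix (Fin 2) (Fin 2) ℤ) = !![a, b; c, d] := rfl

lemma eq_m2 (A : SpecialLinearGroup (Fin 2) ℤ) :
    A = m2 (A.1 0 0) (A.1 0 1) (A.1 1 0) (A.1 1 1) (by
      have := A.2; rwa [Matrix.det_fin_two] at this) := by
  apply Subtype.ext; ext i j; fin_cases i <;> fin_cases j <;> rfl

/-- The properties of the norm on SL2 inherited from SL3. -/
structure Good (N : SpecialLinearGroup (Fin 2) ℤ → ℝ) (M : ℝ) : Prop where
  norm : CNorm N
  up : ∀ t, N (m2 1 t 0 1 (by ring)) ≤ M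
  low : ∀ t, N (m2 1 0 t 1 (by ring)) ≤ M
  sign : ∀ a b c d h, N (m2 a (-b) (-c) d (by linarith)) = N (m2 a b c d h)
  mul : ∀ a b₁ c₁ d₁ h₁ b₂ c₂ d₂ h₂,
    N (m2 a (b₁ * b₂) (-(c₁ * c₂)) (d₂ - c₂ * d₁ * b₂) (by linear_combination h₂ - c₂ * b₂ * h₁)) ≤
      N (m2 a b₁ c₁ d₁ h₁) + N (m2 a b₂ c₂ d₂ h₂) + M
  sq : ∀ a b c d h,
    N (m2 a (b * b) (-(c * c)) (d - c * d * b) (by linear_combination (1 - b * c) * h)) ≤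
      N (m2 a b c d h ^ 2) + M

lemma m2_mul (a b c d h a' b' c' d' h') : m2 a b c d h * m2 a' b' c' d' h' =
    m2 (a * a' + b * c') (a * b' + b * d') (c * a' + d * c') (c * b' + d * d')
      (by linear_combination h * (a' * d' - b' * c') + h') := by
  apply Subtype.ext
  change !![a, b; c, d] * !![a', b'; c', d'] = !![_, _; _, _]
  simp

lemma m2_congr {a b c d h a' b' c' d' h'} (h1 : a = a') (h2 : b = b') (h3 : c = c') (h4 : d = d') :
    m2 a b c d h = m2 a' b' c' d' h' := by
  subst h1 h2 h3 h4; rfl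

section
variable {N : SpecialLinearGroup (Fin 2) ℤ → ℝ} {M : ℝ}

/-- all matrices with first row `(a,b)` have norm at most `K` -/
def SS (N : SpecialLinearGroup (Fin 2) ℤ → ℝ) (a b : ℤ) (K : ℝ) : Prop :=
  ∀ c d h, N (m2 a b c d h) ≤ K

lemma SS_of (G : Good N M) {a b c d h K} (H : N (m2 a b c d h) ≤ K) : SS N a b (K + M) := by
  intro c' d' h'
  have e : m2 a b c' d' h' = m2 1 0 (d * c' - c * d') 1 (by ring) * m2 a b c d h := by
    rw [m2_mul]
    apply m2_congr
    · ring
    · ring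
    · linear_combination c * h' - c' * h
    · linear_combination d * h' - d' * h
  rw [e]
  have := G.norm.mul (m2 1 0 (d * c' - c * d') 1 (by ring)) (m2 a b c d h)
  linarith [G.low (d * c' - c * d')]

lemma SS_col (G : Good N M) {a b K} (H : SS N a b K) {b'} (hb : a ∣ b' - b) :
    SS N a b' (K + M) := by
  obtain ⟨t, ht⟩ := hb
  obtain rfl : b' = b + a * t := by linarith
  intro c d h
  have h' : a * (d - t * c) - b * c = 1 := by linarith
  have e : m2 a (b + a * t) c d h = m2 a b c (d - t * c) h' * m2 1 t 0 1 (by ring) := by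
    rw [m2_mul]; apply m2_congr <;> ring
  rw [e]
  have := G.norm.mul (m2 a b c (d - t * c) h') (m2 1 t 0 1 (by ring))
  linarith [G.up t, H _ _ h']

lemma SS_col' (G : Good N M) {a b K} (H : SS N a b K) {a'} (hb : b ∣ a' - a) :
    SS N a' b (K + M) := by
  obtain ⟨t, ht⟩ := hb
  obtain rfl : a' = a + b * t := by linarith
  intro c d h
  have h' : a * d - b * (c - t * d) = 1 := by linarith
  have e : m2 (a + b * t) b c d h = m2 a b (c - t * d) d h' * m2 1 0 t 1 (by ring) := by
    rw [m2_mul]; apply m2_congr <;> ring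
  rw [e]
  have := G.norm.mul (m2 a b (c - t * d) d h') (m2 1 0 t 1 (by ring))
  linarith [G.low t, H _ _ h']

lemma SS_one (G : Good N M) {a b : ℤ} (h : b ∣ a - 1) : SS N a b (3 * M) := by
  have := SS_col' G (SS_of G (G.up b)) h
  convert this using 1; ring

lemma SS_neg_one (G : Good N M) {a b : ℤ} (h : b ∣ a + 1) : SS N a b (5 * M) := by
  have h1 : SS N (-1) 1 (3 * M) := SS_one G (one_dvd _)
  have h2 : SS N (-1) b (3 * M + M) := SS_col G h1 (by simp)
  have := SS_col' G h2 (a' := a) (by simpa using h)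
  convert this using 1; ring

lemma SS_neg (G : Good N M) {a b K} (H : SS N a b K) : SS N a (-b) K := by
  intro c d h
  have h' : a * d - b * (-c) = 1 := by linarith
  have := G.sign a b (-c) d h'
  have e : m2 a (-b) c d h = m2 a (-b) (-(-c)) d (by linarith) := by
    apply m2_congr <;> ring
  rw [e, this]
  exact H _ _ _

lemma SS_mul (G : Good N M) {a b₁ b₂ K₁ K₂} (h : IsCoprime a (b₁ * b₂)) (H₁ : SS N a b₁ K₁)
    (H₂ : SS N a b₂ K₂) : SS N a (b₁ * b₂) (K₁ + K₂ + 2 * M) := by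
  obtain ⟨u, v, e⟩ := h
  have h1 : a * u - b₁ * (- (v * b₂)) = 1 := by linarith
  have h2 : a * u - b₂ * (- (v * b₁)) = 1 := by linarith
  have := SS_of G (G.mul a b₁ _ _ h1 b₂ _ _ h2)
  intro c d h
  linarith [this c d h, H₁ _ _ h1, H₂ _ _ h2]

lemma pow_form (a b c d : ℤ) (h) (l : ℕ) : ∃ x y : ℤ, ∃ h', 
    m2 a b c d h ^ l = m2 (x + y * a) (y * b) (y * c) (x + y * d) h' ∧ b ∣ x + y * a - a ^ l := by
  induction l with
  | zero =>
    refine ⟨1, 0, by ring, ?_, by simp⟩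
    apply Subtype.ext; rw [m2_coe]; simp [Matrix.one_fin_two]
  | succ l ih =>
    obtain ⟨x, y, h', e, k, hk⟩ := ih
    have key : (-y + (x + y * (a + d)) * a) * (-y + (x + y * (a + d)) * d)
      - ((x + y * (a + d)) * b) * ((x + y * (a + d)) * c) = 1 := by
      linear_combination h' + ((x + y * (a+d))^2 - y ^2) * h
    refine ⟨-y, x + y * (a + d), key, ?_, ?_⟩
    · rw [pow_succ, e, m2_mul]
      apply m2_congr
      · linear_combination -y * h
      · ring
      · ring
      · linear_combination -y * h
    · refine ⟨a * k + y * c, ?_⟩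
      rw [pow_succ]
      linear_combination a * hk + y * h

lemma pow_bdd (G : Good N M) (a b c d : ℤ) (h) (l : ℕ) (hl : b ∣ a ^ (2 * l) - 1) :
    N (m2 a b c d h ^ (2 * l)) ≤ 15 * M := by
  obtain ⟨x, y, h', e, k, hk⟩ := pow_form a b c d h l
  set t := a + d with ht
  have rel : x ^ 2 + x * y * t + y ^ 2 = 1 := by
    linear_combination h' - y ^ 2 * h
  have key : (x^2 - y^2 + y * (2 * x + y * t) * a) * (x^2 - y^2 + y * (2 * x + y * t) * d)
      - (y * (2 * x + y * t) * b) * (y * (2 * x + y * t) * c) = 1 := by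
    have : (x^2 - y^2 + y * (2 * x + y * t) * a) * (x^2 - y^2 + y * (2 * x + y * t) * d)
      - (y * (2 * x + y * t) * b) * (y * (2 * x + y * t) * c) =
      (x ^ 2 + x * y * t + y ^ 2)^2 + (y * (2 * x + y * t))^2 * (a * d - b * c - 1) := by
      rw [ht]; ring
    rw [this, rel, h]; ring
  have e2 : m2 a b c d h ^ (2 * l) = m2 (x^2 - y^2 + y * (2 * x + y * t) * a)
     (y * (2 * x + y * t) * b) (y * (2 * x + y * t) * c) (x^2 - y^2 + y * (2 * x + y * t) * d) key := by
    rw [two_mul, pow_add, e, m2_mul]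
    apply m2_congr
    · linear_combination -y ^ 2 * h
    · rw [ht]; ring
    · rw [ht]; ring
    · linear_combination -y ^ 2 * h
  rw [e2]
  have cop : IsCoprime (x^2 - y^2 + y * (2 * x + y * t) * a) (y * (2 * x + y * t) * b) :=
    ⟨x^2 - y^2 + y * (2 * x + y * t) * d, -(y * (2 * x + y * t) * c), by linear_combination key⟩
  have s1 : SS N (x^2 - y^2 + y * (2 * x + y * t) * a) y (3 * M) :=
    SS_one G ⟨-x * t - 2 * y + (2 * x + y * t) * a, by linear_combination rel⟩
  have s2 : SS N (x^2 - y^2 + y * (2 * x + y * t) * a) (2 * x + y * t) (5 * M) :=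
    SS_neg_one G ⟨x + y * a, by linear_combination -rel⟩
  have s3 : SS N (x^2 - y^2 + y * (2 * x + y * t) * a) b (3 * M) := by
    apply SS_one G
    obtain ⟨q, hq⟩ := hl
    have hk' : x + y * a = a ^ l + b * k := by linarith
    refine ⟨q + 2 * a ^ l * k + b * k ^ 2 + y ^ 2 * c, ?_⟩
    have : x^2 - y^2 + y * (2 * x + y * t) * a - 1 = (x + y * a)^2 + y ^ 2 * (a * d - 1) - 1 := by
      rw [ht]; ring
    rw [this, hk']
    have hq' : (a ^ l)^2 - 1 = b * q := by rw [← hq]; ring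
    linear_combination hq' + y ^ 2 * h
  have := SS_mul G cop (SS_mul G (cop.of_isCoprime_of_dvd_right ⟨b, rfl⟩) s1 s2) s3
  linarith [this _ _ key]

lemma transpose_eq (G : Good N M) (A : SpecialLinearGroup (Fin 2) ℤ) :
    N A.transpose = N A := by
  rw [← G.norm.inv A]
  apply G.norm.conj_of_eq (h := m2 0 1 (-1) 0 (by norm_num))
  apply Subtype.ext
  ext i j
  fin_cases i <;> fin_cases j <;> simp [m2_coe, Matrix.mul_apply, Fin.sum_univ_two, Matrix.adjugate_fin_two]

lemma NT1 (a b : ℤ) (h : IsCoprime a b) (hb : Odd b) :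
    ∃ p : ℕ, p.Prime ∧ p % 4 = 3 ∧ b ∣ (p : ℤ) - a := by
  obtain ⟨m, rfl⟩ := hb
  have hb0 : (2 * m + 1) ≠ 0 := by omega
  set b := 2 * m + 1 with hb
  set z := a + b ^ 2 * (3 - a) with hz
  have hz4 : ∃ w, z = 4 * w + 3 := ⟨(m ^ 2 + m) * (3 - a), by rw [hz, hb]; ring⟩
  have c1 : IsCoprime z b := by
    have : z = a + b * (b * (3 - a)) := by rw [hz]; ring
    rw [this]; exact h.add_mul_left_left _
  have c2 : IsCoprime z 4 := by
    obtain ⟨w, hw⟩ := hz4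
    exact ⟨-1, w + 1, by rw [hw]; ring⟩
  have c3 : IsCoprime z ((4 * b.natAbs : ℕ) : ℤ) := by
    push_cast
    refine c2.mul_right ?_
    rcases abs_choice b with h | h <;> rw [h]
    · exact c1
    · exact c1.neg_right
  obtain ⟨p, -, hp, hpz⟩ := Nat.forall_exists_prime_gt_and_zmodEq 0 (by simpa using hb0) c3
  have hd := hpz.symm.dvd
  push_cast at hd
  refine ⟨p, hp, ?_, ?_⟩
  · have h4 : (4 : ℤ) ∣ p - z := (Dvd.intro _ rfl).trans hd
    obtain ⟨w, hw⟩ := hz4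
    omega
  · have h5 : b ∣ (p : ℤ) - z := by
      have : |b| ∣ (p : ℤ) - z := (Dvd.intro_left _ rfl).trans hd
      rwa [abs_dvd] at this
    have : (p : ℤ) - a = (p - z) + b * (b * (3 - a)) := by rw [hz]; ring
    rw [this]
    exact dvd_add h5 (Dvd.intro _ rfl)

lemma NT2 (p : ℕ) (hp : p.Prime) (h4 : p % 4 = 3) (b : ℤ) (hb : ¬ (p : ℤ) ∣ b) :
    ∃ s : ℕ, 0 < s ∧ s < p ∧ ((p : ℤ) ∣ b - s * s ∨ (p : ℤ) ∣ b - (-(s * s : ℤ))) := by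
  haveI := Fact.mk hp
  have hb0 : (b : ZMod p) ≠ 0 := by rwa [Ne, ZMod.intCast_zmod_eq_zero_iff_dvd]
  set s : ZMod p := (b : ZMod p) ^ ((p + 1) / 4) with hs
  have hs0 : s ≠ 0 := pow_ne_zero _ hb0
  have hss : s * s = (b : ZMod p) ^ (p / 2) * b := by
    rw [hs, ← pow_add, ← pow_succ]
    congr 1; omega
  refine ⟨s.val, ?_, ZMod.val_lt s, ?_⟩
  · rw [Nat.pos_iff_ne_zero, Ne, ZMod.val_eq_zero]; exact hs0
  · rw [← ZMod.intCast_zmod_eq_zero_iff_dvd, ← ZMod.intCast_zmod_eq_zero_iff_dvd]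
    push_cast
    rw [ZMod.natCast_zmod_val, hss]
    rcases ZMod.pow_div_two_eq_neg_one_or_one p hb0 with h | h <;> rw [h]
    · left; ring
    · right; ring

lemma NT3 (p s : ℕ) (hp : p.Prime) (hs : 0 < s) (hsp : s < p) :
    ∃ r : ℕ, r.Prime ∧ 2 < r ∧ (p : ℤ) ∣ s * r + 1 ∧ s.totient ∣ r + 1 := by
  set f := s.totient with hf
  have hf0 : 0 < f := Nat.totient_pos.2 hs
  have hfp : f < p := (Nat.totient_le s).trans_lt hsp
  have c1 : IsCoprime (p : ℤ) f := by
    rw [Nat.isCoprime_iff_coprime]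
    exact Nat.coprime_of_lt_prime hf0.ne' hfp hp
  have c2 : IsCoprime (s : ℤ) p := by
    rw [Nat.isCoprime_iff_coprime]
    exact (Nat.coprime_of_lt_prime hs.ne' hsp hp).symm
  obtain ⟨u, v, huv⟩ := c1
  obtain ⟨i, j, hij⟩ := c2
  set z := -(i * v * f + u * p) with hz
  have z1 : IsCoprime z f := ⟨-1, v * (1 - i), by rw [hz]; linear_combination huv⟩
  have z2' : z * s + 1 = p * (j + i * s * u - u * s) := by
    rw [hz]; linear_combination -i * s * huv  - hij
  have z2 : IsCoprime z p := ⟨-s, (j + i * s * u - u * s), by linear_combination -z2'⟩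
  have z3 : IsCoprime z ((p * f : ℕ) : ℤ) := by push_cast; exact z2.mul_right z1
  obtain ⟨r, hr2, hr, hrz⟩ := Nat.forall_exists_prime_gt_and_zmodEq 2
    (Nat.mul_ne_zero hp.ne_zero hf0.ne') z3
  have hd := hrz.symm.dvd
  push_cast at hd
  refine ⟨r, hr, hr2, ?_, ?_⟩
  · have h5 : (p : ℤ) ∣ r - z := (Dvd.intro _ rfl).trans hd
    have : (s : ℤ) * r + 1 = s * (r - z) + p * (j + i * s * u - u * s) := by
      linear_combination z2'
    rw [this]
    exact dvd_add (h5.mul_left _) (Dvd.intro _ rfl)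
  · have h5 : (f : ℤ) ∣ r - z := (Dvd.intro_left _ rfl).trans hd
    have : ((r + 1 : ℕ) : ℤ) = (r - z) + f * (v * (1 - i)) := by
      push_cast; rw [hz]; linear_combination -huv
    rw [← Int.natCast_dvd_natCast, this]
    exact dvd_add h5 (Dvd.intro _ rfl)

lemma sq_bdd (G : Good N M) (p s : ℕ) (hp : p.Prime) (hs : 0 < s) (hsp : s < p) :
    SS N p (s * s) (32 * M) := by
  obtain ⟨r, hr, hr2, ⟨d, hd⟩, m, hm⟩ := NT3 p s hp hs hsp
  have hdet : (p : ℤ) * d - s * r = 1 := by linarith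
  have hdet' : (p : ℤ) * d - r * s = 1 := by linarith
  obtain ⟨l, hl⟩ : ∃ l, r = 2 * l + 1 := hr.odd_of_ne_two (by omega)
  have cps : p.Coprime s := Nat.coprime_of_lt_prime hs.ne' hsp hp
  have b1 : N (m2 p s r d hdet ^ (2 * (l + 1))) ≤ 15 * M := by
    apply pow_bdd G
    have h1 : p ^ (r + 1) ≡ 1 [MOD s] := by
      rw [hm, pow_mul]
      simpa using (Nat.ModEq.pow_totient cps).pow m
    have : 2 * (l + 1) = r + 1 := by omega
    rw [this]
    have := (Int.natCast_modEq_iff.2 h1).symm.dvd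
    simpa using this
  have b2 : N (m2 p s r d hdet ^ (2 * l)) ≤ 15 * M := by
    have e : (m2 p s r d hdet ^ (2 * l)) = (m2 p r s d hdet' ^ (2 * l)).transpose := by
      have e0 : !![(p : ℤ), s; r, d] = !![(p : ℤ), r; s, d]ᵀ := by
        ext i j
        fin_cases i <;> fin_cases j <;> rfl
      apply Subtype.ext
      have e1 : (m2 p s r d hdet ^ (2 * l)).1 = !![(p : ℤ), s; r, d] ^ (2 * l) :=
        Matrix.SpecialLinearGroup.coe_pow _ _
      have e2 : (m2 p r s d hdet' ^ (2 * l)).1 = !![(p : ℤ), r; s, d] ^ (2 * l) :=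
        Matrix.SpecialLinearGroup.coe_pow _ _
      change (m2 p s r d hdet ^ (2 * l)).1 = (m2 p r s d hdet' ^ (2 * l)).1ᵀ
      rw [e1, e2, e0, Matrix.transpose_pow]
    rw [e, transpose_eq G]
    apply pow_bdd G
    have cpr : IsCoprime (p : ℤ) r := ⟨d, -s, by linarith⟩
    have := (Int.ModEq.pow_card_sub_one_eq_one hr cpr).symm.dvd
    have e : r - 1 = 2 * l := by omega
    rwa [e] at this
  have b3 : N (m2 p s r d hdet ^ 2) ≤ 30 * M := by
    have e : m2 p s r d hdet ^ 2 = m2 p s r d hdet ^ (2 * (l + 1)) * (m2 p s r d hdet ^ (2 * l))⁻¹ := by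
      rw [eq_mul_inv_iff_mul_eq, ← pow_add]; congr 1; ring
    rw [e]
    have := G.norm.mul (m2 p s r d hdet ^ (2 * (l + 1))) (m2 p s r d hdet ^ (2 * l))⁻¹
    rw [G.norm.inv] at this
    linarith
  have := SS_of G (G.sq _ _ _ _ hdet)
  intro c' d' h'
  linarith [this c' d' h']

lemma odd_bdd (G : Good N M) (a b : ℤ) (h : IsCoprime a b) (hb : Odd b) : SS N a b (34 * M) := by
  obtain ⟨p, hp, hp4, hpa⟩ := NT1 a b h hb
  have hpb : IsCoprime (p : ℤ) b := by
    obtain ⟨k, hk⟩ := hpa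
    have : (p : ℤ) = a + b * k := by linarith
    rw [this]; exact h.add_mul_left_left _
  have hndvd : ¬ (p : ℤ) ∣ b := by
    intro hd
    have := hpb.isUnit_of_dvd' dvd_rfl hd
    rw [Int.isUnit_iff] at this
    have := hp.two_le
    omega
  obtain ⟨s, hs, hsp, hh⟩ := NT2 p hp hp4 b hndvd
  have h1 := sq_bdd G p s hp hs hsp
  have h2 : SS N p b (32 * M + M) := by
    rcases hh with hh | hh
    · exact SS_col G h1 hh
    · exact SS_col G (SS_neg G h1) hh
  have := SS_col' G h2 (a' := a) (by rw [← neg_sub, dvd_neg]; exact hpa)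
  convert this using 1; ring

theorem good_bdd (G : Good N M) (A) : N A ≤ 35 * M := by
  have hM : 0 ≤ M := (G.norm.nonneg _).trans (G.up 0)
  obtain ⟨a, b, c, d, h, rfl⟩ : ∃ a b c d h, A = m2 a b c d h := ⟨_, _, _, _, _, eq_m2 A⟩
  have cop : IsCoprime a b := ⟨d, -c, by linarith⟩
  rcases Int.even_or_odd b with hb | hb
  · have ha : Odd a := by
      rw [← Int.not_even_iff_odd]
      intro ha
      have : Even (a * d - b * c) := (ha.mul_right d).sub (hb.mul_right c)
      rw [h] at this
      exact absurd this (by decide)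
    have h1 := odd_bdd G a (b + a * 1) (cop.add_mul_left_right 1) (by simpa using hb.add_odd ha)
    have := SS_col G h1 (b' := b) ⟨-1, by ring⟩ c d h
    linarith
  · linarith [odd_bdd G a b cop hb c d h]

end

/-- three by three matrices -/
def m3 (A : Matrix (Fin 3) (Fin 3) ℤ) (h : A.det = 1) : SpecialLinearGroup (Fin 3) ℤ := ⟨A, h⟩

lemma emb2 (a b c d h) : emb 2 (m2 a b c d h) = m3 !![1, 0, 0; 0, a, b; 0, c, d]
    (by simp [Matrix.det_fin_three]; linarith) := by
  apply Subtype.ext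
  change embMat !![a, b; c, d] = !![1, 0, 0; 0, a, b; 0, c, d]
  ext i j
  fin_cases i <;> fin_cases j <;> rfl

lemma m3_tv {i j : Fin 3} (hij : i ≠ j) (t : ℤ) (A h) (hA : A = Matrix.transvection i j t) :
    m3 A h = SpecialLinearGroup.transvection hij t := by
  subst hA; rfl

lemma m3_mul (A B h h') : m3 A h * m3 B h' = m3 (A * B) (by rw [Matrix.det_mul, h, h', one_mul]) := rfl

lemma m3_congr {A B h h'} (e : A = B) : m3 A h = m3 B h' := by subst e; rfl

/-- U: positions 0,1 -/
def mU (a b c d : ℤ) (h : a * d - b * c = 1) : SpecialLinearGroup (Fin 3) ℤ :=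
  m3 !![a, b, 0; c, d, 0; 0, 0, 1] (by simp [Matrix.det_fin_three]; linarith)
/-- W: positions 0,2 -/
def mW (a b c d : ℤ) (h : a * d - b * c = 1) : SpecialLinearGroup (Fin 3) ℤ :=
  m3 !![a, 0, b; 0, 1, 0; c, 0, d] (by simp [Matrix.det_fin_three]; linarith)

/-- cyclic permutation -/
def sig : SpecialLinearGroup (Fin 3) ℤ := m3 !![0, 1, 0; 0, 0, 1; 1, 0, 0] (by simp [Matrix.det_fin_three])
/-- signed transposition -/
def tau : SpecialLinearGroup (Fin 3) ℤ := m3 !![0, 1, 0; -1, 0, 0; 0, 0, 1] (by simp [Matrix.det_fin_three])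
/-- sign change -/
def eps : SpecialLinearGroup (Fin 3) ℤ := m3 !![-1, 0, 0; 0, 1, 0; 0, 0, -1] (by simp [Matrix.det_fin_three])

lemma sig_U (a b c d h) : sig * emb 2 (m2 a b c d h) = mU a b c d h * sig := by
  rw [emb2, sig, mU, m3_mul, m3_mul]
  apply m3_congr
  ext i j; fin_cases i <;> fin_cases j <;> simp [Matrix.mul_apply, Fin.sum_univ_three]

lemma tau_W (a b c d h) : tau * emb 2 (m2 a b c d h) = mW a b c d h * tau := by
  rw [emb2, tau, mW, m3_mul, m3_mul]
  apply m3_congr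
  ext i j; fin_cases i <;> fin_cases j <;> simp [Matrix.mul_apply, Fin.sum_univ_three]

lemma eps_sign (a b c d h) : eps * emb 2 (m2 a b c d h) = emb 2 (m2 a (-b) (-c) d (by linarith)) * eps := by
  rw [emb2, emb2, eps, m3_mul, m3_mul]
  apply m3_congr
  ext i j; fin_cases i <;> fin_cases j <;> simp [Matrix.mul_apply, Fin.sum_univ_three]

lemma mul_rel (a b₁ c₁ d₁ h₁ b₂ c₂ d₂ h₂ h) :
    mW a (b₁ * b₂) (-(c₁ * c₂)) (d₂ - c₂ * d₁ * b₂) h =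
    SpecialLinearGroup.transvection (show (2 : Fin 3) ≠ 1 by decide) (-c₂) *
      (mU a b₁ c₁ d₁ h₁ * emb 2 (m2 a b₂ c₂ d₂ h₂)) *
      SpecialLinearGroup.transvection (show (0 : Fin 3) ≠ 1 by decide) (-b₁) *
      SpecialLinearGroup.transvection (show (1 : Fin 3) ≠ 0 by decide) (-c₁) *
      SpecialLinearGroup.transvection (show (1 : Fin 3) ≠ 2 by decide) (-(d₁ * b₂)) := by
  rw [emb2, mU, mW]
  rw [← m3_tv (A := !![1, 0, 0; 0, 1, 0; 0, -c₂, 1]) (h := by simp [Matrix.det_fin_three]),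
    ← m3_tv (A := !![1, -b₁, 0; 0, 1, 0; 0, 0, 1]) (h := by simp [Matrix.det_fin_three]),
    ← m3_tv (A := !![1, 0, 0; -c₁, 1, 0; 0, 0, 1]) (h := by simp [Matrix.det_fin_three]),
    ← m3_tv (A := !![1, 0, 0; 0, 1, -(d₁ * b₂); 0, 0, 1]) (h := by simp [Matrix.det_fin_three])]
  · rw [m3_mul, m3_mul, m3_mul, m3_mul, m3_mul]
    apply m3_congr
    have h₁' : a * d₁ = 1 + b₁ * c₁ := by linarith
    have h₂' : a * d₂ = 1 + b₂ * c₂ := by linarith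
    ext i j; fin_cases i <;> fin_cases j <;> simp [Matrix.mul_apply, Fin.sum_univ_three]
    all_goals grind
  all_goals
    ext i j; fin_cases i <;> fin_cases j <;> simp [Matrix.transvection, Matrix.single]

lemma good3 {ν : SpecialLinearGroup (Fin 3) ℤ → ℝ} (hν : CNorm ν) :
    ∃ M, Good (fun A => ν (emb 2 A)) M := by
  obtain ⟨M, hM⟩ := transvection_bdd le_rfl hν
  have hM0 : 0 ≤ M := (hν.nonneg _).trans (hM 0 1 (by decide) 0)
  have hw := hν.nonneg sig
  have key : ∀ a b₁ c₁ d₁ h₁ b₂ c₂ d₂ h₂ h,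
      ν (emb 2 (m2 a (b₁ * b₂) (-(c₁ * c₂)) (d₂ - c₂ * d₁ * b₂) h)) ≤
      ν (mU a b₁ c₁ d₁ h₁ * emb 2 (m2 a b₂ c₂ d₂ h₂)) + 4 * M := by
    intro a b₁ c₁ d₁ h₁ b₂ c₂ d₂ h₂ h
    rw [← hν.conj_of_eq (tau_W _ _ _ _ _), mul_rel a b₁ c₁ d₁ h₁ b₂ c₂ d₂ h₂]
    refine (hν.mul _ _).trans ?_
    refine (add_le_add_left (hν.mul _ _) _).trans ?_
    refine (add_le_add_left (add_le_add_left (hν.mul _ _) _) _).trans ?_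
    refine (add_le_add_left (add_le_add_left (add_le_add_left (hν.mul _ _) _) _) _).trans ?_
    linarith [hM 2 1 (by decide) (-c₂), hM 0 1 (by decide) (-b₁), hM 1 0 (by decide) (-c₁),
      hM 1 2 (by decide) (-(d₁ * b₂))]
  refine ⟨4 * M + 2 * ν sig, hν.comap _, ?_, ?_, ?_, ?_, ?_⟩
  · intro t
    have : emb 2 (m2 1 t 0 1 (by ring)) =
        SpecialLinearGroup.transvection (show (1 : Fin 3) ≠ 2 by decide) t := by
      rw [emb2]
      apply m3_tv
      ext i j; fin_cases i <;> fin_cases j <;> simp [Matrix.transvection, Matrix.single]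
    simp only [this]
    linarith [hM 1 2 (by decide) t]
  · intro t
    have : emb 2 (m2 1 0 t 1 (by ring)) =
        SpecialLinearGroup.transvection (show (2 : Fin 3) ≠ 1 by decide) t := by
      rw [emb2]
      apply m3_tv
      ext i j; fin_cases i <;> fin_cases j <;> simp [Matrix.transvection, Matrix.single]
    simp only [this]
    linarith [hM 2 1 (by decide) t]
  · intro a b c d h
    exact hν.conj_of_eq (eps_sign a b c d h)
  · intro a b₁ c₁ d₁ h₁ b₂ c₂ d₂ h₂
    have h1 := key a b₁ c₁ d₁ h₁ b₂ c₂ d₂ h₂ (by linear_combination h₂ - c₂ * b₂ * h₁)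
    have h2 := hν.mul (mU a b₁ c₁ d₁ h₁) (emb 2 (m2 a b₂ c₂ d₂ h₂))
    rw [hν.conj_of_eq (sig_U a b₁ c₁ d₁ h₁)] at h2
    linarith
  · intro a b c d h
    have h1 := key a b c d h b c d h (by linear_combination (1 - b * c) * h)
    have e : mU a b c d h = sig * emb 2 (m2 a b c d h) * sig⁻¹ := by
      rw [sig_U]; simp
    set V := emb 2 (m2 a b c d h) with hV
    have e2 : mU a b c d h * V = sig * (V * sig⁻¹ * V⁻¹) * (V * V) := by
      rw [e]; group
    have e3 : emb 2 (m2 a b c d h ^ 2) = V * V := by rw [map_pow, pow_two]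
    have h2 := hν.mul (sig * (V * sig⁻¹ * V⁻¹)) (V * V)
    have h3 := hν.mul sig (V * sig⁻¹ * V⁻¹)
    rw [hν.conj, hν.inv] at h3
    rw [e3]
    rw [e2] at h1
    linarith

lemma bdd_two {ν : SpecialLinearGroup (Fin 3) ℤ → ℝ} (hν : CNorm ν) :
    ∃ C, ∀ A, ν (emb 2 A) ≤ C := by
  obtain ⟨M, G⟩ := good3 hν
  exact ⟨_, good_bdd G⟩

lemma NT4 (x y h : ℤ) (hh : h ≠ 0) (u v w : ℤ) (e : u * x + v * y + w * h = 1) :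
    ∃ t, IsCoprime (x + t * y) h := by
  classical
  set T : Finset ℕ := h.natAbs.primeFactors.filter (fun q => ¬ (q : ℤ) ∣ x) with hT
  obtain ⟨P, hP⟩ : ∃ P : ℕ, P = ∏ q ∈ T, q := ⟨_, rfl⟩
  refine ⟨(P : ℤ), ?_⟩
  rw [Int.isCoprime_iff_gcd_eq_one, Int.gcd_eq_natAbs, ← Nat.coprime_iff_gcd_eq_one]
  apply Nat.Coprime.symm
  apply Nat.coprime_of_dvd
  intro q hq hqh hqx
  have hqh' : (q : ℤ) ∣ h := Int.natCast_dvd.2 hqh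
  have hqx2 : (q : ℤ) ∣ x + (P : ℤ) * y := Int.natCast_dvd.2 hqx
  have hqp : Prime (q : ℤ) := Nat.prime_iff_prime_int.1 hq
  by_cases hx : (q : ℤ) ∣ x
  · have h1 : (q : ℤ) ∣ (P : ℤ) * y := (dvd_add_right hx).1 hqx2
    rcases hqp.dvd_or_dvd h1 with h2 | h2
    · rw [Int.natCast_dvd_natCast, hP, hq.prime.dvd_finsetProd_iff] at h2
      obtain ⟨q', hq', hd⟩ := h2
      rw [hT, Finset.mem_filter] at hq'
      have := (Nat.prime_dvd_prime_iff_eq hq (Nat.prime_of_mem_primeFactors hq'.1)).1 hd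
      subst this
      exact hq'.2 hx
    · apply hqp.not_dvd_one
      rw [← e]
      exact dvd_add (dvd_add (hx.mul_left _) (h2.mul_left _)) (hqh'.mul_left _)
  · have hmem : q ∈ T := by
      rw [hT, Finset.mem_filter]
      exact ⟨Nat.mem_primeFactors.2 ⟨hq, hqh, by simpa using hh⟩, hx⟩
    have : (q : ℤ) ∣ (P : ℤ) := by
      rw [Int.natCast_dvd_natCast, hP]; exact Finset.dvd_prod_of_mem (fun q => q) hmem
    exact hx ((dvd_add_left (this.mul_right y)).1 hqx2)

/-- stable range condition for the integers -/
lemma stable_range {k : ℕ} (v0 : ℤ) (v : Fin (k + 2) → ℤ) (a0 : ℤ) (a : Fin (k + 2) → ℤ)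
    (e : a0 * v0 + ∑ i, a i * v i = 1) :
    ∃ w c : Fin (k + 2) → ℤ, ∑ i, c i * (v i + v0 * w i) = 1 := by
  rw [Fin.sum_univ_succ] at e
  let I : Submodule ℤ ℤ := Submodule.span ℤ (Set.range fun i : Fin (k + 1) => v i.succ)
  set h := Submodule.IsPrincipal.generator I with hh
  have hI : h ∈ I := Submodule.IsPrincipal.generator_mem I
  have hdvd : ∀ i : Fin (k + 1), h ∣ v i.succ := fun i =>
    (Submodule.IsPrincipal.mem_iff_generator_dvd I).1 (Submodule.subset_span ⟨i, rfl⟩)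
  obtain ⟨f, hf⟩ := (Submodule.mem_span_range_iff_exists_fun ℤ).1 hI
  obtain ⟨q, hq⟩ : h ∣ ∑ i : Fin (k + 1), a i.succ * v i.succ :=
    Finset.dvd_sum fun i _ => (hdvd i).mul_left _
  by_cases h0 : h = 0
  · have hv : ∀ i : Fin (k + 1), v i.succ = 0 := fun i => by
      have := hdvd i; rwa [h0, zero_dvd_iff] at this
    refine ⟨Fin.cons 0 (Fin.cons 1 0), Fin.cons (a 0) (Fin.cons a0 0), ?_⟩
    rw [Fin.sum_univ_succ, Fin.sum_univ_succ]
    have hv1 : v 1 = 0 := hv 0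
    simp [hv, hv1] at e ⊢
    linarith
  · obtain ⟨t, α, β, ht⟩ := NT4 (v 0) v0 h h0 (a 0) a0 q (by rw [hq] at e; linarith)
    refine ⟨Fin.cons t 0, Fin.cons α (fun i => β * f i), ?_⟩
    rw [Fin.sum_univ_succ]
    simp only [Fin.cons_zero, Fin.cons_succ, Pi.zero_apply, mul_zero, add_zero]
    simp only [smul_eq_mul] at hf
    simp only [mul_assoc]
    rw [← Finset.mul_sum, hf]
    linarith

section
variable {n : ℕ} {ν : SpecialLinearGroup (Fin (n + 1)) ℤ → ℝ} {M : ℝ}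

lemma row_exists (hν : CNorm ν)
    (hM : ∀ (i j : Fin (n + 1)) (h : i ≠ j) (a : ℤ), ν (SpecialLinearGroup.transvection h a) ≤ M)
    (w : Fin n → ℤ) (s : Finset (Fin n)) :
    ∃ X : SpecialLinearGroup (Fin (n + 1)) ℤ, ν X ≤ ν 1 + s.card * M ∧
      (X : Matrix (Fin (n + 1)) (Fin (n + 1)) ℤ) = 1 + ∑ i ∈ s, Matrix.single 0 i.succ (w i) := by
  classical
  induction s using Finset.induction_on with
  | empty => exact ⟨1, by simp, by simp⟩
  | insert i s hi ih =>
    obtain ⟨X, hX, e⟩ := ih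
    have h0 : (0 : Fin (n + 1)) ≠ i.succ := (Fin.succ_ne_zero i).symm
    refine ⟨X * SpecialLinearGroup.transvection h0 (w i), ?_, ?_⟩
    · have := hν.mul X (SpecialLinearGroup.transvection h0 (w i))
      rw [Finset.card_insert_of_notMem hi]
      push_cast
      linarith [hM _ _ h0 (w i)]
    · rw [Matrix.SpecialLinearGroup.coe_mul, e, SpecialLinearGroup.transvection_coe, Finset.sum_insert hi,
        mul_add, mul_one, add_mul, one_mul, Finset.sum_mul, Finset.sum_eq_zero (s := s)
          (f := fun j => Matrix.single 0 j.succ (w j) * Matrix.single 0 i.succ (w i))]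
      · abel
      · intro j _
        exact Matrix.single_mul_single_of_ne _ _ _ _ (Fin.succ_ne_zero j) _

lemma col_exists (hν : CNorm ν)
    (hM : ∀ (i j : Fin (n + 1)) (h : i ≠ j) (a : ℤ), ν (SpecialLinearGroup.transvection h a) ≤ M)
    (w : Fin n → ℤ) (s : Finset (Fin n)) :
    ∃ X : SpecialLinearGroup (Fin (n + 1)) ℤ, ν X ≤ ν 1 + s.card * M ∧
      (X : Matrix (Fin (n + 1)) (Fin (n + 1)) ℤ) = 1 + ∑ i ∈ s, Matrix.single i.succ 0 (w i) := by
  classical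
  induction s using Finset.induction_on with
  | empty => exact ⟨1, by simp, by simp⟩
  | insert i s hi ih =>
    obtain ⟨X, hX, e⟩ := ih
    have h0 : i.succ ≠ (0 : Fin (n + 1)) := Fin.succ_ne_zero i
    refine ⟨X * SpecialLinearGroup.transvection h0 (w i), ?_, ?_⟩
    · have := hν.mul X (SpecialLinearGroup.transvection h0 (w i))
      rw [Finset.card_insert_of_notMem hi]
      push_cast
      linarith [hM _ _ h0 (w i)]
    · rw [Matrix.SpecialLinearGroup.coe_mul, e, SpecialLinearGroup.transvection_coe, Finset.sum_insert hi,
        mul_add, mul_one, add_mul, one_mul, Finset.sum_mul, Finset.sum_eq_zero (s := s)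
          (f := fun j => Matrix.single j.succ 0 (w j) * Matrix.single i.succ 0 (w i))]
      · abel
      · intro j _
        exact Matrix.single_mul_single_of_ne _ _ _ _ h0.symm _

lemma row_op (hν : CNorm ν)
    (hM : ∀ (i j : Fin (n + 1)) (h : i ≠ j) (a : ℤ), ν (SpecialLinearGroup.transvection h a) ≤ M)
    (w : Fin n → ℤ) (g : SpecialLinearGroup (Fin (n + 1)) ℤ) :
    ∃ g' : SpecialLinearGroup (Fin (n + 1)) ℤ, ν g ≤ ν g' + (ν 1 + n * M) ∧
      (∀ i, g' i 0 = g i 0) ∧ (∀ i j, g' i (Fin.succ j) = g i (Fin.succ j) + g i 0 * w j) := by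
  obtain ⟨X, hX, e⟩ := row_exists hν hM w Finset.univ
  rw [Finset.card_univ, Fintype.card_fin] at hX
  refine ⟨g * X, ?_, ?_, ?_⟩
  · have := hν.mul (g * X) X⁻¹
    rw [hν.inv, mul_inv_cancel_right] at this
    linarith
  · intro i
    rw [Matrix.SpecialLinearGroup.coe_mul, e, Matrix.mul_apply, Fin.sum_univ_succ]
    simp [Matrix.sum_apply, Matrix.single_apply, Matrix.one_apply, Fin.succ_ne_zero]
  · intro i j
    rw [Matrix.SpecialLinearGroup.coe_mul, e, Matrix.mul_apply, Fin.sum_univ_succ]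
    simp [Matrix.sum_apply, Matrix.single_apply, Matrix.one_apply, Fin.succ_ne_zero,
      (Fin.succ_ne_zero _).symm]
    ring

lemma col_op (hν : CNorm ν)
    (hM : ∀ (i j : Fin (n + 1)) (h : i ≠ j) (a : ℤ), ν (SpecialLinearGroup.transvection h a) ≤ M)
    (w : Fin n → ℤ) (g : SpecialLinearGroup (Fin (n + 1)) ℤ) :
    ∃ g' : SpecialLinearGroup (Fin (n + 1)) ℤ, ν g ≤ ν g' + (ν 1 + n * M) ∧
      (∀ i, g' i 0 = g i 0 + ∑ j, g i (Fin.succ j) * w j) ∧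
      (∀ i j, g' i (Fin.succ j) = g i (Fin.succ j)) := by
  obtain ⟨X, hX, e⟩ := col_exists hν hM w Finset.univ
  rw [Finset.card_univ, Fintype.card_fin] at hX
  refine ⟨g * X, ?_, ?_, ?_⟩
  · have := hν.mul (g * X) X⁻¹
    rw [hν.inv, mul_inv_cancel_right] at this
    linarith
  · intro i
    rw [Matrix.SpecialLinearGroup.coe_mul, e, Matrix.mul_apply, Fin.sum_univ_succ]
    simp [Matrix.sum_apply, Matrix.single_apply, Matrix.one_apply, Fin.succ_ne_zero,
      (Fin.succ_ne_zero _).symm]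
  · intro i j
    rw [Matrix.SpecialLinearGroup.coe_mul, e, Matrix.mul_apply, Fin.sum_univ_succ]
    simp [Matrix.sum_apply, Matrix.single_apply, Matrix.one_apply, Fin.succ_ne_zero,
      (Fin.succ_ne_zero _).symm]

lemma lcol_op (hν : CNorm ν)
    (hM : ∀ (i j : Fin (n + 1)) (h : i ≠ j) (a : ℤ), ν (SpecialLinearGroup.transvection h a) ≤ M)
    (w : Fin n → ℤ) (g : SpecialLinearGroup (Fin (n + 1)) ℤ) :
    ∃ g' : SpecialLinearGroup (Fin (n + 1)) ℤ, ν g ≤ ν g' + (ν 1 + n * M) ∧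
      (∀ j, g' 0 j = g 0 j) ∧ (∀ i j, g' (Fin.succ i) j = g (Fin.succ i) j + w i * g 0 j) := by
  obtain ⟨X, hX, e⟩ := col_exists hν hM w Finset.univ
  rw [Finset.card_univ, Fintype.card_fin] at hX
  refine ⟨X * g, ?_, ?_, ?_⟩
  · have := hν.mul X⁻¹ (X * g)
    rw [hν.inv, inv_mul_cancel_left] at this
    linarith
  · intro i
    rw [Matrix.SpecialLinearGroup.coe_mul, e, Matrix.mul_apply, Fin.sum_univ_succ]
    simp [Matrix.sum_apply, Matrix.single_apply, Matrix.one_apply, Fin.succ_ne_zero,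
      (Fin.succ_ne_zero _).symm]
  · intro i j
    rw [Matrix.SpecialLinearGroup.coe_mul, e, Matrix.mul_apply, Fin.sum_univ_succ]
    simp [Matrix.sum_apply, Matrix.single_apply, Matrix.one_apply, Fin.succ_ne_zero,
      (Fin.succ_ne_zero _).symm]
    ring

lemma eq_emb (g : SpecialLinearGroup (Fin (n + 1)) ℤ) (h00 : g 0 0 = 1)
    (hr : ∀ j, g 0 (Fin.succ j) = 0) (hc : ∀ i, g (Fin.succ i) 0 = 0) : ∃ h, g = emb n h := by
  have e : (g : Matrix (Fin (n + 1)) (Fin (n + 1)) ℤ) =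
      embMat (Matrix.of fun i j => g (Fin.succ i) (Fin.succ j)) := by
    ext i j
    refine Fin.cases ?_ (fun i => ?_) i <;> refine Fin.cases ?_ (fun j => ?_) j
    · exact h00
    · exact hr j
    · exact hc i
    · rfl
  refine ⟨⟨Matrix.of fun i j => g (Fin.succ i) (Fin.succ j), ?_⟩, Subtype.ext e⟩
  rw [← embMat_det, ← e]
  exact g.2

end

lemma reduction {k : ℕ} {ν : SpecialLinearGroup (Fin (k + 3)) ℤ → ℝ} (hν : CNorm ν)
    (hC : ∃ C, ∀ h, ν (emb (k + 2) h) ≤ C) : ∃ C, ∀ g, ν g ≤ C := by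
  obtain ⟨M, hM⟩ := transvection_bdd (by omega) hν
  obtain ⟨C, hC⟩ := hC
  refine ⟨C + 4 * (ν 1 + ((k + 2 : ℕ) : ℝ) * M), fun g => ?_⟩
  have e : g 0 0 * (g⁻¹ : SpecialLinearGroup (Fin (k + 3)) ℤ) 0 0 +
      ∑ i : Fin (k + 2), g 0 i.succ * (g⁻¹ : SpecialLinearGroup (Fin (k + 3)) ℤ) i.succ 0 = 1 := by
    have : ((g * g⁻¹ : SpecialLinearGroup (Fin (k + 3)) ℤ) : Matrix (Fin (k + 3)) (Fin (k + 3)) ℤ) 0 0 = 1 := by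
      rw [mul_inv_cancel]; simp
    rwa [Matrix.SpecialLinearGroup.coe_mul, Matrix.mul_apply, Fin.sum_univ_succ] at this
  obtain ⟨w, c, hwc⟩ := stable_range (g 0 0) (fun i => g 0 i.succ)
    ((g⁻¹ : SpecialLinearGroup (Fin (k + 3)) ℤ) 0 0)
    (fun i => (g⁻¹ : SpecialLinearGroup (Fin (k + 3)) ℤ) i.succ 0)
    (by
      rw [mul_comm]
      refine Eq.trans ?_ e
      congr 1
      exact Finset.sum_congr rfl fun i _ => mul_comm _ _)
  obtain ⟨g₁, n₁, z₁, s₁⟩ := row_op hν hM w g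
  obtain ⟨g₂, n₂, z₂, s₂⟩ := col_op hν hM (fun i => (1 - g 0 0) * c i) g₁
  have h2 : g₂ 0 0 = 1 := by
    rw [z₂, z₁]
    have : ∑ j, g₁ 0 (Fin.succ j) * ((1 - g 0 0) * c j) =
        (1 - g 0 0) * ∑ i, c i * (g 0 i.succ + g 0 0 * w i) := by
      rw [Finset.mul_sum]
      refine Finset.sum_congr rfl fun j _ => ?_
      rw [s₁]; ring
    rw [this, hwc]; ring
  obtain ⟨g₃, n₃, z₃, s₃⟩ := row_op hν hM (fun i => - g₂ 0 i.succ) g₂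
  obtain ⟨g₄, n₄, z₄, s₄⟩ := lcol_op hν hM (fun i => - g₃ i.succ 0) g₃
  have h3 : g₃ 0 0 = 1 := by rw [z₃, h2]
  obtain ⟨h, rfl⟩ := eq_emb g₄ (by rw [z₄, h3]) (fun j => by rw [z₄, s₃, h2]; ring)
    (fun i => by rw [s₄, h3]; ring)
  linarith [hC h]

theorem cnorm_bdd (k : ℕ) : ∀ {ν : SpecialLinearGroup (Fin (k + 3)) ℤ → ℝ}, CNorm ν →
    ∃ C, ∀ g, ν g ≤ C := by
  induction k with
  | zero => intro ν hν; exact reduction hν (bdd_two hν)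
  | succ k ih => intro ν hν; exact reduction hν (ih (hν.comap (emb (k + 3))))

/-- For n ≥ 3, every bi-invariant metric on SL(n,ℤ) is bounded. -/
theorem SLnZ_biinvariant_metric_bounded (n : ℕ) (hn : 3 ≤ n)
    (d : Matrix.SpecialLinearGroup (Fin n) ℤ → Matrix.SpecialLinearGroup (Fin n) ℤ → ℝ)
    (d_eq_zero : ∀ g h, d g h = 0 ↔ g = h)
    (d_symm : ∀ g h, d g h = d h g)
    (d_triangle : ∀ g h k, d g k ≤ d g h + d h k)
    (d_left_inv : ∀ k g h, d (k * g) (k * h) = d g h)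
    (d_right_inv : ∀ k g h, d (g * k) (h * k) = d g h) :
    ∃ C : ℝ, ∀ g h, d g h ≤ C := by
  obtain ⟨k, rfl⟩ : ∃ k, n = k + 3 := ⟨n - 3, by omega⟩
  have hν : CNorm (fun g => d g 1) := by
    refine ⟨fun g h => ?_, fun g => ?_, fun g h => ?_⟩
    · have h1 := d_triangle (g * h) h 1
      have h2 := d_right_inv h g 1
      rw [one_mul] at h2
      linarith
    · have h2 := d_right_inv g g⁻¹ 1
      rw [one_mul, inv_mul_cancel] at h2
      show d g⁻¹ 1 = d g 1
      rw [← h2, d_symm]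
    · have h2 := d_right_inv h⁻¹ (h * g) h
      rw [mul_inv_cancel] at h2
      have h3 := d_left_inv h g 1
      rw [mul_one] at h3
      show d (h * g * h⁻¹) 1 = d g 1
      rw [h2, h3]
  obtain ⟨C, hC⟩ := cnorm_bdd k hν
  refine ⟨C, fun g h => ?_⟩
  have h1 := d_right_inv h⁻¹ g h
  rw [mul_inv_cancel] at h1
  rw [← h1]
  exact hC _
end

section
/- Let n ≥ 3. Then every bi-invariant metric on SL(n,ℤ[i]) is bounded, where ℤ[i] denotes the ring of Gaussian integers: for every metric d on SL(n,ℤ[i]) satisfying d(kg, kh) = d(g, h) = d(gk, hk) for all g, h, k ∈ SL(n,ℤ[i]), there exists a constant C with d(g, h) ≤ C for all g, h ∈ SL(n,ℤ[i]). -/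
namespace GaussBdd

open Matrix

/-- Conjugation-invariant length functions on a group. -/
structure CI {G : Type*} [Group G] (l : G → ℝ) : Prop where
  one : l 1 = 0
  mul : ∀ g h, l (g * h) ≤ l g + l h
  inv : ∀ g, l g⁻¹ = l g
  conj : ∀ g h, l (h * g * h⁻¹) = l g

section basics
variable {G : Type*} [Group G] {l : G → ℝ}

lemma CI.nonneg (hl : CI l) (g : G) : 0 ≤ l g := by
  have := hl.mul g g⁻¹
  rw [mul_inv_cancel, hl.one, hl.inv] at this
  linarith

lemma CI.comap {H : Type*} [Group H] (hl : CI l) (f : H →* G) : CI (fun h => l (f h)) where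
  one := by simp [hl.one]
  mul g h := by simpa using hl.mul _ _
  inv g := by simpa using hl.inv _
  conj g h := by simpa using hl.conj _ _

/-- `g` and `h` are at distance at most `C`. -/
def Nr (l : G → ℝ) (C : ℝ) (g h : G) : Prop := l (g * h⁻¹) ≤ C

lemma CI.nr_symm (hl : CI l) {C : ℝ} {g h : G} (H : Nr l C g h) : Nr l C h g := by
  unfold Nr at *
  rw [← hl.inv]; simpa using H

lemma CI.nr_trans (hl : CI l) {C D : ℝ} {g h k : G} (H : Nr l C g h) (H' : Nr l D h k) :
    Nr l (C + D) g k := by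
  unfold Nr at *
  have := hl.mul (g * h⁻¹) (h * k⁻¹)
  have e : g * h⁻¹ * (h * k⁻¹) = g * k⁻¹ := by group
  rw [e] at this
  linarith

lemma CI.nr_mul (hl : CI l) {C D : ℝ} {g h g' h' : G} (H : Nr l C g h) (H' : Nr l D g' h') :
    Nr l (C + D) (g * g') (h * h') := by
  unfold Nr at *
  have := hl.mul (g * (g' * h'⁻¹) * g⁻¹) (g * h⁻¹)
  rw [hl.conj] at this
  have e : g * (g' * h'⁻¹) * g⁻¹ * (g * h⁻¹) = g * g' * (h * h')⁻¹ := by group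
  rw [e] at this
  linarith

lemma CI.nr_refl (hl : CI l) (g : G) : Nr l 0 g g := by
  simp [Nr, hl.one]

lemma CI.nr_left (_hl : CI l) {C : ℝ} {e : G} (H : l e ≤ C) (g : G) : Nr l C (e * g) g := by
  simpa [Nr] using H

lemma CI.nr_right (hl : CI l) {C : ℝ} {e : G} (H : l e ≤ C) (g : G) : Nr l C (g * e) g := by
  unfold Nr; rw [hl.conj]; exact H

lemma CI.nr_conj (hl : CI l) {C : ℝ} {w g h : G} (H : l w ≤ C) (e : h * w = w * g) :
    Nr l (2 * C) h g := by
  have e' : h * g⁻¹ = w * (g * w⁻¹ * g⁻¹) := by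
    rw [eq_mul_inv_of_mul_eq e]; group
  unfold Nr
  rw [e']
  have := hl.mul w (g * w⁻¹ * g⁻¹)
  rw [hl.conj, hl.inv] at this
  linarith

lemma CI.le_of_nr (hl : CI l) {C : ℝ} {g h : G} (H : Nr l C g h) : l g ≤ C + l h := by
  unfold Nr at H
  have := hl.mul (g * h⁻¹) h
  simp at this
  linarith

lemma CI.pow_le (hl : CI l) {r s : ℕ} {C : ℝ} {g : G} {k : ℕ} (hk : Nat.gcd r s = k)
    (hr : ∀ u : ℕ, l (g ^ (r * u)) ≤ C) (hs : ∀ u : ℕ, l (g ^ (s * u)) ≤ C) :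
    l (g ^ k) ≤ 2 * C := by
  have key : ∀ r : ℕ, (∀ u : ℕ, l (g ^ (r * u)) ≤ C) → ∀ u : ℤ, l (g ^ ((r : ℤ) * u)) ≤ C := by
    intro r hr u
    obtain ⟨n, rfl | rfl⟩ := u.eq_nat_or_neg
    · exact_mod_cast hr n
    · rw [mul_neg, _root_.zpow_neg, hl.inv]
      exact_mod_cast hr n
  have hb : (k : ℤ) = r * Nat.gcdA r s + s * Nat.gcdB r s := by
    rw [← hk]; exact Nat.gcd_eq_gcd_ab r s
  rw [← zpow_natCast, hb, _root_.zpow_add]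
  have := hl.mul (g ^ ((r : ℤ) * Nat.gcdA r s)) (g ^ ((s : ℤ) * Nat.gcdB r s))
  have h1 := key r hr (Nat.gcdA r s)
  have h2 := key s hs (Nat.gcdB r s)
  linarith

end basics

section elem
variable {R : Type*} [CommRing R] {ι : Type*} [Fintype ι] [DecidableEq ι]

lemma sl_ext {A B : SpecialLinearGroup ι R} (h : (A : Matrix ι ι R) = (B : Matrix ι ι R)) :
    A = B := Subtype.ext h

lemma tv_comm {i j k : ι} (hij : i ≠ j) (hik : i ≠ k) (hkj : k ≠ j) (x : R) :
    SpecialLinearGroup.transvection hij x =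
      SpecialLinearGroup.transvection hik x * SpecialLinearGroup.transvection hkj 1 *
      (SpecialLinearGroup.transvection hik x)⁻¹ * (SpecialLinearGroup.transvection hkj 1)⁻¹ := by
  rw [eq_mul_inv_iff_mul_eq, eq_mul_inv_iff_mul_eq]
  apply sl_ext
  simp only [Matrix.SpecialLinearGroup.coe_mul, Matrix.SpecialLinearGroup.transvection_coe]
  simp [mul_add, add_mul, hij.symm, hkj.symm]
  abel

lemma exists_K {l : SpecialLinearGroup ι R → ℝ} (hl : CI l) (hc : 3 ≤ Fintype.card ι) :
    ∃ K : ℝ, 0 ≤ K ∧ ∀ (i j : ι) (hij : i ≠ j) (x : R),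
      l (SpecialLinearGroup.transvection hij x) ≤ K := by
  classical
  let f : ι × ι → ℝ := fun p => if h : p.1 ≠ p.2 then
    2 * l (SpecialLinearGroup.transvection (F := R) h 1) else 0
  have hf : ∀ p, 0 ≤ f p := by
    intro p; simp only [f]; split_ifs
    · exact mul_nonneg (by norm_num) (hl.nonneg _)
    · exact le_rfl
  refine ⟨∑ p, f p, Finset.sum_nonneg fun p _ => hf p, fun i j hij x => ?_⟩
  obtain ⟨k, hk⟩ : ∃ k, k ∉ ({i, j} : Finset ι) := by
    by_contra! h
    have : Finset.univ ⊆ ({i, j} : Finset ι) := fun k _ => h k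
    have h2 := Finset.card_le_card this
    have h3 := Finset.card_le_two (a := i) (b := j)
    rw [Finset.card_univ] at h2
    omega
  simp only [Finset.mem_insert, Finset.mem_singleton, not_or] at hk
  have hik : i ≠ k := fun h => hk.1 h.symm
  have h1 : f (k, j) ≤ ∑ p, f p := Finset.single_le_sum (fun p _ => hf p) (Finset.mem_univ _)
  refine le_trans ?_ h1
  simp only [f, ne_eq, hk.2, not_false_eq_true, dif_pos]
  rw [tv_comm hij hik hk.2]
  refine (hl.mul _ _).trans ?_
  rw [hl.conj, hl.inv]
  linarith

end elem

section core
variable {R : Type*} [CommRing R]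


lemma det2 (A : SpecialLinearGroup (Fin 2) R) : A 0 0 * A 1 1 - A 0 1 * A 1 0 = 1 := by
  have := A.det_coe
  rwa [Matrix.det_fin_two] at this

/-- Matrix in SL2 from entries. -/
def mk2 (a b c d : R) (h : a * d - b * c = 1) : SpecialLinearGroup (Fin 2) R :=
  ⟨!![a, b; c, d], by rw [Matrix.det_fin_two]; simpa using h⟩

@[simp] lemma mk2_00 (a b c d : R) (h) : mk2 a b c d h 0 0 = a := rfl
@[simp] lemma mk2_01 (a b c d : R) (h) : mk2 a b c d h 0 1 = b := rfl
@[simp] lemma mk2_10 (a b c d : R) (h) : mk2 a b c d h 1 0 = c := rfl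
@[simp] lemma mk2_11 (a b c d : R) (h) : mk2 a b c d h 1 1 = d := rfl

lemma ext2 {A B : SpecialLinearGroup (Fin 2) R} (h0 : A 0 0 = B 0 0) (h1 : A 0 1 = B 0 1)
    (h2 : A 1 0 = B 1 0) (h3 : A 1 1 = B 1 1) : A = B := by
  ext i j
  fin_cases i <;> fin_cases j <;> assumption

lemma mul2 (A B : SpecialLinearGroup (Fin 2) R) (i j : Fin 2) :
    (A * B) i j = A i 0 * B 0 j + A i 1 * B 1 j := by
  simp [Matrix.mul_apply, Fin.sum_univ_two]

lemma mul3 (A B : SpecialLinearGroup (Fin 3) R) (i j : Fin 3) :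
    (A * B) i j = A i 0 * B 0 j + A i 1 * B 1 j + A i 2 * B 2 j := by
  simp [Matrix.mul_apply, Fin.sum_univ_three]

/-- The standard embedding of SL2 in SL3. -/
def embFun (A : SpecialLinearGroup (Fin 2) R) : SpecialLinearGroup (Fin 3) R :=
  ⟨!![A 0 0, A 0 1, 0; A 1 0, A 1 1, 0; 0, 0, 1], by
    have := det2 A
    simp [Matrix.det_fin_three]; linear_combination this⟩

/-- The standard embedding of SL2 in SL3, as a homomorphism. -/
def emb : SpecialLinearGroup (Fin 2) R →* SpecialLinearGroup (Fin 3) R where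
  toFun A := embFun A
  map_one' := by
    ext i j; fin_cases i <;> fin_cases j <;> simp [embFun]
  map_mul' A B := by
    ext i j; rw [mul3]
    fin_cases i <;> fin_cases j <;> simp [embFun, Matrix.mul_apply, Fin.sum_univ_two]

lemma emb_coe (A : SpecialLinearGroup (Fin 2) R) : (emb A : Matrix (Fin 3) (Fin 3) R) =
    !![A 0 0, A 0 1, 0; A 1 0, A 1 1, 0; 0, 0, 1] := rfl

/-- The embedding in coordinates 0, 2. -/
def X13 (A : SpecialLinearGroup (Fin 2) R) : SpecialLinearGroup (Fin 3) R :=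
  ⟨!![A 0 0, 0, A 0 1; 0, 1, 0; A 1 0, 0, A 1 1], by
    have := det2 A
    simp [Matrix.det_fin_three]; linear_combination this⟩

/-- A twisted embedding in coordinates 1, 2. -/
def X23 (A : SpecialLinearGroup (Fin 2) R) : SpecialLinearGroup (Fin 3) R :=
  ⟨!![1, 0, 0; 0, A 1 1, -A 1 0; 0, -A 0 1, A 0 0], by
    have := det2 A
    simp [Matrix.det_fin_three]; linear_combination this⟩

/-- Signed permutation. -/
def ww : SpecialLinearGroup (Fin 3) R :=
  ⟨!![1, 0, 0; 0, 0, -1; 0, 1, 0], by simp [Matrix.det_fin_three]⟩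

/-- Signed permutation. -/
def vv : SpecialLinearGroup (Fin 3) R :=
  ⟨!![0, 0, 1; 0, -1, 0; 1, 0, 0], by simp [Matrix.det_fin_three]⟩

/-- Transvections in SL3. -/
abbrev T (i j : Fin 3) (hij : i ≠ j) (x : R) : SpecialLinearGroup (Fin 3) R :=
  SpecialLinearGroup.transvection hij x

lemma X13_conj (A : SpecialLinearGroup (Fin 2) R) : X13 A * ww = ww * emb A := by
  ext i j; rw [mul3, mul3]
  fin_cases i <;> fin_cases j <;> simp [X13, ww, emb_coe]

lemma X23_conj (A : SpecialLinearGroup (Fin 2) R) : X23 A * vv = vv * emb A := by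
  ext i j; rw [mul3, mul3]
  fin_cases i <;> fin_cases j <;> simp [X23, vv, emb_coe]

/-- lower elementary -/
def L2 (x : R) : SpecialLinearGroup (Fin 2) R := mk2 1 0 x 1 (by ring)
/-- upper elementary -/
def U2 (x : R) : SpecialLinearGroup (Fin 2) R := mk2 1 x 0 1 (by ring)

lemma emb_L2 (x : R) : emb (L2 x) = T 1 0 (by decide) x := by
  ext i j
  fin_cases i <;> fin_cases j <;>
    simp [L2, emb_coe, SpecialLinearGroup.transvection, Matrix.transvection]

lemma emb_U2 (x : R) : emb (U2 x) = T 0 1 (by decide) x := by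
  ext i j
  fin_cases i <;> fin_cases j <;>
    simp [U2, emb_coe, SpecialLinearGroup.transvection, Matrix.transvection]

/-- The key matrix identity behind multiplicativity of Mennicke symbols. -/
lemma mennicke_id (a b1 b2 c1 d1 c2 d2 c3 d3 : R) (h1 : a * d1 - b1 * c1 = 1)
    (h2 : a * d2 - b2 * c2 = 1) (h3 : a * d3 - (b1 * b2) * c3 = 1)
    (h4 : a * (d3 - b2 * (c3 * b1 * d2 - d3 * c2)) -
      b2 * (b1 * c3 - a * (c3 * b1 * d2 - d3 * c2)) = 1) :
    emb (mk2 a (b1 * b2) c3 d3 h3) * T 0 2 (by decide) (b1 * d2) * T 1 2 (by decide) (-c2) *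
      T 2 1 (by decide) (-b2) =
    T 1 0 (by decide) (c3 * d1 - (c3 * b1 * d2 - d3 * c2) * c1) * T 2 0 (by decide) (-c1) *
      (X23 (mk2 a b2 (b1 * c3 - a * (c3 * b1 * d2 - d3 * c2))
        (d3 - b2 * (c3 * b1 * d2 - d3 * c2)) h4) * X13 (mk2 a b1 c1 d1 h1)) := by
  ext i j
  simp only [mul3]
  fin_cases i <;> fin_cases j <;>
    simp [emb_coe, X13, X23, SpecialLinearGroup.transvection, Matrix.transvection]
  · linear_combination (-b1 * b2) * h2
  · linear_combination b1 * h2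
  · linear_combination (-c3) * h1
  · ring
  · linear_combination (-(c3 * b1 * d2 - d3 * c2)) * h1
  · ring
  · linear_combination -h1

section bounds
variable {l : SpecialLinearGroup (Fin 3) R → ℝ} {K : ℝ}

/-- Standing assumptions. -/
structure Std (l : SpecialLinearGroup (Fin 3) R → ℝ) (K : ℝ) : Prop where
  ci : CI l
  nonneg : 0 ≤ K
  tv : ∀ (i j : Fin 3) (hij : i ≠ j) (x : R), l (SpecialLinearGroup.transvection hij x) ≤ K
  ww : l ww ≤ K
  vv : l vv ≤ K
  neg : l (emb (-1)) ≤ K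

lemma Std.L2 (H : Std l K) (x : R) : l (emb (L2 x)) ≤ K := by
  rw [emb_L2]; exact H.tv _ _ _ _

lemma Std.U2 (H : Std l K) (x : R) : l (emb (U2 x)) ≤ K := by
  rw [emb_U2]; exact H.tv _ _ _ _

/-- Same first row. -/
lemma Std.row (H : Std l K) {A B : SpecialLinearGroup (Fin 2) R} (h0 : A 0 0 = B 0 0)
    (h1 : A 0 1 = B 0 1) : Nr l K (emb A) (emb B) := by
  have hA := det2 A
  have hB := det2 B
  have : A = GaussBdd.L2 (A 1 0 * B 1 1 - A 1 1 * B 1 0) * B := by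
    apply ext2 <;> rw [mul2] <;> simp [GaussBdd.L2, h0, h1]
    · rw [h0, h1] at hA
      linear_combination (-A 1 0) * hB + B 1 0 * hA
    · rw [h0, h1] at hA
      linear_combination (-A 1 1) * hB + B 1 1 * hA
  rw [this, map_mul]
  exact H.ci.nr_left (H.L2 _) _

/-- First rows `(a, b)` and `(a + u b, b)`. -/
lemma Std.row_add (H : Std l K) {A B : SpecialLinearGroup (Fin 2) R} (u : R)
    (h0 : A 0 0 = B 0 0 + u * B 0 1) (h1 : A 0 1 = B 0 1) : Nr l (2 * K) (emb A) (emb B) := by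
  have h : Nr l K (emb A) (emb (B * GaussBdd.L2 u)) := by
    apply H.row <;> rw [mul2] <;> simp [GaussBdd.L2, h0, h1]
    ring
  have h2 : Nr l K (emb (B * GaussBdd.L2 u)) (emb B) := by
    rw [map_mul]; exact H.ci.nr_right (H.L2 _) _
  rw [two_mul]; exact H.ci.nr_trans h h2

/-- First rows `(a, b)` and `(a, b + u a)`. -/
lemma Std.row_add' (H : Std l K) {A B : SpecialLinearGroup (Fin 2) R} (u : R)
    (h0 : A 0 0 = B 0 0) (h1 : A 0 1 = B 0 1 + u * B 0 0) : Nr l (2 * K) (emb A) (emb B) := by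
  have h : Nr l K (emb A) (emb (B * GaussBdd.U2 u)) := by
    apply H.row <;> rw [mul2] <;> simp [GaussBdd.U2, h0, h1]
    ring
  have h2 : Nr l K (emb (B * GaussBdd.U2 u)) (emb B) := by
    rw [map_mul]; exact H.ci.nr_right (H.U2 _) _
  rw [two_mul]; exact H.ci.nr_trans h h2

lemma mk2_eta (A : SpecialLinearGroup (Fin 2) R) :
    A = mk2 (A 0 0) (A 0 1) (A 1 0) (A 1 1) (det2 A) := ext2 rfl rfl rfl rfl

/-- Multiplicativity of Mennicke symbols, up to bounded error. -/
lemma Std.mennicke (H : Std l K) {A1 A2 A3 : SpecialLinearGroup (Fin 2) R}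
    (h1 : A1 0 0 = A3 0 0) (h2 : A2 0 0 = A3 0 0) (h3 : A3 0 1 = A1 0 1 * A2 0 1) :
    Nr l (10 * K) (emb A3) (emb A2 * emb A1) := by
  obtain ⟨a0, b1, c1, d1, e1, rfl⟩ : ∃ a b c d h, A1 = mk2 a b c d h := ⟨_, _, _, _, _, mk2_eta A1⟩
  obtain ⟨a, b2, c2, d2, e2, rfl⟩ : ∃ a b c d h, A2 = mk2 a b c d h := ⟨_, _, _, _, _, mk2_eta A2⟩
  obtain ⟨a'', b3, c3, d3, e3, rfl⟩ : ∃ a b c d h, A3 = mk2 a b c d h :=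
    ⟨_, _, _, _, _, mk2_eta A3⟩
  simp only [mk2_00, mk2_01] at h1 h2 h3
  subst h1 h2 h3
  have h4 : a * (d3 - b2 * (c3 * b1 * d2 - d3 * c2)) -
      b2 * (b1 * c3 - a * (c3 * b1 * d2 - d3 * c2)) = 1 := by linear_combination e3
  have key := mennicke_id a b1 b2 c1 d1 c2 d2 c3 d3 e1 e2 e3 h4
  have s1 := H.ci.nr_right (H.tv 0 2 (by decide) (b1 * d2)) (emb (mk2 a (b1 * b2) c3 d3 e3))
  have s2 := H.ci.nr_right (H.tv 1 2 (by decide) (-c2))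
    (emb (mk2 a (b1 * b2) c3 d3 e3) * T 0 2 (by decide) (b1 * d2))
  have s3 := H.ci.nr_right (H.tv 2 1 (by decide) (-b2))
    (emb (mk2 a (b1 * b2) c3 d3 e3) * T 0 2 (by decide) (b1 * d2) * T 1 2 (by decide) (-c2))
  have s4 := H.ci.nr_symm (H.ci.nr_trans s3 (H.ci.nr_trans s2 s1))
  rw [key, mul_assoc] at s4
  set Y := mk2 a b2 (b1 * c3 - a * (c3 * b1 * d2 - d3 * c2))
        (d3 - b2 * (c3 * b1 * d2 - d3 * c2)) h4
  have s5 := H.ci.nr_left (H.tv 1 0 (by decide) (c3 * d1 - (c3 * b1 * d2 - d3 * c2) * c1))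
    (T 2 0 (by decide) (-c1) * (X23 Y * X13 (mk2 a b1 c1 d1 e1)))
  have s6 := H.ci.nr_left (H.tv 2 0 (by decide) (-c1)) (X23 Y * X13 (mk2 a b1 c1 d1 e1))
  have s7 := H.ci.nr_mul (H.ci.nr_conj H.vv (X23_conj Y))
    (H.ci.nr_conj H.ww (X13_conj (mk2 a b1 c1 d1 e1)))
  have s8 : Nr l K (emb Y) (emb (mk2 a b2 c2 d2 e2)) := H.row rfl rfl
  have s9 := H.ci.nr_mul s8 (H.ci.nr_refl (emb (mk2 a b1 c1 d1 e1)))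
  have := H.ci.nr_trans s4 (H.ci.nr_trans s5 (H.ci.nr_trans s6 (H.ci.nr_trans s7 s9)))
  refine le_trans this ?_
  linarith

lemma exists_fg (A : SpecialLinearGroup (Fin 2) R) (m : ℕ) : ∃ f g : R,
    (A ^ m) 0 0 = f * A 0 0 + g ∧ (A ^ m) 0 1 = f * A 0 1 ∧ (A ^ m) 1 0 = f * A 1 0 ∧
    (A ^ m) 1 1 = f * A 1 1 + g := by
  induction m with
  | zero => exact ⟨0, 1, by simp⟩
  | succ m ih =>
    obtain ⟨f, g, h0, h1, h2, h3⟩ := ih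
    have hd := det2 A
    refine ⟨f * (A 0 0 + A 1 1) + g, -f, ?_⟩
    simp only [pow_succ, mul2, h0, h1, h2, h3]
    refine ⟨?_, ?_, ?_, ?_⟩
    · linear_combination (-f) * hd
    · ring
    · ring
    · linear_combination (-f) * hd

lemma pow_cong (A : SpecialLinearGroup (Fin 2) R) (m : ℕ) :
    ∃ u : R, (A ^ m) 0 0 = (A 0 0) ^ m + u * A 0 1 := by
  induction m with
  | zero => exact ⟨0, by simp⟩
  | succ m ih =>
    obtain ⟨u, hu⟩ := ih
    obtain ⟨f, g, h0, h1, h2, h3⟩ := exists_fg A m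
    refine ⟨u * A 0 0 + f * A 1 0, ?_⟩
    rw [pow_succ, mul2, hu, h1]; ring

/-- Power lemma. -/
lemma Std.power (H : Std l K) (A B : SpecialLinearGroup (Fin 2) R) (m : ℕ)
    (h0 : B 0 0 = (A 0 0) ^ (2 * m)) (h1 : B 0 1 = A 0 1) :
    Nr l (27 * K) (emb (A ^ (2 * m))) (emb B) := by
  obtain ⟨f, g, e0, e1, e2, e3⟩ := exists_fg A m
  obtain ⟨u, hu⟩ := pow_cong A (2 * m)
  have hd := det2 A
  have hD := det2 (A ^ m)
  have hrel : f ^ 2 + f * g * (A 0 0 + A 1 1) + g ^ 2 = 1 := by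
    rw [e0, e1, e2, e3] at hD
    linear_combination hD - f ^ 2 * hd
  have hsq : A ^ (2 * m) = A ^ m * A ^ m := by rw [two_mul, pow_add]
  set s := f * (A 0 0 + A 1 1) + 2 * g with hs
  set α := (A ^ (2 * m)) 0 0 with hα
  have hα1 : α = s * (f * A 0 0 + g) - 1 := by
    rw [hα, hsq, mul2, e0, e1, e2, hs]
    linear_combination (-f ^ 2) * hd - hrel
  have hβ : (A ^ (2 * m)) 0 1 = (s * f) * A 0 1 := by
    rw [hsq, mul2, e0, e1, e3, hs]; ring
  have hdd := det2 (A ^ (2 * m))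
  rw [← hα, hβ] at hdd
  let M1 := mk2 α s (-(f * A 0 0 + g)) (-1) (by rw [hα1]; ring)
  obtain ⟨h, hh⟩ : ∃ h, α = 1 + f * h :=
    ⟨(A 0 0 + A 1 1) * (f * A 0 0 + g) + 2 * g * A 0 0 - 2 * f - 2 * g * (A 0 0 + A 1 1), by
      rw [hα1, hs]; linear_combination 2 * hrel⟩
  let M2 := mk2 α f h 1 (by rw [hh]; ring)
  let M3 := mk2 α (s * f) (A 0 1 * (A ^ (2 * m)) 1 0) ((A ^ (2 * m)) 1 1)
    (by linear_combination hdd)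
  let M4 := B * GaussBdd.L2 u
  have hM1 : l (emb M1) ≤ 3 * K := by
    have : M1 = (-1) * (GaussBdd.U2 (-s) * GaussBdd.L2 (f * A 0 0 + g)) := by
      apply ext2 <;> simp only [mul2] <;> simp [M1, GaussBdd.U2, GaussBdd.L2]
      rw [hα1]; ring
    rw [this, map_mul, map_mul]
    have i1 := H.ci.mul (emb (-1)) (emb (GaussBdd.U2 (-s)) * emb (GaussBdd.L2 (f * A 0 0 + g)))
    have i2 := H.ci.mul (emb (GaussBdd.U2 (-s))) (emb (GaussBdd.L2 (f * A 0 0 + g)))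
    have := H.U2 (-s)
    have := H.L2 (f * A 0 0 + g)
    have := H.neg
    linarith
  have hM2 : l (emb M2) ≤ 2 * K := by
    have : M2 = GaussBdd.U2 f * GaussBdd.L2 h := by
      apply ext2 <;> simp only [mul2] <;> simp [M2, GaussBdd.U2, GaussBdd.L2]
      rw [hh]
    rw [this, map_mul]
    have i2 := H.ci.mul (emb (GaussBdd.U2 f)) (emb (GaussBdd.L2 h))
    have := H.U2 f
    have := H.L2 h
    linarith
  have n1 : Nr l (10 * K) (emb M3) (emb M2 * emb M1) := H.mennicke rfl rfl rfl
  have hM3 : l (emb M3) ≤ 15 * K := by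
    have := H.ci.le_of_nr n1
    have := H.ci.mul (emb M2) (emb M1)
    linarith
  have m40 : M4 0 0 = α := by
    simp only [M4, mul2]; simp [GaussBdd.L2, h0, h1, hu]; ring
  have m41 : M4 0 1 = A 0 1 := by
    simp only [M4, mul2]; simp [GaussBdd.L2, h1]
  have n2 : Nr l (10 * K) (emb (A ^ (2 * m))) (emb M4 * emb M3) := by
    apply H.mennicke
    · rfl
    · exact m40
    · rw [hβ, m41]; rfl
  have n3 := H.ci.nr_right hM3 (emb M4)
  have n4 : Nr l K (emb M4) (emb B) := by
    simp only [M4, map_mul]; exact H.ci.nr_right (H.L2 _) _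
  refine le_trans (H.ci.nr_trans n2 (H.ci.nr_trans n3 n4)) ?_
  have := H.nonneg
  linarith

/-- If `a ^ (2 * m) ≡ 1 mod b` then `A ^ (2 * m)` is bounded. -/
lemma Std.pow_row (H : Std l K) (A : SpecialLinearGroup (Fin 2) R) (m : ℕ)
    (h : A 0 1 ∣ (A 0 0) ^ (2 * m) - 1) : l (emb (A ^ (2 * m))) ≤ 29 * K := by
  obtain ⟨u, hu⟩ := h
  have h' : (A 0 0) ^ (2 * m) = 1 + A 0 1 * u := by linear_combination hu
  have n := H.power A (GaussBdd.U2 (A 0 1) * GaussBdd.L2 u) m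
    (by simp only [mul2]; simp [GaussBdd.L2, GaussBdd.U2, h'])
    (by simp only [mul2]; simp [GaussBdd.L2, GaussBdd.U2])
  have i1 := H.ci.le_of_nr n
  rw [map_mul] at i1
  have i2 := H.ci.mul (emb (GaussBdd.U2 (A 0 1))) (emb (GaussBdd.L2 u))
  have := H.U2 (A 0 1)
  have := H.L2 u
  linarith

/-- Column version. -/
lemma Std.pow_col (H : Std l K) (A : SpecialLinearGroup (Fin 2) R) (m : ℕ)
    (h : A 1 0 ∣ (A 0 0) ^ (2 * m) - 1) : l (emb (A ^ (2 * m))) ≤ 29 * K := by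
  let J : SpecialLinearGroup (Fin 2) R := mk2 0 1 (-1) 0 (by ring)
  let B : SpecialLinearGroup (Fin 2) R := mk2 (A 0 0) (A 1 0) (A 0 1) (A 1 1)
    (by linear_combination det2 A)
  have hd := det2 A
  have e : B⁻¹ = J * A * J⁻¹ := by
    rw [eq_mul_inv_iff_mul_eq, inv_mul_eq_iff_eq_mul]
    apply ext2 <;> simp only [mul2] <;> simp [B, J] <;>
      first | ring1 | linear_combination hd | linear_combination -hd
  have e2 : (B ^ (2 * m))⁻¹ = J * A ^ (2 * m) * J⁻¹ := by
    rw [← inv_pow, e, conj_pow]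
  have := H.pow_row B m h
  rw [← H.ci.inv, ← map_inv, e2, map_mul, map_mul, map_inv, H.ci.conj] at this
  exact this

/-- Combination: fourth powers. -/
lemma Std.pow_gcd (H : Std l K) (A : SpecialLinearGroup (Fin 2) R) {r s : ℕ}
    (hr : A 0 1 ∣ (A 0 0) ^ (2 * r) - 1) (hs : A 1 0 ∣ (A 0 0) ^ (2 * s) - 1)
    (hg : Nat.gcd (2 * r) (2 * s) = 4) (B : SpecialLinearGroup (Fin 2) R)
    (h0 : B 0 0 = (A 0 0) ^ 4) (h1 : B 0 1 = A 0 1) : l (emb B) ≤ 85 * K := by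
  have i1 : l (emb A ^ 4) ≤ 2 * (29 * K) := by
    apply H.ci.pow_le hg
    · intro u
      rw [← map_pow, mul_assoc]
      apply H.pow_row
      refine hr.trans ?_
      rw [← mul_assoc, pow_mul _ (2 * r)]
      exact sub_one_dvd_pow_sub_one _ _
    · intro u
      rw [← map_pow, mul_assoc]
      apply H.pow_col
      refine hs.trans ?_
      rw [← mul_assoc, pow_mul _ (2 * s)]
      exact sub_one_dvd_pow_sub_one _ _
  have i2 := H.ci.le_of_nr (H.ci.nr_symm (H.power A B 2 h0 h1))
  rw [map_pow] at i2
  norm_num at i2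
  linarith

end bounds
end core
end GaussBdd
namespace GaussBdd
open Matrix

lemma exists_coprime_add {R : Type*} [CommRing R] [IsDomain R] [IsPrincipalIdealRing R]
    (a b γ : R) (hγ : γ ≠ 0) (h : ∀ q, Prime q → q ∣ γ → q ∣ a → ¬ q ∣ b) :
    ∃ t, IsCoprime (a + t * b) γ := by
  induction γ using UniqueFactorizationMonoid.induction_on_prime with
  | h₁ => exact absurd rfl hγ
  | h₂ x hx => 
    obtain ⟨z, hz⟩ := hx.exists_left_inv
    exact ⟨0, 0, z, by rw [hz]; ring⟩
  | h₃ γ p hγ0 hp ih =>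
    obtain ⟨t, ht⟩ := ih hγ0 (fun q hq hd => h q hq (hd.mul_left _))
    by_cases hpd : p ∣ a + t * b
    · have hpb : ¬ p ∣ b := fun hb => h p hp (dvd_mul_right _ _)
        ((dvd_add_left (hb.mul_left t)).mp hpd) hb
      have hpγ : ¬ p ∣ γ := fun hg => hp.not_isUnit (ht.isUnit_of_dvd' hpd hg)
      refine ⟨t + γ, IsCoprime.mul_right ?_ ?_⟩
      · refine ((hp.irreducible.coprime_iff_not_dvd).mpr fun hd => ?_).symm
        have : p ∣ γ * b := by
          have := dvd_sub hd hpd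
          have e : a + (t + γ) * b - (a + t * b) = γ * b := by ring
          rwa [e] at this
        exact (hp.dvd_or_dvd this).elim hpγ hpb
      · have := ht.add_mul_left_left b
        convert this using 1; ring
    · exact ⟨t, IsCoprime.mul_right ((hp.irreducible.coprime_iff_not_dvd).mpr hpd).symm ht⟩

lemma cop_int {m n : ℤ} (h : IsCoprime (m : GaussianInt) (n : GaussianInt)) : IsCoprime m n := by
  obtain ⟨a, b, hab⟩ := h
  have := congrArg Zsqrtd.re hab
  simp at this
  exact ⟨a.re, b.re, this⟩

lemma cop_star {z w : GaussianInt} (h : IsCoprime z w) : IsCoprime (star z) (star w) := by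
  obtain ⟨a, b, hab⟩ := h
  refine ⟨star a, star b, ?_⟩
  have := congrArg star hab
  rw [star_add, star_mul', star_mul', star_one] at this
  exact this

lemma cop_norm {m : ℤ} {z : GaussianInt} (h : IsCoprime (m : GaussianInt) z) :
    IsCoprime m z.norm := by
  apply cop_int
  rw [Zsqrtd.norm_eq_mul_conj]
  refine IsCoprime.mul_right h ?_
  have := cop_star h
  simpa using this

lemma exists_primitive (y m : GaussianInt) (h : IsCoprime y m) :
    ∃ s, IsCoprime (y + s * m).re (y + s * m).im := by
  by_cases hm : m = 0
  · subst hm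
    rw [isCoprime_zero_right] at h
    obtain ⟨z, hz⟩ := h.exists_right_inv
    have := congrArg Zsqrtd.re hz
    simp at this
    exact ⟨0, z.re, -z.im, by simp; linear_combination this⟩
  obtain ⟨k, a, b, hk, hab, hre, him⟩ : ∃ k a b : ℤ, k ≠ 0 ∧ IsCoprime a b ∧ m.re = k * a ∧
      m.im = k * b := by
    have hpos : 0 < Int.gcd m.re m.im := by
      rw [Int.gcd_pos_iff]
      by_contra! h
      exact hm (Zsqrtd.ext h.1 h.2)
    obtain ⟨a, b, h1, h2, h3⟩ := Int.exists_gcd_one hpos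
    exact ⟨Int.gcd m.re m.im, a, b, by exact_mod_cast hpos.ne', Int.isCoprime_iff_gcd_eq_one.mpr h1,
      by rw [mul_comm]; exact h2, by rw [mul_comm]; exact h3⟩
  obtain ⟨u, v, huv⟩ := hab
  set N := a * a + b * b with hN
  have hN0 : N ≠ 0 := by
    intro h0
    have ha : a = 0 := by nlinarith [mul_self_nonneg a, mul_self_nonneg b]
    have hb : b = 0 := by nlinarith [mul_self_nonneg a, mul_self_nonneg b]
    rw [ha, hb] at huv; simp at huv
  have hq : ∀ q : ℤ, Prime q → q ∣ k → q ∣ y.re → q ∣ y.im → False := by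
    intro q hq h1 h2 h3
    have d1 : (q : GaussianInt) ∣ y := (Zsqrtd.intCast_dvd q y).mpr ⟨h2, h3⟩
    have d2 : (q : GaussianInt) ∣ m :=
      (Zsqrtd.intCast_dvd q m).mpr ⟨hre ▸ h1.mul_right _, him ▸ h1.mul_right _⟩
    have hu := h.isUnit_of_dvd' d1 d2
    obtain ⟨z, hz⟩ := hu.exists_right_inv
    have := congrArg Zsqrtd.re hz
    simp at this
    exact hq.not_isUnit (IsUnit.of_mul_eq_one _ this)
  have hpos : 0 < Int.gcd y.im k := Int.gcd_pos_of_ne_zero_right _ hk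
  obtain ⟨y1, k1, hc1, hy1, hk1⟩ := Int.exists_gcd_one hpos
  set g0 : ℤ := (Int.gcd y.im k : ℤ)
  have hg0 : g0 ≠ 0 := by
    intro h0; rw [h0, mul_zero] at hk1; exact hk hk1
  obtain ⟨T, hT⟩ := exists_coprime_add y1 k1 (2 * (k * N)) (by positivity)
    (fun q hq _ h1 h2 => hq.not_isUnit ((Int.isCoprime_iff_gcd_eq_one.mpr hc1).isUnit_of_dvd' h1 h2))
  have hw0 : y1 + T * k1 ≠ 0 := by
    intro h0
    rw [h0, isCoprime_zero_left] at hT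
    have := isUnit_of_mul_isUnit_left hT
    rw [Int.isUnit_iff] at this
    omega
  set hh := a * v - b * u with hhh
  have him' : y.im + k * T = (y1 + T * k1) * g0 := by
    rw [hy1, hk1]; ring
  obtain ⟨W, hW⟩ := exists_coprime_add (y.re + k * T * hh) (k * N) (y.im + k * T)
    (by rw [him']; exact mul_ne_zero hw0 hg0) (by
      intro q hqp h1 h2 h3
      rw [him'] at h1
      rcases hqp.dvd_or_dvd h1 with h1 | h1
      · exact hqp.not_isUnit (hT.isUnit_of_dvd' h1 (h3.mul_left _))
      · have hqk : q ∣ k := by rw [hk1]; exact h1.mul_left _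
        refine hq q hqp hqk ?_ (by rw [hy1]; exact h1.mul_left _)
        exact (dvd_add_left ((hqk.mul_right T).mul_right hh)).mp h2)
  refine ⟨⟨T * v + W * a, T * u - W * b⟩, ?_⟩
  have f1 : (y + ⟨T * v + W * a, T * u - W * b⟩ * m).re
      = y.re + k * T * hh + W * (k * N) := by
    simp [hre, him, hhh, hN]; ring
  have f2 : (y + ⟨T * v + W * a, T * u - W * b⟩ * m).im = y.im + k * T := by
    simp [hre, him]; linear_combination (k * T) * huv
  rw [f1, f2]
  exact hW

lemma exists_int_mod (x z : GaussianInt) (h : IsCoprime x.re x.im) : ∃ n : ℤ, x ∣ z - n := by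
  obtain ⟨u, v, huv⟩ := h
  refine ⟨z.re - z.im * (x.re * v - x.im * u), z.im * ⟨v, u⟩, ?_⟩
  apply Zsqrtd.ext
  · simp; ring
  · simp; linear_combination (-z.im) * huv

lemma dirichlet (x c0 : GaussianInt) (hx : IsCoprime x.re x.im) (hc : IsCoprime c0 x) (M κ : ℤ)
    (hM : M ≠ 0) (hNM : IsCoprime x.norm M) (hκ : IsCoprime κ M) :
    ∃ c : ℕ, c.Prime ∧ x ∣ (c : GaussianInt) - c0 ∧ M ∣ (c : ℤ) - κ := by
  obtain ⟨n, hn⟩ := exists_int_mod x c0 hx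
  have hx0 : x.norm ≠ 0 := by
    intro h0
    rw [GaussianInt.norm_eq_zero] at h0
    subst h0
    exact not_isUnit_zero (isCoprime_zero_left.mp hx)
  have hnx : IsCoprime (n : GaussianInt) x := by
    obtain ⟨w, hw⟩ := hn
    have := hc.add_mul_left_left (-w)
    have e : (n : GaussianInt) = c0 + x * (-w) := by linear_combination -hw
    rw [e]; exact this
  have hnN := cop_norm hnx
  obtain ⟨u, v, huv⟩ := hNM
  have e1 : n * v * M + κ * u * x.norm = n + x.norm * (κ * u - n * u) := by
    linear_combination n * huv
  have e2 : n * v * M + κ * u * x.norm = κ + M * (n * v - κ * v) := by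
    linear_combination κ * huv
  have hcop : IsCoprime (n * v * M + κ * u * x.norm) (x.norm * M) := by
    apply IsCoprime.mul_right
    · rw [e1]; exact hnN.add_mul_left_left _
    · rw [e2]; exact hκ.add_mul_left_left _
  obtain ⟨p, -, hp, hmod⟩ := Nat.forall_exists_prime_gt_and_zmodEq 0 (q := (x.norm * M).natAbs)
    (a := n * v * M + κ * u * x.norm) (by simp [hx0, hM]) (by
      rw [Int.isCoprime_iff_gcd_eq_one] at hcop ⊢
      rw [Int.gcd] at hcop ⊢; rwa [Int.natAbs_natCast])
  have hd : x.norm * M ∣ (p : ℤ) - (n * v * M + κ * u * x.norm) := by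
    have := hmod.symm.dvd
    rwa [Int.natAbs_dvd] at this
  refine ⟨p, hp, ?_, ?_⟩
  · have h1 : x.norm ∣ (p : ℤ) - n := by
      have := (dvd_mul_right _ _).trans hd
      rw [e1] at this
      have h2 := dvd_add this (dvd_mul_right x.norm (κ * u - n * u))
      ring_nf at h2 ⊢
      exact h2
    have h2 : x ∣ ((p : ℤ) - n : ℤ) := by
      refine dvd_trans ?_ (Int.cast_dvd_cast (α := GaussianInt) _ _ h1)
      rw [Zsqrtd.norm_eq_mul_conj]; exact dvd_mul_right _ _
    have h3 := dvd_sub h2 hn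
    push_cast at h3
    ring_nf at h3 ⊢
    exact h3
  · have := (dvd_mul_left _ _).trans hd
    rw [e2] at this
    have h2 := dvd_add this (dvd_mul_right M (n * v - κ * v))
    ring_nf at h2 ⊢
    exact h2

/-- The imaginary unit. -/
def I : GaussianInt := ⟨0, 1⟩

lemma I_sq : I * I = -1 := by
  apply Zsqrtd.ext <;> simp [I]

lemma int_fermat (p : ℕ) (hp : p.Prime) (n : ℤ) : (p : GaussianInt) ∣ (n : GaussianInt) ^ p - n := by
  have : (p : ℤ) ∣ n ^ p - n := by
    have := Fact.mk hp
    rw [← ZMod.intCast_zmod_eq_zero_iff_dvd]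
    push_cast
    rw [ZMod.pow_card, sub_self]
  have := Int.cast_dvd_cast (α := GaussianInt) _ _ this
  push_cast at this
  exact this

lemma fermat (p : ℕ) (hp : p.Prime) (h4 : p % 4 = 1) (z : GaussianInt) :
    (p : GaussianInt) ∣ z ^ p - z := by
  have hz : z = (z.re : GaussianInt) + I * (z.im : GaussianInt) := by
    apply Zsqrtd.ext <;> simp [I]
  obtain ⟨r, hr⟩ := exists_add_pow_prime_eq hp (z.re : GaussianInt) (I * (z.im : GaussianInt))
  have hI : I ^ p = I := by
    obtain ⟨k, hk⟩ : ∃ k, p = 4 * k + 1 := ⟨p / 4, by omega⟩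
    have : I ^ 4 = 1 := by
      calc I ^ 4 = (I * I) * (I * I) := by ring
        _ = 1 := by rw [I_sq]; ring
    rw [hk, pow_succ, pow_mul, this, one_pow, one_mul]
  rw [← hz, mul_pow, hI] at hr
  obtain ⟨s, hs⟩ := int_fermat p hp z.re
  obtain ⟨t, ht⟩ := int_fermat p hp z.im
  refine ⟨s + I * t + z.re * (I * z.im) * r, ?_⟩
  linear_combination hr + hs + I * ht - hz

lemma fermat' (p : ℕ) (hp : p.Prime) (h4 : p % 4 = 1) {z ρ : GaussianInt} (hρ : ρ ∣ p)
    (h : IsCoprime z ρ) : ρ ∣ z ^ (p - 1) - 1 := by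
  have := hρ.trans (fermat p hp h4 z)
  have e : z ^ p - z = z * (z ^ (p - 1) - 1) := by
    obtain ⟨k, hk⟩ : ∃ k, p = k + 1 := ⟨p - 1, by have := hp.pos; omega⟩
    subst hk; simp; ring
  rw [e] at this
  exact h.symm.dvd_of_dvd_mul_left this

lemma prime_of_norm {p : ℕ} (hp : p.Prime) {π : GaussianInt} (h : π.norm = p) : Prime π := by
  apply Irreducible.prime
  constructor
  · intro hu
    rw [← Zsqrtd.norm_eq_one_iff, h] at hu
    simp at hu
    exact hp.one_lt.ne' hu
  · intro a b hab
    rw [← Zsqrtd.norm_eq_one_iff, ← Zsqrtd.norm_eq_one_iff]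
    have : a.norm.natAbs * b.norm.natAbs = p := by
      rw [← Int.natAbs_mul, ← Zsqrtd.norm_mul, ← hab, h]; simp
    rw [← this] at hp
    rcases Nat.prime_mul_iff.mp hp with h | h
    · right; exact h.2
    · left; exact h.2

end GaussBdd
namespace GaussBdd
open Matrix

section unitstep
variable {R : Type*} [CommRing R] {l : SpecialLinearGroup (Fin 3) R → ℝ} {K : ℝ}

lemma exists_row {a b : R} (h : IsCoprime a b) :
    ∃ B : SpecialLinearGroup (Fin 2) R, B 0 0 = a ∧ B 0 1 = b := by
  obtain ⟨u, v, huv⟩ := h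
  exact ⟨mk2 a b (-v) u (by linear_combination huv), rfl, rfl⟩

lemma row_coprime (B : SpecialLinearGroup (Fin 2) R) : IsCoprime (B 0 0) (B 0 1) :=
  ⟨B 1 1, -B 1 0, by linear_combination det2 B⟩

lemma Std.unit (H : Std l K) {ε ε' : R} (h : ε * ε' - 0 * 0 = 1)
    {A B : SpecialLinearGroup (Fin 2) R} (h0 : A 0 0 = ε * B 0 0) (h1 : A 0 1 = B 0 1) :
    l (emb A) ≤ l (emb B) + l (emb (mk2 ε 0 0 ε' h)) + K := by
  have h' : ε * ε' = 1 := by linear_combination h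
  have hB := det2 B
  let B3 : SpecialLinearGroup (Fin 2) R := mk2 (ε * B 0 0) (B 0 1) (B 1 0) (ε' * B 1 1)
    (by linear_combination hB + (B 0 0 * B 1 1) * h')
  let D : SpecialLinearGroup (Fin 3) R := ⟨!![1, 0, 0; 0, ε, 0; 0, 0, ε'], by
    simp [Matrix.det_fin_three, h']⟩
  have e : emb B3 * D = D * (emb (mk2 ε 0 0 ε' h) * emb B) := by
    ext i j; simp only [mul3]
    fin_cases i <;> fin_cases j <;> simp [D, B3, emb_coe]
    · ring
    · linear_combination (-B 1 0) * h'
    · ring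
  have e2 := eq_mul_inv_of_mul_eq e
  have i1 : l (emb B3) ≤ l (emb (mk2 ε 0 0 ε' h)) + l (emb B) := by
    rw [e2, H.ci.conj]; exact H.ci.mul _ _
  have i2 : Nr l K (emb A) (emb B3) := H.row h0 h1
  have := H.ci.le_of_nr i2
  linarith

end unitstep

variable {l : SpecialLinearGroup (Fin 3) GaussianInt → ℝ} {K : ℝ}

lemma four_cases (π z : GaussianInt) (hπ : Prime π) (h : π ∣ z ^ 4 - 1) :
    ∃ ε : GaussianInt, ε ^ 4 = 1 ∧ π ∣ z - ε := by
  have hI := I_sq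
  have e : z ^ 4 - 1 = (z - 1) * ((z - (-1)) * ((z - I) * (z - (-I)))) := by
    linear_combination (z ^ 2 - 1) * hI
  rw [e] at h
  rcases hπ.dvd_or_dvd h with h | h
  · exact ⟨1, by ring, h⟩
  rcases hπ.dvd_or_dvd h with h | h
  · exact ⟨-1, by ring, h⟩
  rcases hπ.dvd_or_dvd h with h | h
  · exact ⟨I, by linear_combination (I * I - 1) * hI, h⟩
  · exact ⟨-I, by linear_combination (I * I - 1) * hI, h⟩

lemma unit_cases (ε : GaussianInt) (h : ε ^ 4 = 1) : ε = 1 ∨ ε = -1 ∨ ε = I ∨ ε = -I := by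
  have hI := I_sq
  have e : (ε - 1) * ((ε + 1) * ((ε - I) * (ε + I))) = 0 := by
    linear_combination h - (ε ^ 2 - 1) * hI
  rcases mul_eq_zero.mp e with h | h
  · left; linear_combination h
  rcases mul_eq_zero.mp h with h | h
  · right; left; linear_combination h
  rcases mul_eq_zero.mp h with h | h
  · right; right; left; linear_combination h
  · right; right; right; linear_combination h

lemma exists_kappa (j : ℤ) : ∃ κ : ℤ, 8 ∣ κ - 5 ∧ (2 * j + 1) ∣ κ - 2 ∧
    IsCoprime κ (8 * (2 * j + 1)) := by
  have h2 : IsCoprime (2 : ℤ) (2 * j + 1) := ⟨-j, 1, by ring⟩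
  have h8 : IsCoprime (8 : ℤ) (2 * j + 1) := by
    have := h2.pow_left (m := 3)
    norm_num at this; exact this
  obtain ⟨u, v, huv⟩ := h8
  refine ⟨5 + 8 * (-3 * u), ⟨-3 * u, by ring⟩, ⟨3 * v, by linear_combination -3 * huv⟩, ?_⟩
  apply IsCoprime.mul_right
  · have : IsCoprime (5 : ℤ) 8 := ⟨5, -3, by norm_num⟩
    exact this.add_mul_left_left _
  · have := h2.add_mul_left_left (3 * v)
    have e : 5 + 8 * (-3 * u) = 2 + (2 * j + 1) * (3 * v) := by linear_combination -3 * huv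
    rw [e]; exact this

/-- The arithmetic input: a matrix with a prime lower left corner. -/
lemma exists_A (p j : ℕ) (hpj : p = 8 * j + 5) (π x0 : GaussianInt) (hπp : π ∣ p)
    (hx0 : IsCoprime x0 π) : ∃ (A : SpecialLinearGroup (Fin 2) GaussianInt) (c e : ℕ),
      c.Prime ∧ A 0 1 = π ∧ A 1 0 = c ∧ π ∣ A 0 0 - x0 ∧ c = 4 * e + 1 ∧
      Nat.gcd (2 * j + 1) e = 1 := by
  obtain ⟨ϖ, hϖ⟩ := hπp
  set P : GaussianInt := (p : GaussianInt) with hP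
  have hy0 : IsCoprime (x0 + P * (1 - x0)) (π * (P - 1)) := by
    apply IsCoprime.mul_right
    · rw [hϖ, mul_assoc]; exact hx0.add_mul_left_left _
    · exact ⟨1, -(1 - x0), by ring⟩
  obtain ⟨s, hs⟩ := exists_primitive _ _ hy0
  set x := x0 + P * (1 - x0) + s * (π * (P - 1)) with hx
  have hxπ : IsCoprime x π := by
    have := hx0.add_mul_left_left (ϖ * (1 - x0) + s * (P - 1))
    have e : x = x0 + π * (ϖ * (1 - x0) + s * (P - 1)) := by rw [hx, hϖ]; ring
    rw [e]; exact this
  have hxp : IsCoprime (((8 * j + 4 : ℤ)) : GaussianInt) x := by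
    refine ⟨-(1 - x0 + s * π), 1, ?_⟩
    have : P = 8 * j + 5 := by rw [hP, hpj]; push_cast; ring
    rw [hx, this]; push_cast; ring
  have hN : IsCoprime x.norm (8 * (2 * j + 1) : ℤ) := by
    have h1 := (cop_norm hxp).symm.pow_right (n := 2)
    exact h1.of_isCoprime_of_dvd_right ⟨2 * (2 * j + 1), by ring⟩
  obtain ⟨κ, hκ8, hκq, hκ⟩ := exists_kappa j
  obtain ⟨u, v, huv⟩ := hxπ
  obtain ⟨c, hc, hxc, hM⟩ := dirichlet x (-v) hs ⟨-π, u, by linear_combination huv⟩ _ κ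
    (by positivity) hN hκ
  obtain ⟨w, hw⟩ := hxc
  have h8 : (8 : ℤ) ∣ c - 5 := by
    have := dvd_add ((dvd_mul_right _ _).trans hM) hκ8
    have e : (c : ℤ) - κ + (κ - 5) = c - 5 := by ring
    rwa [e] at this
  have hq : (2 * j + 1 : ℤ) ∣ c - 2 := by
    have := dvd_add ((dvd_mul_left _ _).trans hM) hκq
    have e : (c : ℤ) - κ + (κ - 2) = c - 2 := by ring
    rwa [e] at this
  obtain ⟨e, he⟩ : ∃ e, c = 4 * e + 1 := ⟨c / 4, by omega⟩
  refine ⟨mk2 x π c (u + π * w) (by linear_combination huv - π * hw), c, e, hc, rfl, rfl, ?_, he, ?_⟩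
  · exact ⟨ϖ * (1 - x0) + s * (P - 1), by simp only [mk2_00]; rw [hx, hϖ]; ring⟩
  · have : IsCoprime (2 * j + 1 : ℤ) e := by
      obtain ⟨k, hk⟩ := hq
      refine ⟨-k, 4, ?_⟩
      have : (c : ℤ) = 4 * e + 1 := by exact_mod_cast he
      linear_combination hk - this
    have := Int.isCoprime_iff_gcd_eq_one.mp this
    exact_mod_cast this

lemma unit_inv {ε : GaussianInt} (h : ε ^ 4 = 1) : ε * ε ^ 3 - 0 * 0 = 1 := by
  linear_combination h

lemma Std.primeRow (H : Std l K) {KU : ℝ}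
    (hU : ∀ ε (h : ε ^ 4 = 1), l (emb (mk2 ε 0 0 (ε ^ 3) (unit_inv h))) ≤ KU)
    {p j : ℕ} (hp : p.Prime) (hpj : p = 8 * j + 5) {π : GaussianInt} (hπ : π.norm = p)
    {B : SpecialLinearGroup (Fin 2) GaussianInt} (hB : B 0 1 = π) :
    l (emb B) ≤ 88 * K + KU := by
  have hπp : π ∣ (p : GaussianInt) := by
    refine ⟨star π, ?_⟩
    rw [← Zsqrtd.norm_eq_mul_conj, hπ]; simp
  have hπP := prime_of_norm hp hπ
  have hc : IsCoprime (B 0 0) π := hB ▸ row_coprime B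
  set y := B 0 0 with hy
  have hp4 : p % 4 = 1 := by omega
  have hf := fermat' p hp hp4 hπp hc
  have hp1 : p - 1 = 4 * (2 * j + 1) := by omega
  obtain ⟨ε, hε, hzε⟩ := four_cases π (y ^ (2 * j + 1)) hπP (by
    rw [← pow_mul, mul_comm, ← hp1]; exact hf)
  have hε1 : (ε ^ (2 * j + 1)) ^ 4 = 1 := by rw [← pow_mul, mul_comm, pow_mul, hε, one_pow]
  set ε1 := ε ^ (2 * j + 1) with hε1d
  have d1 : π ∣ (y ^ (2 * j + 1)) ^ (2 * j + 1) - ε1 :=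
    hzε.trans (sub_dvd_pow_sub_pow _ _ _)
  set J := j * j + j with hJ
  have e1 : (y ^ (2 * j + 1)) ^ (2 * j + 1) = y * (y ^ J) ^ 4 := by
    rw [← pow_mul, ← pow_mul, ← pow_succ']
    congr 1; rw [hJ]; ring
  rw [e1] at d1
  set x0 := y ^ (J * (8 * j + 3)) with hx0
  have hc0 : IsCoprime x0 π := hc.pow_left
  have d2 : π ∣ y ^ J * x0 - 1 := by
    have e2 : y ^ J * x0 = (y ^ (p - 1)) ^ J := by
      rw [hx0, ← pow_add, ← pow_mul]
      congr 1; rw [hp1]; ring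
    rw [e2]
    exact hf.trans (sub_one_dvd_pow_sub_one _ _)
  obtain ⟨A, c, e, hcp, hA1, hAc, hAx, hce, hg⟩ := exists_A p j hpj π x0 hπp hc0
  have d3 : π ∣ (A 0 0) ^ 4 - x0 ^ 4 := hAx.trans (sub_dvd_pow_sub_pow _ _ _)
  have d4 : π ∣ (y ^ J * x0) ^ 4 - 1 := d2.trans (sub_one_dvd_pow_sub_one _ _)
  have d5 : π ∣ y - ε1 * (A 0 0) ^ 4 := by
    have e3 : y - ε1 * (A 0 0) ^ 4 = (y * (y ^ J) ^ 4 - ε1) * x0 ^ 4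
        - y * ((y ^ J * x0) ^ 4 - 1) - ε1 * ((A 0 0) ^ 4 - x0 ^ 4) := by ring
    rw [e3]
    exact dvd_sub (dvd_sub (d1.mul_right _) (d4.mul_left _)) (d3.mul_left _)
  have hAπ : IsCoprime (A 0 0) π := hA1 ▸ row_coprime A
  have hA10 : IsCoprime (A 0 0) (A 1 0) := ⟨A 1 1, -A 0 1, by linear_combination det2 A⟩
  obtain ⟨B4, h40, h41⟩ := exists_row (hAπ.pow_left (m := 4))
  have i1 : l (emb B4) ≤ 85 * K := by
    apply H.pow_gcd A (r := 2 * (2 * j + 1)) (s := 2 * e) ?_ ?_ ?_ B4 h40 (by rw [h41, hA1])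
    · rw [hA1]
      have := fermat' p hp hp4 hπp hAπ
      rw [hp1] at this
      rw [← mul_assoc]; exact this
    · have := fermat' c hcp (by omega) (ρ := A 1 0) (by rw [hAc]) hA10
      have e4 : c - 1 = 2 * (2 * e) := by omega
      rw [e4] at this; exact this
    · rw [← mul_assoc, ← mul_assoc, Nat.gcd_mul_left, hg]; norm_num
  have hu1 : IsCoprime (ε1 * (A 0 0) ^ 4) π :=
    IsCoprime.mul_left ⟨ε1 ^ 3, 0, by linear_combination hε1⟩ (hAπ.pow_left)
  obtain ⟨B5, h50, h51⟩ := exists_row hu1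
  have i2 := H.unit (unit_inv hε1) (A := B5) (B := B4) (by rw [h50, h40]) (by rw [h51, h41])
  have i3 := hU ε1 hε1
  obtain ⟨k, hk⟩ := d5
  have n1 := H.row_add (A := B) (B := B5) k
    (by rw [h50, h51, ← hy]; linear_combination hk) (by rw [h51, hB])
  have := H.ci.le_of_nr n1
  linarith

lemma Std.all (H : Std l K) {KU : ℝ}
    (hU : ∀ ε (h : ε ^ 4 = 1), l (emb (mk2 ε 0 0 (ε ^ 3) (unit_inv h))) ≤ KU)
    (A : SpecialLinearGroup (Fin 2) GaussianInt) : l (emb A) ≤ 190 * K + 2 * KU := by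
  have hab := row_coprime A
  obtain ⟨t, ht⟩ := exists_coprime_add (A 0 0) (A 0 1) 2 (by
    intro h; have := congrArg Zsqrtd.re h; simp at this)
    (fun q hq _ h1 h2 => hq.not_isUnit (hab.isUnit_of_dvd' h1 h2))
  have hab1 : IsCoprime (A 0 0 + t * A 0 1) (A 0 1) := by
    have := hab.add_mul_left_left t
    rwa [mul_comm] at this
  obtain ⟨s, hs⟩ := exists_primitive _ _ (ht.mul_right hab1)
  set a1 := A 0 0 + t * A 0 1 with ha1
  set a2 := a1 + s * (2 * A 0 1) with ha2
  have hcop : IsCoprime a2 (2 * A 0 1) := by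
    have := (ht.mul_right hab1).add_mul_left_left s
    rwa [mul_comm _ s] at this
  have hc2 : IsCoprime (((2 : ℤ)) : GaussianInt) a2 := by
    have := hcop.of_mul_right_left.symm
    exact_mod_cast this
  have hcb : IsCoprime a2 (A 0 1) := hcop.of_mul_right_right
  have hN : IsCoprime a2.norm 8 := by
    have := (cop_norm hc2).symm.pow_right (n := 3)
    norm_num at this; exact this
  obtain ⟨p, hp, hpb, hp8⟩ := dirichlet a2 (A 0 1) hs hcb.symm 8 5 (by norm_num) hN
    ⟨5, -3, by norm_num⟩
  obtain ⟨j, hj⟩ : ∃ j, p = 8 * j + 5 := ⟨p / 8, by omega⟩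
  have := Fact.mk hp
  obtain ⟨m, n, hmn⟩ := Nat.Prime.sq_add_sq (p := p) (by omega)
  let π : GaussianInt := ⟨m, n⟩
  have hπ : π.norm = p := by
    simp only [π, Zsqrtd.norm_def, ← hmn]; push_cast; ring
  have hπ' : (star π).norm = p := by rw [Zsqrtd.norm_conj, hπ]
  have hpp : (p : GaussianInt) = π * star π := by
    rw [← Zsqrtd.norm_eq_mul_conj, hπ]; simp
  obtain ⟨w, hw⟩ := hpb
  have hcp : IsCoprime a2 (p : GaussianInt) := by
    have := hcb.add_mul_left_right w
    have e : (p : GaussianInt) = A 0 1 + a2 * w := by linear_combination hw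
    rw [e]; exact this
  obtain ⟨B, hB0, hB1⟩ := exists_row hcb
  obtain ⟨A3, h30, h31⟩ := exists_row hcp
  rw [hpp] at hcp
  obtain ⟨A1, h10, h11⟩ := exists_row hcp.of_mul_right_left
  obtain ⟨A2, h20, h21⟩ := exists_row hcp.of_mul_right_right
  have i1 := H.primeRow hU hp hj hπ h11
  have i2 := H.primeRow hU hp hj hπ' h21
  have n1 := H.mennicke (A1 := A1) (A2 := A2) (A3 := A3) (by rw [h10, h30]) (by rw [h20, h30])
    (by rw [h31, h11, h21, hpp])
  have n2 := H.row_add' (A := B) (B := A3) (-w) (by rw [hB0, h30])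
    (by rw [hB1, h31, h30]; linear_combination -hw)
  have n3 := H.row_add (A := A) (B := B) (-(t + 2 * s))
    (by rw [hB0, hB1, ha2, ha1]; ring) hB1.symm
  have k1 := H.ci.le_of_nr n1
  have k2 := H.ci.le_of_nr n2
  have k3 := H.ci.le_of_nr n3
  have k4 := H.ci.mul (emb A2) (emb A1)
  linarith

lemma bound_emb (hl : CI l) : ∃ C, ∀ A, l (emb A) ≤ C := by
  obtain ⟨K0, hK0, hK⟩ := exists_K hl (by simp)
  have p1 := hl.nonneg ww
  have p2 := hl.nonneg vv
  have p3 := hl.nonneg (emb (-1))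
  have H : Std l (K0 + l ww + l vv + l (emb (-1))) :=
    ⟨hl, by linarith, fun i j hij x => (hK i j hij x).trans (by linarith), by linarith,
      by linarith, by linarith⟩
  let f : GaussianInt → ℝ := fun ε => if h : ε ^ 4 = 1 then
    l (emb (mk2 ε 0 0 (ε ^ 3) (unit_inv h))) else 0
  have hf : ∀ ε, 0 ≤ f ε := by
    intro ε; simp only [f]; split_ifs
    · exact hl.nonneg _
    · exact le_rfl
  refine ⟨_, fun A => H.all (KU := f 1 + f (-1) + f I + f (-I)) (fun ε h => ?_) A⟩
  have e : l (emb (mk2 ε 0 0 (ε ^ 3) (unit_inv h))) = f ε := by simp only [f, dif_pos h]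
  rw [e]
  have q1 := hf 1
  have q2 := hf (-1)
  have q3 := hf I
  have q4 := hf (-I)
  rcases unit_cases ε h with h | h | h | h <;> rw [h] <;> linarith

end GaussBdd
namespace GaussBdd
open Matrix

section blocks
variable {R : Type*} [CommRing R] {κ : Type*} [Fintype κ] [DecidableEq κ]

/-- Upper block unipotent. -/
def bU (f : κ → R) : SpecialLinearGroup (κ ⊕ Fin 1) R :=
  ⟨fromBlocks 1 (replicateCol (Fin 1) f) 0 1, by rw [Matrix.det_fromBlocks_zero₂₁]; simp⟩

/-- Lower block unipotent. -/
def bL (f : κ → R) : SpecialLinearGroup (κ ⊕ Fin 1) R :=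
  ⟨fromBlocks 1 0 (replicateRow (Fin 1) f) 1, by rw [Matrix.det_fromBlocks_zero₁₂]; simp⟩

/-- Block embedding. -/
def bE : SpecialLinearGroup κ R →* SpecialLinearGroup (κ ⊕ Fin 1) R where
  toFun h := ⟨fromBlocks (h : Matrix κ κ R) 0 0 1, by
    rw [Matrix.det_fromBlocks_zero₁₂]; simp⟩
  map_one' := by apply sl_ext; simp
  map_mul' g h := by 
    apply sl_ext
    change fromBlocks ((g : Matrix κ κ R) * (h : Matrix κ κ R)) 0 0 1 =
      fromBlocks (g : Matrix κ κ R) 0 0 (1 : Matrix (Fin 1) (Fin 1) R) *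
        fromBlocks (h : Matrix κ κ R) 0 0 (1 : Matrix (Fin 1) (Fin 1) R)
    simp [Matrix.fromBlocks_multiply]

lemma bU_coe (f : κ → R) : (bU f : Matrix (κ ⊕ Fin 1) (κ ⊕ Fin 1) R) =
    fromBlocks 1 (replicateCol (Fin 1) f) 0 1 := rfl
lemma bL_coe (f : κ → R) : (bL f : Matrix (κ ⊕ Fin 1) (κ ⊕ Fin 1) R) =
    fromBlocks 1 0 (replicateRow (Fin 1) f) 1 := rfl
lemma bE_coe (h : SpecialLinearGroup κ R) : (bE h : Matrix (κ ⊕ Fin 1) (κ ⊕ Fin 1) R) =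
    fromBlocks (h : Matrix κ κ R) 0 0 1 := rfl

lemma bU_add (f g : κ → R) : bU (f + g) = bU f * bU g := by
  apply sl_ext
  rw [Matrix.SpecialLinearGroup.coe_mul, bU_coe, bU_coe, bU_coe, fromBlocks_multiply]
  simp [add_comm]

lemma bL_add (f g : κ → R) : bL (f + g) = bL f * bL g := by
  apply sl_ext
  rw [Matrix.SpecialLinearGroup.coe_mul, bL_coe, bL_coe, bL_coe, fromBlocks_multiply]
  simp

lemma bU_zero : bU (0 : κ → R) = 1 := by
  have := bU_add (0 : κ → R) 0
  simpa using this

lemma bL_zero : bL (0 : κ → R) = 1 := by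
  have := bL_add (0 : κ → R) 0
  simpa using this

lemma bU_single (i : κ) (x : R) : bU (Pi.single i x) =
    SpecialLinearGroup.transvection (i := Sum.inl i) (j := Sum.inr (0 : Fin 1)) (by simp) x := by
  apply sl_ext
  rw [bU_coe, Matrix.SpecialLinearGroup.transvection_coe]
  ext (a | a) (b | b) <;>
    simp [Matrix.single_apply, Matrix.one_apply, Pi.single_apply, Fin.fin_one_eq_zero, eq_comm]

lemma bL_single (i : κ) (x : R) : bL (Pi.single i x) =
    SpecialLinearGroup.transvection (i := Sum.inr (0 : Fin 1)) (j := Sum.inl i) (by simp) x := by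
  apply sl_ext
  rw [bL_coe, Matrix.SpecialLinearGroup.transvection_coe]
  ext (a | a) (b | b) <;>
    simp [Matrix.single_apply, Matrix.one_apply, Pi.single_apply, Fin.fin_one_eq_zero, eq_comm]

lemma bound_of_single {G : Type*} [Group G] {l : G → ℝ} (hl : CI l) {K : ℝ}
    (F : (κ → R) → G) (h0 : F 0 = 1) (ha : ∀ f g, F (f + g) = F f * F g)
    (hs : ∀ i x, l (F (Pi.single i x)) ≤ K) (f : κ → R) : l (F f) ≤ Fintype.card κ * K := by
  have key : ∀ s : Finset κ, l (F (∑ i ∈ s, Pi.single i (f i))) ≤ s.card * K := by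
    intro s
    induction s using Finset.induction_on with
    | empty => simp [h0, hl.one]
    | insert a s has ih =>
      rw [Finset.sum_insert has, ha, Finset.card_insert_of_notMem has]
      have := hl.mul (F (Pi.single a (f a))) (F (∑ i ∈ s, Pi.single i (f i)))
      have := hs a (f a)
      push_cast
      linarith
  have := key Finset.univ
  rwa [Finset.univ_sum_single] at this

lemma bU_mul_inl (f : κ → R) (g : SpecialLinearGroup (κ ⊕ Fin 1) R) (i j) :
    (bU f * g) (Sum.inl i) j = g (Sum.inl i) j + f i * g (Sum.inr 0) j := by
  simp [bU_coe, Matrix.mul_apply, Matrix.one_apply]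

lemma bU_mul_inr (f : κ → R) (g : SpecialLinearGroup (κ ⊕ Fin 1) R) (j) :
    (bU f * g) (Sum.inr 0) j = g (Sum.inr 0) j := by
  simp [bU_coe, Matrix.mul_apply]

lemma bL_mul_inl (f : κ → R) (g : SpecialLinearGroup (κ ⊕ Fin 1) R) (i j) :
    (bL f * g) (Sum.inl i) j = g (Sum.inl i) j := by
  simp [bL_coe, Matrix.mul_apply, Matrix.one_apply]

lemma bL_mul_inr (f : κ → R) (g : SpecialLinearGroup (κ ⊕ Fin 1) R) (j) :
    (bL f * g) (Sum.inr 0) j = ∑ i, f i * g (Sum.inl i) j + g (Sum.inr 0) j := by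
  simp [bL_coe, Matrix.mul_apply]

lemma last_step (g : SpecialLinearGroup (κ ⊕ Fin 1) R) (h0 : ∀ i, g (Sum.inl i) (Sum.inr 0) = 0)
    (h1 : g (Sum.inr 0) (Sum.inr 0) = 1) : ∃ w h, g = bL w * bE h := by
  set M := (g : Matrix (κ ⊕ Fin 1) (κ ⊕ Fin 1) R) with hM
  have e12 : M.toBlocks₁₂ = 0 := by
    ext i j; fin_cases j; exact h0 i
  have e22 : M.toBlocks₂₂ = 1 := by
    ext i j; fin_cases i; fin_cases j; simpa [Matrix.toBlocks₂₂] using h1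
  have e : M = fromBlocks M.toBlocks₁₁ 0 M.toBlocks₂₁ 1 := by
    conv_lhs => rw [← Matrix.fromBlocks_toBlocks M, e12, e22]
  have hd : M.toBlocks₁₁.det = 1 := by
    have := g.det_coe
    rw [← hM, e, Matrix.det_fromBlocks_zero₁₂] at this
    simpa using this
  let h : SpecialLinearGroup κ R := ⟨M.toBlocks₁₁, hd⟩
  refine ⟨fun i => (M.toBlocks₂₁ * ((h⁻¹ : SpecialLinearGroup κ R) : Matrix κ κ R)) 0 i, h, ?_⟩
  apply sl_ext
  rw [← hM, Matrix.SpecialLinearGroup.coe_mul, bL_coe, bE_coe, fromBlocks_multiply]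
  have e3 : replicateRow (Fin 1)
      (fun i => (M.toBlocks₂₁ * ((h⁻¹ : SpecialLinearGroup κ R) : Matrix κ κ R)) 0 i)
      = M.toBlocks₂₁ * ((h⁻¹ : SpecialLinearGroup κ R) : Matrix κ κ R) := by
    ext i j; fin_cases i; rfl
  rw [e3, Matrix.mul_assoc, ← Matrix.SpecialLinearGroup.coe_mul, inv_mul_cancel]
  simp only [Matrix.one_mul, Matrix.mul_zero, add_zero, Matrix.SpecialLinearGroup.coe_one,
    Matrix.mul_one, zero_add]
  exact e

lemma stable_range [IsDomain R] [IsPrincipalIdealRing R] (hc : 2 ≤ Fintype.card κ)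
    (v c : κ → R) (d e : R) (h : ∑ i, c i * v i + e * d = 1) :
    ∃ t c' : κ → R, ∑ i, c' i * (v i + t i * d) = 1 := by
  have hone : ∀ J : Ideal R, (∀ i, v i ∈ J) → d ∈ J → (1 : R) ∈ J := by
    intro J hv hd
    rw [← h]
    exact J.add_mem (J.sum_mem fun i _ => J.mul_mem_left _ (hv i)) (J.mul_mem_left _ hd)
  suffices hs : ∃ t : κ → R, (1 : R) ∈ Ideal.span (Set.range fun i => v i + t i * d) by
    obtain ⟨t, ht⟩ := hs
    obtain ⟨c', hc'⟩ := Ideal.mem_span_range_iff_exists_fun.mp ht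
    exact ⟨t, c', hc'⟩
  obtain ⟨i0, i1, h01⟩ := Fintype.exists_pair_of_one_lt_card (α := κ) (by omega)
  obtain ⟨γ, hγ⟩ := (IsPrincipalIdealRing.principal (Ideal.span (v '' {i | i ≠ i0}))).principal
  rw [Ideal.submodule_span_eq] at hγ
  have hmem : ∀ i, i ≠ i0 → γ ∣ v i := by
    intro i hi
    rw [← Ideal.mem_span_singleton, ← hγ]
    exact Ideal.subset_span ⟨i, hi, rfl⟩
  by_cases h0 : γ = 0
  · refine ⟨Pi.single i1 1, ?_⟩
    have hJ : ∀ i, v i + (Pi.single i1 1 : κ → R) i * d ∈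
      Ideal.span (Set.range fun i => v i + (Pi.single i1 1 : κ → R) i * d) :=
      fun i => Ideal.subset_span ⟨i, rfl⟩
    apply hone
    · intro i
      by_cases hi : i = i0
      · have := hJ i
        subst hi
        simpa [Pi.single_apply, h01] using this
      · have := hmem i hi
        rw [h0, zero_dvd_iff] at this
        rw [this]; exact Ideal.zero_mem _
    · have := hJ i1
      have h2 := hmem i1 h01.symm
      rw [h0, zero_dvd_iff] at h2
      simpa [h2] using this
  · obtain ⟨τ, x, y, hxy⟩ := exists_coprime_add (v i0) d γ h0 (by
      intro q hq h1 h2 h3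
      apply hq.not_isUnit
      rw [isUnit_iff_dvd_one, ← Ideal.mem_span_singleton]
      apply hone
      · intro i
        rw [Ideal.mem_span_singleton]
        by_cases hi : i = i0
        · rw [hi]; exact h2
        · exact h1.trans (hmem i hi)
      · rwa [Ideal.mem_span_singleton])
    refine ⟨Pi.single i0 τ, ?_⟩
    set J := Ideal.span (Set.range fun i => v i + (Pi.single i0 τ : κ → R) i * d) with hJd
    have hJ : ∀ i, v i + (Pi.single i0 τ : κ → R) i * d ∈ J :=
      fun i => Ideal.subset_span ⟨i, rfl⟩
    have hγJ : γ ∈ J := by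
      have : Ideal.span (v '' {i | i ≠ i0}) ≤ J := by
        rw [Ideal.span_le]
        rintro _ ⟨i, hi, rfl⟩
        have hi' : i ≠ i0 := hi
        simpa [Pi.single_apply, hi'] using hJ i
      apply this
      rw [hγ]; exact Ideal.mem_span_singleton_self γ
    have hi0 : v i0 + τ * d ∈ J := by simpa using hJ i0
    rw [← hxy]
    exact J.add_mem (J.mul_mem_left _ hi0) (J.mul_mem_left _ hγJ)

lemma decomp [IsDomain R] [IsPrincipalIdealRing R] (hc : 2 ≤ Fintype.card κ)
    (g : SpecialLinearGroup (κ ⊕ Fin 1) R) :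
    ∃ t c v w h, bU v * (bL c * (bU t * g)) = bL w * bE h := by
  have hcol : ∑ i, (g⁻¹) (Sum.inr 0) (Sum.inl i) * g (Sum.inl i) (Sum.inr 0) +
      (g⁻¹) (Sum.inr 0) (Sum.inr 0) * g (Sum.inr 0) (Sum.inr 0) = 1 := by
    have h1 : (g⁻¹ * g) (Sum.inr 0) (Sum.inr 0) = 1 := by
      rw [inv_mul_cancel]; simp
    rw [Matrix.SpecialLinearGroup.coe_mul, Matrix.mul_apply, Fintype.sum_sum_type] at h1
    simpa using h1
  obtain ⟨t, c, htc⟩ := stable_range hc (fun i => g (Sum.inl i) (Sum.inr 0)) _ _ _ hcol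
  refine ⟨t, fun i => (1 - g (Sum.inr 0) (Sum.inr 0)) * c i,
    fun i => -(g (Sum.inl i) (Sum.inr 0) + t i * g (Sum.inr 0) (Sum.inr 0)), ?_⟩
  apply last_step
  · intro i
    rw [bU_mul_inl, bL_mul_inl, bL_mul_inr, bU_mul_inl, bU_mul_inr]
    simp only [bU_mul_inl, mul_assoc, ← Finset.mul_sum]
    rw [htc]; ring
  · rw [bU_mul_inr, bL_mul_inr, bU_mul_inr]
    simp only [bU_mul_inl, mul_assoc, ← Finset.mul_sum]
    rw [htc]; ring

lemma block_bound [IsDomain R] [IsPrincipalIdealRing R] (hc : 2 ≤ Fintype.card κ)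
    {l : SpecialLinearGroup (κ ⊕ Fin 1) R → ℝ} (hl : CI l) {C : ℝ} (hC : ∀ h, l (bE h) ≤ C) :
    ∃ C', ∀ g, l g ≤ C' := by
  obtain ⟨K, hK0, hK⟩ := exists_K hl (by simp; omega)
  have hU := bound_of_single hl bU bU_zero bU_add (K := K)
    (fun i x => by rw [bU_single]; exact hK _ _ _ _)
  have hL := bound_of_single hl bL bL_zero bL_add (K := K)
    (fun i x => by rw [bL_single]; exact hK _ _ _ _)
  refine ⟨4 * (Fintype.card κ * K) + C, fun g => ?_⟩
  obtain ⟨t, c, v, w, h, hg⟩ := decomp hc g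
  have e : g = (bU t)⁻¹ * ((bL c)⁻¹ * ((bU v)⁻¹ * (bL w * bE h))) := by
    rw [← hg]; group
  have i1 := hl.mul (bU t)⁻¹ ((bL c)⁻¹ * ((bU v)⁻¹ * (bL w * bE h)))
  have i2 := hl.mul (bL c)⁻¹ ((bU v)⁻¹ * (bL w * bE h))
  have i3 := hl.mul (bU v)⁻¹ (bL w * bE h)
  have i4 := hl.mul (bL w) (bE h)
  rw [← e] at i1
  rw [hl.inv] at i1 i2 i3
  have := hU t
  have := hU v
  have := hL c
  have := hL w
  have := hC h
  linarith

/-- Reindexing. -/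
def rdx {μ ν : Type*} [Fintype μ] [DecidableEq μ] [Fintype ν] [DecidableEq ν] (e : μ ≃ ν) :
    SpecialLinearGroup μ R →* SpecialLinearGroup ν R where
  toFun g := ⟨Matrix.reindex e e (g : Matrix μ μ R), by rw [Matrix.det_reindex_self]; exact g.det_coe⟩
  map_one' := by apply sl_ext; simp
  map_mul' g h := by 
    apply sl_ext
    change Matrix.reindex e e ((g : Matrix μ μ R) * (h : Matrix μ μ R)) =
      Matrix.reindex e e (g : Matrix μ μ R) * Matrix.reindex e e (h : Matrix μ μ R)
    simp [Matrix.submatrix_mul_equiv]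

lemma rdx_coe {μ ν : Type*} [Fintype μ] [DecidableEq μ] [Fintype ν] [DecidableEq ν] (e : μ ≃ ν)
    (g : SpecialLinearGroup μ R) : (rdx e g : Matrix ν ν R) =
      Matrix.reindex e e (g : Matrix μ μ R) := rfl

lemma rdx_rdx {μ ν : Type*} [Fintype μ] [DecidableEq μ] [Fintype ν] [DecidableEq ν] (e : μ ≃ ν)
    (g : SpecialLinearGroup ν R) : rdx e (rdx e.symm g) = g := by
  apply sl_ext; rw [rdx_coe, rdx_coe]; simp

end blocks

lemma bnd_step (n : ℕ) (hn : 2 ≤ n) {l : SpecialLinearGroup (Fin (n + 1)) GaussianInt → ℝ}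
    (hl : CI l) {C : ℝ}
    (hC : ∀ h : SpecialLinearGroup (Fin n) GaussianInt, l (rdx finSumFinEquiv (bE h)) ≤ C) :
    ∃ C', ∀ g, l g ≤ C' := by
  obtain ⟨C', h⟩ := block_bound (by simpa using hn)
    (hl.comap (rdx (finSumFinEquiv (m := n) (n := 1)))) hC
  refine ⟨C', fun g => ?_⟩
  have := h (rdx finSumFinEquiv.symm g)
  simp only [rdx_rdx] at this
  exact this

lemma bnd (n : ℕ) : ∀ {l : SpecialLinearGroup (Fin (n + 3)) GaussianInt → ℝ}, CI l →
    ∃ C, ∀ g, l g ≤ C := by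
  induction n with
  | zero =>
    intro l hl
    obtain ⟨C, hC⟩ := bound_emb hl
    refine bnd_step 2 le_rfl hl (C := C) fun h => ?_
    have : rdx finSumFinEquiv (bE h) = emb h := by
      apply sl_ext
      rw [emb_coe]
      funext i j
      fin_cases i <;> fin_cases j <;> rfl
    rw [this]; exact hC h
  | succ n ih =>
    intro l hl
    obtain ⟨C, hC⟩ := ih (hl.comap ((rdx (finSumFinEquiv (m := n + 3) (n := 1))).comp bE))
    exact bnd_step (n + 3) (by omega) hl hC

end GaussBdd

/-- For n ≥ 3, every bi-invariant metric on SL(n,ℤ[i]) is bounded, where ℤ[i]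
is the ring of Gaussian integers. -/
theorem SLnGaussianInt_biinvariant_metric_bounded (n : ℕ) (hn : 3 ≤ n)
    (d : Matrix.SpecialLinearGroup (Fin n) GaussianInt →
      Matrix.SpecialLinearGroup (Fin n) GaussianInt → ℝ)
    (d_eq_zero : ∀ g h, d g h = 0 ↔ g = h)
    (d_symm : ∀ g h, d g h = d h g)
    (d_triangle : ∀ g h k, d g k ≤ d g h + d h k)
    (d_left_inv : ∀ k g h, d (k * g) (k * h) = d g h)
    (d_right_inv : ∀ k g h, d (g * k) (h * k) = d g h) :
    ∃ C : ℝ, ∀ g h, d g h ≤ C := by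
  obtain ⟨m, rfl⟩ : ∃ m, n = m + 3 := ⟨n - 3, by omega⟩
  have hl : GaussBdd.CI (fun g => d 1 g) := by
    refine ⟨(d_eq_zero _ _).mpr rfl, fun g h => ?_, fun g => ?_, fun g h => ?_⟩
    · have h1 := d_triangle 1 g (g * h)
      have h2 := d_left_inv g 1 h
      rw [mul_one] at h2
      linarith
    · have h2 := d_left_inv g 1 g⁻¹
      rw [mul_one, mul_inv_cancel, d_symm] at h2
      exact h2.symm
    · have h1 := d_left_inv h 1 g
      have h2 := d_right_inv h⁻¹ (h * 1) (h * g)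
      rw [mul_one, mul_inv_cancel] at h2
      rw [mul_one] at h1
      exact h2.trans h1
  obtain ⟨C, hC⟩ := GaussBdd.bnd m hl
  refine ⟨C, fun g h => ?_⟩
  have h1 := d_left_inv g 1 (g⁻¹ * h)
  rw [mul_one, mul_inv_cancel_left] at h1
  rw [h1]; exact hC _
end

section
/- Let n ≥ 3. Then the commutator length is bounded on SL(n,ℤ): there exists a constant C such that every g ∈ SL(n,ℤ) is a product of at most C commutators, and consequently the stable commutator length vanishes identically: scl(g) = 0 for every g ∈ SL(n,ℤ). -/
/-- The set of all conjugates of elements of `S`. -/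
def conjSet {G : Type*} [Group G] (S : Set G) : Set G :=
  {x | ∃ g : G, ∃ s ∈ S, x = g * s * g⁻¹}

/-- The word norm of `g` with respect to a generating set `T`:
the least length of a word in elements of `T` expressing `g`. -/
noncomputable def wordNorm {G : Type*} [Group G] (T : Set G) (g : G) : ℕ :=
  sInf {k | ∃ l : List G, (∀ x ∈ l, x ∈ T) ∧ l.prod = g ∧ l.length = k}

namespace SLBdd

open Matrix

theorem SLext {ι R : Type*} [CommRing R] [Fintype ι] [DecidableEq ι]
    {A B : Matrix.SpecialLinearGroup ι R}
    (h : (A : Matrix ι ι R) = (B : Matrix ι ι R)) : A = B := Subtype.ext h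

section three
variable {R : Type*} [CommRing R] {A : Type*} [CommGroup A]

/-- Transvection in `SL`. -/
def TV {ι : Type*} [Fintype ι] [DecidableEq ι] {i j : ι} (h : i ≠ j) (x : R) :
    Matrix.SpecialLinearGroup ι R :=
  ⟨Matrix.transvection i j x, Matrix.det_transvection_of_ne i j h x⟩

theorem coe_TV {ι : Type*} [Fintype ι] [DecidableEq ι] {i j : ι} (h : i ≠ j) (x : R) :
    (TV h x : Matrix ι ι R) = Matrix.transvection i j x := rfl

/-- Elementary `3 × 3` matrix. -/
def E3 (i j : Fin 3) (h : i ≠ j) (x : R) : Matrix.SpecialLinearGroup (Fin 3) R :=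
  TV h x

theorem transvection_commutator {ι : Type*} [Fintype ι] [DecidableEq ι] {i j k : ι}
    (hij : i ≠ j) (hik : i ≠ k) (hkj : k ≠ j) (x : R) :
    (TV hik x) *
      TV hkj 1 =
    TV hij x *
      (TV hkj 1 *
      TV hik x) := by
  apply SLext
  simp only [Matrix.SpecialLinearGroup.coe_mul, coe_TV, Matrix.transvection, mul_add, add_mul, one_mul, mul_one]
  simp [Matrix.single_mul_single_of_ne, hij.symm, hkj.symm]
  abel

theorem map_transvection {ι : Type*} [Fintype ι] [DecidableEq ι]
    (φ : Matrix.SpecialLinearGroup ι R →* A) {i j k : ι}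
    (hij : i ≠ j) (hik : i ≠ k) (hkj : k ≠ j) (x : R) :
    φ (TV hij x) = 1 := by
  have h := congrArg φ (transvection_commutator hij hik hkj x)
  simp only [map_mul] at h
  rw [mul_comm (φ (TV hkj 1))] at h
  exact (right_eq_mul.mp h)

theorem map_E3 (φ : Matrix.SpecialLinearGroup (Fin 3) R →* A) (i j : Fin 3) (h : i ≠ j) (x : R) :
    φ (E3 i j h x) = 1 := by
  obtain ⟨k, hk1, hk2⟩ : ∃ k : Fin 3, i ≠ k ∧ k ≠ j := by
    revert i j; decide
  exact map_transvection φ h hk1 hk2 x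

/-- The embedding of `SL₂` in the upper left corner of `SL₃`. -/
def emb : Matrix.SpecialLinearGroup (Fin 2) R →* Matrix.SpecialLinearGroup (Fin 3) R where
  toFun M := ⟨!![M 0 0, M 0 1, 0; M 1 0, M 1 1, 0; 0, 0, 1], by
    have := M.det_coe
    rw [Matrix.det_fin_two] at this
    simp [Matrix.det_fin_three, this]⟩
  map_one' := by
    apply SLext
    ext i j
    fin_cases i <;> fin_cases j <;> simp
  map_mul' M N := by
    apply SLext
    change (!![(M * N) 0 0, (M * N) 0 1, 0; (M * N) 1 0, (M * N) 1 1, 0; 0, 0, 1] : Matrix (Fin 3) (Fin 3) R) =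
      !![M 0 0, M 0 1, 0; M 1 0, M 1 1, 0; 0, 0, 1] *
        !![N 0 0, N 0 1, 0; N 1 0, N 1 1, 0; 0, 0, 1]
    ext i j
    fin_cases i <;> fin_cases j <;>
      simp [Matrix.mul_apply, Fin.sum_univ_two, Fin.sum_univ_three]

theorem coe_emb (M : Matrix.SpecialLinearGroup (Fin 2) R) :
    (emb M : Matrix (Fin 3) (Fin 3) R) =
      !![M 0 0, M 0 1, 0; M 1 0, M 1 1, 0; 0, 0, 1] := rfl

theorem coe_E3 (i j : Fin 3) (h : i ≠ j) (x : R) (k l : Fin 3) :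
    (E3 i j h x : Matrix (Fin 3) (Fin 3) R) k l =
      (if k = l then 1 else 0) + (if i = k ∧ j = l then x else 0) := by
  simp [E3, coe_TV, Matrix.transvection, Matrix.one_apply, Matrix.single_apply]

theorem det2 (M : Matrix.SpecialLinearGroup (Fin 2) R) : M 0 0 * M 1 1 - M 0 1 * M 1 0 = 1 := by
  have := M.det_coe
  rwa [Matrix.det_fin_two] at this

/-- cyclic permutation matrix -/
def P3 : Matrix.SpecialLinearGroup (Fin 3) R :=
  ⟨!![0, 0, 1; 1, 0, 0; 0, 1, 0], by simp [Matrix.det_fin_three]⟩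

/-- signed transposition matrix -/
def Q3 : Matrix.SpecialLinearGroup (Fin 3) R :=
  ⟨!![1, 0, 0; 0, 0, -1; 0, 1, 0], by simp [Matrix.det_fin_three]⟩

def Y3 (M : Matrix.SpecialLinearGroup (Fin 2) R) : Matrix.SpecialLinearGroup (Fin 3) R :=
  ⟨!![1, 0, 0; 0, M 0 0, M 0 1; 0, M 1 0, M 1 1], by
    have := det2 M
    simp [Matrix.det_fin_three, this]⟩

def Z3 (M : Matrix.SpecialLinearGroup (Fin 2) R) : Matrix.SpecialLinearGroup (Fin 3) R :=
  ⟨!![M 0 0, 0, M 0 1; 0, 1, 0; M 1 0, 0, M 1 1], by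
    have := det2 M
    simp [Matrix.det_fin_three, this]⟩

theorem coe_P3 : ((P3 : Matrix.SpecialLinearGroup (Fin 3) R) : Matrix (Fin 3) (Fin 3) R) =
    !![0, 0, 1; 1, 0, 0; 0, 1, 0] := rfl

theorem coe_Q3 : ((Q3 : Matrix.SpecialLinearGroup (Fin 3) R) : Matrix (Fin 3) (Fin 3) R) =
    !![1, 0, 0; 0, 0, -1; 0, 1, 0] := rfl

theorem coe_Y3 (M : Matrix.SpecialLinearGroup (Fin 2) R) :
    (Y3 M : Matrix (Fin 3) (Fin 3) R) =
    !![1, 0, 0; 0, M 0 0, M 0 1; 0, M 1 0, M 1 1] := rfl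

theorem coe_Z3 (M : Matrix.SpecialLinearGroup (Fin 2) R) :
    (Z3 M : Matrix (Fin 3) (Fin 3) R) =
    !![M 0 0, 0, M 0 1; 0, 1, 0; M 1 0, 0, M 1 1] := rfl

theorem map_Y3 (φ : Matrix.SpecialLinearGroup (Fin 3) R →* A) (M : Matrix.SpecialLinearGroup (Fin 2) R) :
    φ (Y3 M) = φ (emb M) := by
  have h : P3 * emb M = Y3 M * P3 := by
    apply SLext
    ext i j
    fin_cases i <;> fin_cases j <;>
      simp [coe_P3, coe_Y3, coe_emb, Matrix.SpecialLinearGroup.coe_mul, Matrix.mul_apply, Fin.sum_univ_three]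
  have h := congrArg φ h
  rw [map_mul, map_mul, mul_comm] at h
  exact (mul_right_cancel h).symm

theorem map_Z3 (φ : Matrix.SpecialLinearGroup (Fin 3) R →* A) (M : Matrix.SpecialLinearGroup (Fin 2) R) :
    φ (Z3 M) = φ (emb M) := by
  have h : Q3 * emb M = Z3 M * Q3 := by
    apply SLext
    ext i j
    fin_cases i <;> fin_cases j <;>
      simp [coe_Q3, coe_Z3, coe_emb, Matrix.SpecialLinearGroup.coe_mul, Matrix.mul_apply, Fin.sum_univ_three]
  have h := congrArg φ h
  rw [map_mul, map_mul, mul_comm] at h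
  exact (mul_right_cancel h).symm

theorem mennicke (φ : Matrix.SpecialLinearGroup (Fin 3) R →* A) (M N K : Matrix.SpecialLinearGroup (Fin 2) R)
    (h1 : N 0 0 = M 0 0) (h2 : K 0 0 = M 0 0) (h3 : K 0 1 = M 0 1 * N 0 1) :
    φ (emb K) = φ (emb M) * φ (emb N) := by
  have h : emb M * Y3 N * E3 0 1 (by decide) (-(M 0 1)) =
      E3 1 0 (by decide) (M 1 0 * K 1 1 - M 1 1 * N 0 1 * K 1 0) *
      E3 2 0 (by decide) (- N 1 1 * K 1 0) * E3 2 1 (by decide) (N 1 0) *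
      E3 1 2 (by decide) (N 0 1) * Z3 K := by
    have d1 := det2 M
    have d2 := det2 N
    have d3 := det2 K
    rw [h1] at d2
    rw [h2, h3] at d3
    apply SLext
    ext i j
    fin_cases i <;> fin_cases j <;>
      simp [coe_Y3, coe_Z3, coe_emb, Matrix.SpecialLinearGroup.coe_mul, Matrix.mul_apply, Fin.sum_univ_three, coe_E3, h1, h2, h3] <;>
      grind
  have h := congrArg φ h
  simp only [map_mul, map_E3, map_Y3, map_Z3, one_mul, mul_one] at h
  exact h.symm

end three
end SLBdd

namespace SLBdd

open Matrix

section symbol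
variable {R : Type*} [CommRing R] {A : Type*} [CommGroup A]
  (φ : Matrix.SpecialLinearGroup (Fin 3) R →* A)

/-- two by two lower unipotent -/
def lo (x : R) : Matrix.SpecialLinearGroup (Fin 2) R :=
  ⟨!![1, 0; x, 1], by simp [Matrix.det_fin_two]⟩

def up (x : R) : Matrix.SpecialLinearGroup (Fin 2) R :=
  ⟨!![1, x; 0, 1], by simp [Matrix.det_fin_two]⟩

def w2 : Matrix.SpecialLinearGroup (Fin 2) R :=
  ⟨!![0, -1; 1, 0], by simp [Matrix.det_fin_two]⟩

theorem coe_lo (x : R) : (lo x : Matrix (Fin 2) (Fin 2) R) = !![1, 0; x, 1] := rfl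
theorem coe_up (x : R) : (up x : Matrix (Fin 2) (Fin 2) R) = !![1, x; 0, 1] := rfl
theorem coe_w2 : ((w2 : Matrix.SpecialLinearGroup (Fin 2) R) : Matrix (Fin 2) (Fin 2) R) =
  !![0, -1; 1, 0] := rfl

theorem map_lo (x : R) : φ (emb (lo x)) = 1 := by
  rw [show emb (lo x) = E3 1 0 (by decide) x from ?_, map_E3]
  apply SLext
  ext i j
  fin_cases i <;> fin_cases j <;> simp [coe_emb, coe_lo, coe_E3]

theorem map_up (x : R) : φ (emb (up x)) = 1 := by
  rw [show emb (up x) = E3 0 1 (by decide) x from ?_, map_E3]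
  apply SLext
  ext i j
  fin_cases i <;> fin_cases j <;> simp [coe_emb, coe_up, coe_E3]

theorem map_w2 : φ (emb w2) = 1 := by
  rw [show (w2 : Matrix.SpecialLinearGroup (Fin 2) R) = up (-1) * lo 1 * up (-1) from ?_]
  · simp only [map_mul, map_lo, map_up, mul_one]
  apply SLext
  ext i j
  fin_cases i <;> fin_cases j <;>
    simp [Matrix.SpecialLinearGroup.coe_mul, coe_up, coe_lo, coe_w2, Matrix.mul_apply]

theorem map_row (M N : Matrix.SpecialLinearGroup (Fin 2) R) (h0 : M 0 0 = N 0 0)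
    (h1 : M 0 1 = N 0 1) : φ (emb M) = φ (emb N) := by
  have h : M = lo (M 1 0 * N 1 1 - M 1 1 * N 1 0) * N := by
    have d1 := det2 M
    have d2 := det2 N
    rw [h0, h1] at d1
    apply SLext
    ext i j
    fin_cases i <;> fin_cases j <;>
      simp [Matrix.SpecialLinearGroup.coe_mul, coe_lo, Matrix.mul_apply, h0, h1] <;> grind
  rw [h, map_mul, map_mul, map_lo, one_mul]

open Classical in
/-- The (Mennicke) symbol of a unimodular row. -/
noncomputable def sym (a b : R) : A :=
  if h : ∃ M : Matrix.SpecialLinearGroup (Fin 2) R, M 0 0 = a ∧ M 0 1 = b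
  then φ (emb h.choose) else 1

theorem sym_eq (M : Matrix.SpecialLinearGroup (Fin 2) R) (a b : R) (ha : M 0 0 = a)
    (hb : M 0 1 = b) : sym φ a b = φ (emb M) := by
  have h : ∃ M : Matrix.SpecialLinearGroup (Fin 2) R, M 0 0 = a ∧ M 0 1 = b := ⟨M, ha, hb⟩
  rw [sym, dif_pos h]
  exact map_row φ _ _ (h.choose_spec.1.trans ha.symm) (h.choose_spec.2.trans hb.symm)

theorem exists_mat {a b : R} (h : IsCoprime a b) :
    ∃ M : Matrix.SpecialLinearGroup (Fin 2) R, M 0 0 = a ∧ M 0 1 = b := by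
  obtain ⟨u, v, h⟩ := h
  exact ⟨⟨!![a, b; -v, u], by simp [Matrix.det_fin_two]; linear_combination h⟩, rfl, rfl⟩

theorem sym_add_right {a b : R} (h : IsCoprime a b) (t : R) :
    sym φ a (b + t * a) = sym φ a b := by
  obtain ⟨M, h0, h1⟩ := exists_mat h
  rw [sym_eq φ M a b h0 h1, sym_eq φ (M * up t), map_mul, map_mul, map_up, mul_one] <;>
    simp [Matrix.SpecialLinearGroup.coe_mul, coe_up, Matrix.mul_apply, h0, h1] <;> ring

theorem sym_add_left {a b : R} (h : IsCoprime a b) (t : R) :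
    sym φ (a + t * b) b = sym φ a b := by
  obtain ⟨M, h0, h1⟩ := exists_mat h
  rw [sym_eq φ M a b h0 h1, sym_eq φ (M * lo t), map_mul, map_mul, map_lo, mul_one] <;>
    simp [Matrix.SpecialLinearGroup.coe_mul, coe_lo, Matrix.mul_apply, h0, h1] <;> ring

theorem sym_rot {a b : R} (h : IsCoprime a b) : sym φ b (-a) = sym φ a b := by
  obtain ⟨M, h0, h1⟩ := exists_mat h
  rw [sym_eq φ M a b h0 h1, sym_eq φ (M * w2), map_mul, map_mul, map_w2, mul_one] <;>
    simp [Matrix.SpecialLinearGroup.coe_mul, coe_w2, Matrix.mul_apply, h0, h1]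

theorem sym_mul_right {a b c : R} (h : IsCoprime a b) (h' : IsCoprime a c) :
    sym φ a (b * c) = sym φ a b * sym φ a c := by
  obtain ⟨M, h0, h1⟩ := exists_mat h
  obtain ⟨N, h2, h3⟩ := exists_mat h'
  obtain ⟨K, h4, h5⟩ := exists_mat (h.mul_right h')
  rw [sym_eq φ M a b h0 h1, sym_eq φ N a c h2 h3, sym_eq φ K _ _ h4 h5]
  exact mennicke φ M N K (h2.trans h0.symm) (h4.trans h0.symm) (by rw [h5, h1, h3])

theorem sym_one_left (b : R) : sym φ 1 b = 1 := by
  rw [sym_eq φ (up b) 1 b rfl rfl, map_up]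

theorem sym_one_right (b : R) : sym φ b 1 = 1 := by
  rw [sym_eq φ (up 1 * lo (b - 1)) b 1, map_mul, map_mul, map_lo, map_up, one_mul]
  all_goals simp [Matrix.SpecialLinearGroup.coe_mul, coe_lo, coe_up, Matrix.mul_apply]

theorem sym_neg_one_right (b : R) : sym φ b (-1) = 1 := by
  rw [sym_rot φ isCoprime_one_left, sym_one_left]

theorem sym_neg_right {a b : R} (h : IsCoprime a b) : sym φ a (-b) = sym φ a b := by
  rw [← mul_neg_one, sym_mul_right φ h isCoprime_one_right.neg_right, sym_neg_one_right, mul_one]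

theorem sym_comm {a b : R} (h : IsCoprime a b) : sym φ b a = sym φ a b := by
  rw [← sym_neg_right φ h.symm, sym_rot φ h]

theorem sym_mul_left {a b c : R} (h : IsCoprime a c) (h' : IsCoprime b c) :
    sym φ (a * b) c = sym φ a c * sym φ b c := by
  rw [← sym_comm φ (h.mul_left h'), sym_mul_right φ h.symm h'.symm, sym_comm φ h, sym_comm φ h']

theorem sym_unit_left {a b : R} (h : a * a = 1) : sym φ a b = 1 := by
  have hu : IsCoprime a 1 := isCoprime_one_right
  rw [← sym_one_right φ a, ← sym_add_right φ hu ((b - 1) * a)]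
  congr 1
  linear_combination (-(b-1)) * h

/-- If `b ∣ a² - 1` then the symbol squares to one. -/
theorem sym_sq_eq_one {a b : R} (h : b ∣ a * a - 1) : sym φ a b * sym φ a b = 1 := by
  obtain ⟨t, ht⟩ := h
  have hc : IsCoprime a b := ⟨a, -t, by linear_combination ht⟩
  rw [← sym_mul_left φ hc hc, show a * a = 1 + t * b by linear_combination ht,
    sym_add_left φ isCoprime_one_left, sym_one_left]

theorem map_transpose (M N : Matrix.SpecialLinearGroup (Fin 2) R)
    (h0 : N 0 0 = M 0 0) (h1 : N 0 1 = M 1 0) (h2 : N 1 0 = M 0 1) (h3 : N 1 1 = M 1 1) :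
    φ (emb N) = (φ (emb M))⁻¹ := by
  have h : N * (w2 * M) = w2 := by
    have d := det2 M
    apply SLext
    ext i j
    fin_cases i <;> fin_cases j <;>
      simp [Matrix.SpecialLinearGroup.coe_mul, coe_w2, Matrix.mul_apply, Matrix.vecMul,
        dotProduct, h0, h1, h2, h3] <;> grind
  have h := congrArg (fun g => φ (emb g)) h
  simp only [map_mul, map_w2, one_mul] at h
  exact eq_inv_of_mul_eq_one_left h

/-- The power lemma. -/
theorem power_lemma (M N : Matrix.SpecialLinearGroup (Fin 2) R) (x y : R)
    (h0 : N 0 0 = x + y * M 0 0) (h1 : N 0 1 = y * M 0 1)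
    (h2 : N 1 0 = y * M 1 0) (h3 : N 1 1 = x + y * M 1 1)
    (h : M 0 1 ∣ N 0 0 * N 0 0 - 1) : φ (emb N) * φ (emb N) = 1 := by
  have d := det2 N
  have c1 : IsCoprime (N 0 0) y := ⟨N 1 1, - (M 0 1 * N 1 0), by rw [h1] at d; linear_combination d⟩
  have c2 : IsCoprime (N 0 0) (M 0 1) := ⟨N 1 1, - (y * N 1 0), by rw [h1] at d; linear_combination d⟩
  have c3 : IsCoprime x y :=
    ⟨N 1 1, M 0 0 * N 1 1 - (M 0 1 * N 1 0), by rw [h1, h0] at d; linear_combination d⟩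
  have e : φ (emb N) = sym φ x y * sym φ (N 0 0) (M 0 1) := by
    rw [← sym_eq φ N _ _ rfl h1, sym_mul_right φ c1 c2, h0, ← sym_add_left φ c3 (M 0 0),
      mul_comm y]
  have e1 := sym_sq_eq_one φ h
  have e2 : sym φ x y * sym φ x y = 1 := by
    apply sym_sq_eq_one
    rw [h0, h1, h2, h3] at d
    exact ⟨- (x * (M 0 0 + M 1 1) + y * (M 0 0 * M 1 1 - M 0 1 * M 1 0)),
      by linear_combination d⟩
  rw [e, mul_mul_mul_comm, e1, e2, one_mul]

end symbol
end SLBdd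

namespace SLBdd

open Matrix

theorem pow_CH (M : Matrix.SpecialLinearGroup (Fin 2) ℤ) (k : ℕ) :
    ∃ x y : ℤ, (M ^ k) 0 0 = x + y * M 0 0 ∧ (M ^ k) 0 1 = y * M 0 1 ∧
      (M ^ k) 1 0 = y * M 1 0 ∧ (M ^ k) 1 1 = x + y * M 1 1 := by
  induction k with
  | zero => exact ⟨1, 0, by simp⟩
  | succ k ih =>
    obtain ⟨x, y, h0, h1, h2, h3⟩ := ih
    have d := det2 M
    refine ⟨-y, x + y * (M 0 0 + M 1 1), ?_⟩
    simp only [pow_succ, Matrix.SpecialLinearGroup.coe_mul, Matrix.mul_apply, Fin.sum_univ_two]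
    simp only [Matrix.SpecialLinearGroup.coe_pow] at h0 h1 h2 h3 ⊢
    rw [h0, h1, h2, h3]
    refine ⟨?_, ?_, ?_, ?_⟩ <;> grind

theorem pow_mod_right (M : Matrix.SpecialLinearGroup (Fin 2) ℤ) (k : ℕ) :
    M 0 1 ∣ (M ^ k) 0 0 - M 0 0 ^ k := by
  induction k with
  | zero => simp
  | succ k ih =>
    obtain ⟨x, y, h0, h1, h2, h3⟩ := pow_CH M k
    obtain ⟨t, ht⟩ := ih
    refine ⟨t * M 0 0 + y * M 1 0, ?_⟩
    simp only [pow_succ, Matrix.SpecialLinearGroup.coe_mul, Matrix.mul_apply, Fin.sum_univ_two]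
    simp only [Matrix.SpecialLinearGroup.coe_pow] at h0 h1 h2 h3 ht ⊢
    rw [h1]
    linear_combination (M 0 0) * ht

theorem pow_mod_left (M : Matrix.SpecialLinearGroup (Fin 2) ℤ) (k : ℕ) :
    M 1 0 ∣ (M ^ k) 0 0 - M 0 0 ^ k := by
  induction k with
  | zero => simp
  | succ k ih =>
    obtain ⟨t, ht⟩ := ih
    refine ⟨t * M 0 0 + (M ^ k) 0 1, ?_⟩
    simp only [pow_succ, Matrix.SpecialLinearGroup.coe_mul, Matrix.mul_apply, Fin.sum_univ_two]
    simp only [Matrix.SpecialLinearGroup.coe_pow] at ht ⊢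
    linear_combination (M 0 0) * ht

theorem sq_of_dvd {b n a : ℤ} {k : ℕ} (h : b ∣ n - a ^ k) (h' : b ∣ a ^ (2 * k) - 1) :
    b ∣ n * n - 1 := by
  obtain ⟨s, hs⟩ := h
  obtain ⟨t, ht⟩ := h'
  refine ⟨s * (n + a ^ k) + t, ?_⟩
  have : a ^ (2 * k) = a ^ k * a ^ k := by ring
  rw [this] at ht
  linear_combination (n + a ^ k) * hs + ht

/-- Dirichlet for integers. -/
theorem dirichlet (a m : ℤ) (hm : m ≠ 0) (h : IsCoprime a m) :
    ∃ p : ℕ, p.Prime ∧ 2 < p ∧ m ∣ (p : ℤ) - a := by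
  have hq : m.natAbs ≠ 0 := by simpa using hm
  have h' : IsCoprime a (m.natAbs : ℤ) := by
    rw [Int.isCoprime_iff_gcd_eq_one] at h ⊢
    simpa [Int.gcd, Int.natAbs_abs] using h
  obtain ⟨p, hp2, hp, hpa⟩ := Nat.forall_exists_prime_gt_and_zmodEq 2 hq h'
  refine ⟨p, hp, hp2, ?_⟩
  have := hpa.symm.dvd
  rwa [Int.natCast_natAbs, abs_dvd] at this

theorem exists_q (a b : ℤ) (ha : Odd a) (h : IsCoprime a b) :
    ∃ q : ℕ, q.Prime ∧ q % 4 = 3 ∧ ∃ t : ℤ, (q : ℤ) = b + t * a := by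
  have h4 : IsCoprime a 4 := by
    have : IsCoprime a (2 ^ 2) := (Int.isCoprime_iff_gcd_eq_one.mpr (by
      rw [Int.gcd_comm]; simpa [Int.gcd] using ha.natAbs)).pow_right
    simpa using this
  obtain ⟨u, v, huv⟩ := id h4
  have ha0 : a ≠ 0 := by rintro rfl; simp at ha
  -- residue
  obtain ⟨q, hq, -, r, hr⟩ := dirichlet (b * (v * 4) + 3 * (u * a)) (4 * a) (by simpa) (by
    apply IsCoprime.mul_right
    · have h34 : IsCoprime (3 : ℤ) 4 := ⟨-1, 1, by norm_num⟩
      obtain ⟨x, y, hxy⟩ := h34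
      refine ⟨x, y + x * (3 * v - b * v), ?_⟩
      linear_combination hxy + 3 * x * huv
    · obtain ⟨x, y, hxy⟩ := h
      refine ⟨y, x - 3 * u * y + b * u * y, ?_⟩
      linear_combination hxy + b * y * huv)
  refine ⟨q, hq, ?_, 4 * r - b * u + 3 * u, ?_⟩
  · have : (q : ℤ) = 3 + 4 * (a * r + b * v - 3 * v) := by
      linear_combination hr + 3 * huv
    omega
  · linear_combination hr + b * huv

theorem exists_sqrt (q : ℕ) (hq : q.Prime) (h3 : q % 4 = 3) (a : ℤ) :
    ∃ ε s t : ℤ, ε * ε = 1 ∧ a = ε * (s * s) + t * q := by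
  haveI : Fact q.Prime := ⟨hq⟩
  have key : IsSquare ((a : ℤ) : ZMod q) ∨ IsSquare (-(a : ZMod q)) := by
    by_contra! hc
    obtain ⟨h1, h2⟩ := hc
    have ha : ((a : ℤ) : ZMod q) ≠ 0 := by
      intro h; rw [h] at h1; exact h1 (IsSquare.zero)
    have e1 := (quadraticChar_neg_one_iff_not_isSquare (F := ZMod q)).mpr h1
    have e2 := (quadraticChar_neg_one_iff_not_isSquare (F := ZMod q)).mpr h2
    rw [← neg_one_mul, map_mul, e1] at e2
    have e3 : quadraticChar (ZMod q) (-1) = 1 := by linarith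
    have e4 : IsSquare (-1 : ZMod q) :=
      (quadraticChar_one_iff_isSquare (neg_ne_zero.mpr one_ne_zero)).mp e3
    rw [ZMod.exists_sq_eq_neg_one_iff] at e4
    exact e4 h3
  rcases key with ⟨r, hr⟩ | ⟨r, hr⟩
  · obtain ⟨s, rfl⟩ := ZMod.intCast_surjective r
    have : ((a - s * s : ℤ) : ZMod q) = 0 := by push_cast; rw [hr, sub_self]
    obtain ⟨t, ht⟩ := (ZMod.intCast_zmod_eq_zero_iff_dvd _ q).mp this
    exact ⟨1, s, t, by norm_num, by linear_combination ht⟩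
  · obtain ⟨s, rfl⟩ := ZMod.intCast_surjective r
    have : ((a + s * s : ℤ) : ZMod q) = 0 := by push_cast; rw [← hr]; ring
    obtain ⟨t, ht⟩ := (ZMod.intCast_zmod_eq_zero_iff_dvd _ q).mp this
    exact ⟨-1, s, t, by norm_num, by linear_combination ht⟩

theorem exists_exponents (m n : ℕ) (hm : 0 < m) (hn : 0 < n) (h : m.Coprime n) :
    ∃ u v : ℕ, u * n = v * m + 1 := by
  rcases Nat.lt_or_ge 1 m with h1 | h1
  · obtain ⟨u, hu⟩ := Nat.exists_mul_mod_eq_one_of_coprime h.symm h1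
    obtain ⟨hu1, hu2⟩ := hu
    refine ⟨u, n * u / m, ?_⟩
    have := Nat.div_add_mod (n * u) m
    rw [hu2] at this
    linarith
  · obtain rfl : m = 1 := by omega
    exact ⟨1, n - 1, by omega⟩

/-- The arithmetic core. -/
theorem exists_data (a b : ℤ) (ha : Odd a) (h : IsCoprime a b) :
    ∃ (q t ε s t' : ℤ) (B : Matrix.SpecialLinearGroup (Fin 2) ℤ) (k l : ℕ),
      q = b + t * a ∧ ε * ε = 1 ∧ a = ε * (s * s) + t' * q ∧ B 0 0 = s ∧ B 0 1 = q ∧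
      q ∣ (B ^ l) 0 0 * (B ^ l) 0 0 - 1 ∧ B 1 0 ∣ (B ^ k) 0 0 * (B ^ k) 0 0 - 1 ∧
      k = l + 1 := by
  obtain ⟨q, hq, hq3, t, hqt⟩ := exists_q a b ha h
  obtain ⟨ε, s₀, t₀, hε, hs₀⟩ := exists_sqrt q hq hq3 a
  set s : ℤ := s₀ + q * (1 - s₀) with hs
  have hsq : a = ε * (s * s) + (t₀ - ε * ((1 - s₀) * (s + s₀))) * q := by
    rw [hs]; linear_combination hs₀
  have haq : IsCoprime a (q : ℤ) := by
    rw [hqt]; exact IsCoprime.add_mul_right_right h t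
  have hsc : IsCoprime s (q : ℤ) := by
    obtain ⟨x, y, hxy⟩ := haq
    exact ⟨x * ε * s, y + x * (t₀ - ε * ((1 - s₀) * (s + s₀))), by
      linear_combination hxy - x * hsq⟩
  have hq1 : 3 ≤ q := by omega
  have hs0 : s ≠ 0 := by
    intro h0
    rw [h0, isCoprime_zero_left, Int.isUnit_iff] at hsc
    omega
  obtain ⟨x, y, hxy⟩ := id hsc
  -- s * x - q * (-y) = 1 ; choose p ≡ -y mod s, p ≡ -1 mod q-1
  have hs1 : s - 1 = (q - 1 : ℤ) * (1 - s₀) := by rw [hs]; ring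
  obtain ⟨p, hp, hp2, r, hr⟩ := dirichlet (- y - s * (1 - y)) (s * (q - 1))
    (mul_ne_zero hs0 (by omega)) (by
      apply IsCoprime.mul_right
      · exact ⟨-q, x - q * (1 - y), by linear_combination hxy⟩
      · exact ⟨-1, (y - 1) * (1 - s₀), by linear_combination (y - 1) * hs1⟩)
  let B : Matrix.SpecialLinearGroup (Fin 2) ℤ :=
    ⟨!![s, q; p, x + q * ((q - 1) * r - (1 - y))], by
      simp [Matrix.det_fin_two]; linear_combination hxy - q * hr⟩
  have hpodd : p % 2 = 1 := hp.eq_two_or_odd.resolve_left (by omega)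
  have hcop : ((q - 1) / 2).Coprime ((p - 1) / 2) := by
    have hK : (p : ℤ) + 1 = (q - 1) * (s * r - (1 - s₀) * (1 - y)) := by
      linear_combination hr - (1 - y) * hs1
    have hg1 := Nat.gcd_dvd_left ((q - 1) / 2) ((p - 1) / 2)
    have hg2 := Nat.gcd_dvd_right ((q - 1) / 2) ((p - 1) / 2)
    unfold Nat.Coprime
    generalize Nat.gcd ((q - 1) / 2) ((p - 1) / 2) = g at hg1 hg2 ⊢
    obtain ⟨c, hc⟩ := hg1
    obtain ⟨d, hd⟩ := hg2
    have hc' : (q : ℤ) - 1 = 2 * ((g : ℤ) * c) := by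
      have : q - 1 = 2 * (g * c) := by omega
      have h2 : q = 2 * (g * c) + 1 := by omega
      rw [h2]; push_cast; ring
    have hd' : (p : ℤ) - 1 = 2 * ((g : ℤ) * d) := by
      have h2 : p = 2 * (g * d) + 1 := by omega
      rw [h2]; push_cast; ring
    have h1 : (1 : ℤ) = g * (c * (s * r - (1 - s₀) * (1 - y)) - d) := by
      rw [hc'] at hK
      have : (2 : ℤ) * 1 = 2 * (g * (c * (s * r - (1 - s₀) * (1 - y)) - d)) := by
        linear_combination hK - hd'
      exact mul_left_cancel₀ two_ne_zero this
    have h2 : (g : ℤ) ∣ 1 := ⟨_, h1⟩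
    exact Nat.dvd_one.mp (by exact_mod_cast h2)
  obtain ⟨u, v, huv⟩ := exists_exponents _ _ (by omega) (by omega) hcop
  have hsp : IsCoprime s (p : ℤ) :=
    ⟨x + q * ((q - 1) * r - (1 - y)), -q, by linear_combination hxy - q * hr⟩
  refine ⟨q, t, ε, s, _, B, u * ((p - 1) / 2), v * ((q - 1) / 2), hqt, hε, hsq, rfl, rfl,
    ?_, ?_, huv⟩
  · refine sq_of_dvd (pow_mod_right B _) ?_
    have := (Int.ModEq.pow_card_sub_one_eq_one hq hsc).pow v
    have e : 2 * (v * ((q - 1) / 2)) = (q - 1) * v := by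
      rw [mul_left_comm, Nat.mul_div_cancel' (by omega), mul_comm]
    rw [e, pow_mul]
    rw [one_pow] at this
    exact this.symm.dvd
  · refine sq_of_dvd (pow_mod_left B _) ?_
    have := (Int.ModEq.pow_card_sub_one_eq_one hp hsp).pow u
    have e : 2 * (u * ((p - 1) / 2)) = (p - 1) * u := by
      rw [mul_left_comm, Nat.mul_div_cancel' (by omega), mul_comm]
    rw [e, pow_mul]
    rw [one_pow] at this
    exact this.symm.dvd

end SLBdd

namespace SLBdd

open Matrix

section pack
variable {I : Type*}

/-- A family of integer matrices as a matrix over the product ring. -/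
def pack {ι : Type*} [Fintype ι] [DecidableEq ι] (f : I → Matrix.SpecialLinearGroup ι ℤ) :
    Matrix.SpecialLinearGroup ι (I → ℤ) :=
  ⟨Matrix.of fun r s i => f i r s, by
    funext i
    have h := (Pi.evalRingHom (fun _ : I => ℤ) i).map_det (Matrix.of fun r s i => f i r s)
    rw [Pi.evalRingHom_apply] at h
    rw [h, Pi.one_apply]
    exact (f i).det_coe⟩

theorem pack_apply {ι : Type*} [Fintype ι] [DecidableEq ι]
    (f : I → Matrix.SpecialLinearGroup ι ℤ) (r s : ι) (i : I) :
    (pack f) r s i = f i r s := rfl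

theorem pack_mul {ι : Type*} [Fintype ι] [DecidableEq ι]
    (f g : I → Matrix.SpecialLinearGroup ι ℤ) : pack (fun i => f i * g i) = pack f * pack g := by
  apply SLext
  ext r s i
  rw [pack_apply]
  simp only [Matrix.SpecialLinearGroup.coe_mul, Matrix.mul_apply, Finset.sum_apply, Pi.mul_apply,
    pack_apply]

theorem pi_dvd {a b : I → ℤ} (h : ∀ i, a i ∣ b i) : a ∣ b := by
  choose c hc using h
  exact ⟨c, funext hc⟩

/-- transpose of a two by two matrix -/
def tr2 {R : Type*} [CommRing R] (M : Matrix.SpecialLinearGroup (Fin 2) R) :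
    Matrix.SpecialLinearGroup (Fin 2) R :=
  ⟨!![M 0 0, M 1 0; M 0 1, M 1 1], by
    have := det2 M
    simp [Matrix.det_fin_two]; linear_combination this⟩

theorem map_emb_odd {A : Type*} [CommGroup A]
    (φ : Matrix.SpecialLinearGroup (Fin 3) (I → ℤ) →* A) (a b : I → ℤ)
    (ha : ∀ i, Odd (a i)) (h : IsCoprime a b) : sym φ a b = 1 := by
  have hp : ∀ i, IsCoprime (a i) (b i) := by
    intro i
    obtain ⟨u, v, e⟩ := h
    exact ⟨u i, v i, by simpa using congrFun e i⟩
  choose q t ε s t' B k l hq hε hs hB0 hB1 hd1 hd2 hkl using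
    fun i => exists_data (a i) (b i) (ha i) (hp i)
  have Hq : q = b + t * a := funext hq
  have Hε : ε * ε = 1 := funext hε
  have Hs : a = ε * (s * s) + t' * q := funext hs
  have haq : IsCoprime a q := by
    rw [Hq]; exact IsCoprime.add_mul_right_right h t
  have hsq : IsCoprime s q := by
    obtain ⟨x, y, hxy⟩ := haq
    exact ⟨x * ε * s, y + x * t', by linear_combination hxy - x * Hs⟩
  have hεq : IsCoprime ε q := ⟨ε, 0, by linear_combination Hε⟩
  rw [← sym_add_right φ h t, ← Hq, Hs, sym_add_left φ (hεq.mul_left (hsq.mul_left hsq)),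
    sym_mul_left φ hεq (hsq.mul_left hsq), sym_mul_left φ hsq hsq, sym_unit_left φ Hε, one_mul,
    sym_eq φ (pack B) s q (funext hB0) (funext hB1)]
  choose xl yl l0 l1 l2 l3 using fun i => pow_CH (B i) (l i)
  choose xk yk k0 k1 k2 k3 using fun i => pow_CH (B i) (k i)
  have hl : φ (emb (pack fun i => B i ^ l i)) * φ (emb (pack fun i => B i ^ l i)) = 1 := by
    refine power_lemma φ (pack B) _ xl yl (funext l0) (funext l1) (funext l2) (funext l3) ?_
    apply pi_dvd
    intro i
    have := hd1 i
    rw [← hB1 i] at this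
    exact this
  have hk : φ (emb (pack fun i => B i ^ k i)) * φ (emb (pack fun i => B i ^ k i)) = 1 := by
    have e := map_transpose φ (pack fun i => B i ^ k i) (tr2 (pack fun i => B i ^ k i))
      rfl rfl rfl rfl
    have := power_lemma φ (tr2 (pack B)) (tr2 (pack fun i => B i ^ k i)) xk yk
      (funext k0) (funext k2) (funext k1) (funext k3) (by
        apply pi_dvd
        exact hd2)
    rw [e, ← mul_inv, inv_eq_one] at this
    exact this
  have hm : (pack fun i => B i ^ k i) = (pack fun i => B i ^ l i) * pack B := by
    rw [← pack_mul]
    congr 1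
    funext i
    rw [hkl i, pow_succ]
  rw [hm, map_mul, map_mul, mul_mul_mul_comm, hl, one_mul] at hk
  exact hk

theorem map_emb {A : Type*} [CommGroup A]
    (φ : Matrix.SpecialLinearGroup (Fin 3) (I → ℤ) →* A)
    (M : Matrix.SpecialLinearGroup (Fin 2) (I → ℤ)) : φ (emb M) = 1 := by
  have d := det2 M
  have h : IsCoprime (M 0 0) (M 0 1) := ⟨M 1 1, - M 1 0, by linear_combination d⟩
  have ht : ∀ i, ∃ t : ℤ, Odd (M 0 0 i + t * M 0 1 i) := by
    intro i
    have di : M 0 0 i * M 1 1 i - M 0 1 i * M 1 0 i = 1 := congrFun d i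
    rcases Int.even_or_odd (M 0 0 i) with he | ho
    · refine ⟨1, ?_⟩
      rw [one_mul]
      apply he.add_odd
      by_contra hc
      rw [Int.not_odd_iff_even] at hc
      have : Even (1 : ℤ) := by
        rw [← di]
        exact (he.mul_right _).sub (hc.mul_right _)
      simp at this
    · exact ⟨0, by simpa using ho⟩
  choose t ht using ht
  rw [← sym_eq φ M _ _ rfl rfl, ← sym_add_left φ h t]
  refine map_emb_odd φ _ _ ht ?_
  exact h.add_mul_right_left t

end pack
end SLBdd

namespace SLBdd

open Matrix

section reduce

theorem int_unimod {ι : Type*} [Fintype ι] [DecidableEq ι] [Nontrivial ι] (w v : ι → ℤ) (y z : ℤ)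
    (h : ∑ i, w i * v i + y * z = 1) :
    ∃ t w' : ι → ℤ, ∑ i, w' i * (v i + t i * z) = 1 := by
  by_cases hv : ∀ i, v i = 0
  · obtain ⟨i0⟩ : Nonempty ι := inferInstance
    refine ⟨fun _ => y, Pi.single i0 1, ?_⟩
    simp [hv] at h ⊢
    simpa [Pi.single_apply] using h
  push Not at hv
  obtain ⟨i1, hi1⟩ := hv
  obtain ⟨i0, hi0⟩ := exists_ne i1
  let τ : ℤ := ∏ p ∈ (v i1).natAbs.primeFactors.filter (fun p : ℕ => ¬ ((p : ℤ) ∣ v i0)), (p : ℤ)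
  let t : ι → ℤ := Pi.single i0 τ
  let u : ι → ℤ := fun i => v i + t i * z
  have key : Ideal.span (Set.range u) = ⊤ := by
    obtain ⟨g, hg⟩ := (IsPrincipalIdealRing.principal (Ideal.span (Set.range u))).principal
    have hdvd : ∀ i, g ∣ u i := by
      intro i
      have : u i ∈ Ideal.span (Set.range u) := Ideal.subset_span ⟨i, rfl⟩
      rw [hg] at this
      exact Ideal.mem_span_singleton.mp this
    have hu1 : u i1 = v i1 := by simp [u, t, hi0.symm]
    have hu2 : ∀ i, i ≠ i0 → u i = v i := by intro i hi; simp [u, t, hi]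
    have hu0 : u i0 = v i0 + τ * z := by simp [u, t]
    rw [hg]
    refine Ideal.span_singleton_eq_top.mpr ?_
    by_contra hun
    have hg0 : g ≠ 0 := by
      rintro rfl
      have := hdvd i1
      rw [hu1, zero_dvd_iff] at this
      exact hi1 this
    obtain ⟨p, hp, hpg⟩ := WfDvdMonoid.exists_irreducible_factor hun hg0
    have hp' : Prime p := hp.prime
    have hpu : ∀ i, p ∣ u i := fun i => hpg.trans (hdvd i)
    have hpv1 : p ∣ v i1 := hu1 ▸ hpu i1
    have hpv0 := hpu i0
    rw [hu0] at hpv0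
    by_cases hc : p ∣ v i0
    · have hpz : ¬ p ∣ z := by
        intro hz
        apply hp'.not_dvd_one
        rw [← h]
        refine dvd_add (Finset.dvd_sum fun i _ => ?_) (hz.mul_left _)
        by_cases hi : i = i0
        · subst hi; exact hc.mul_left _
        · exact (hu2 i hi ▸ hpu i).mul_left _
      have h3 : p ∣ τ := (hp'.dvd_or_dvd ((dvd_add_right hc).mp hpv0)).resolve_right hpz
      obtain ⟨r, hr, hpr⟩ := (Prime.dvd_finsetProd_iff hp' _).mp h3
      rw [Finset.mem_filter, Nat.mem_primeFactors] at hr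
      have hrp : Prime (r : ℤ) := Nat.prime_iff_prime_int.mp hr.1.1
      exact hr.2 (((hp'.associated_of_dvd hrp hpr).dvd_iff_dvd_left).mp hc)
    · have hpτ : p ∣ τ := by
        have hm : p.natAbs ∈ (v i1).natAbs.primeFactors.filter
            (fun p : ℕ => ¬ ((p : ℤ) ∣ v i0)) := by
          rw [Finset.mem_filter, Nat.mem_primeFactors]
          refine ⟨⟨Int.prime_iff_natAbs_prime.mp hp', Int.natAbs_dvd_natAbs.mpr hpv1, by simpa⟩, ?_⟩
          rwa [Int.natAbs_dvd]
        have := Finset.dvd_prod_of_mem (fun p : ℕ => (p : ℤ)) hm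
        exact Int.natAbs_dvd.mp this
      exact hc ((dvd_add_left (hpτ.mul_right z)).mp hpv0)
  have h1 : (1 : ℤ) ∈ Ideal.span (Set.range u) := by rw [key]; trivial
  obtain ⟨w', hw'⟩ := Ideal.mem_span_range_iff_exists_fun.mp h1
  exact ⟨t, w', hw'⟩

theorem pi_unimod {I ι : Type*} [Fintype ι] [DecidableEq ι] [Nontrivial ι] (w v : ι → I → ℤ)
    (y z : I → ℤ) (h : ∑ i, w i * v i + y * z = 1) :
    ∃ t w' : ι → I → ℤ, ∑ i, w' i * (v i + t i * z) = 1 := by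
  have hp : ∀ m, ∃ t w' : ι → ℤ, ∑ i, w' i * (v i m + t i * z m) = 1 := fun m =>
    int_unimod (fun i => w i m) (fun i => v i m) (y m) (z m) (by simpa using congrFun h m)
  choose t w' hw using hp
  refine ⟨fun i m => t m i, fun i m => w' m i, ?_⟩
  funext m
  simpa using hw m

variable {ι : Type*} [Fintype ι] [DecidableEq ι] {R : Type*} [CommRing R]

/-- Upper unipotent column. -/
def U (t : ι → R) : Matrix.SpecialLinearGroup (ι ⊕ Fin 1) R :=
  ⟨fromBlocks 1 (replicateCol (Fin 1) t) 0 1, by simp⟩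

/-- Lower unipotent row. -/
def Lw (r : ι → R) : Matrix.SpecialLinearGroup (ι ⊕ Fin 1) R :=
  ⟨fromBlocks 1 0 (replicateRow (Fin 1) r) 1, by simp⟩

/-- Block embedding. -/
def D : Matrix.SpecialLinearGroup ι R →* Matrix.SpecialLinearGroup (ι ⊕ Fin 1) R where
  toFun M := ⟨fromBlocks M 0 0 1, by simp⟩
  map_one' := by apply SLext; simp
  map_mul' M N := by
    apply SLext
    change fromBlocks ((M : Matrix ι ι R) * (N : Matrix ι ι R)) _ _ _ =
      fromBlocks (M : Matrix ι ι R) _ _ _ * fromBlocks (N : Matrix ι ι R) _ _ _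
    simp [fromBlocks_multiply]

theorem coe_U (t : ι → R) : (U t : Matrix (ι ⊕ Fin 1) (ι ⊕ Fin 1) R) =
  fromBlocks 1 (replicateCol (Fin 1) t) 0 1 := rfl
theorem coe_Lw (t : ι → R) : (Lw t : Matrix (ι ⊕ Fin 1) (ι ⊕ Fin 1) R) =
  fromBlocks 1 0 (replicateRow (Fin 1) t) 1 := rfl
theorem coe_D (M : Matrix.SpecialLinearGroup ι R) :
  (D M : Matrix (ι ⊕ Fin 1) (ι ⊕ Fin 1) R) = fromBlocks M 0 0 1 := rfl

theorem U_add (s t : ι → R) : U (s + t) = U s * U t := by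
  apply SLext
  rw [Matrix.SpecialLinearGroup.coe_mul, coe_U, coe_U, coe_U, fromBlocks_multiply]
  simp [add_comm]

theorem Lw_add (s t : ι → R) : Lw (s + t) = Lw s * Lw t := by
  apply SLext
  rw [Matrix.SpecialLinearGroup.coe_mul, coe_Lw, coe_Lw, coe_Lw, fromBlocks_multiply]
  simp [add_comm]

theorem U_single (i : ι) (x : R) :
    U (Pi.single i x) = TV (Sum.inl_ne_inr : (Sum.inl i : ι ⊕ Fin 1) ≠ Sum.inr 0) x := by
  apply SLext
  rw [coe_U, coe_TV]
  ext r s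
  rcases r with r | r <;> rcases s with s | s <;>
    simp [Matrix.transvection, Matrix.single_apply, Matrix.one_apply, Pi.single_apply,
      Subsingleton.elim _ (0 : Fin 1), eq_comm]

theorem Lw_single (i : ι) (x : R) :
    Lw (Pi.single i x) = TV (Sum.inr_ne_inl : (Sum.inr 0 : ι ⊕ Fin 1) ≠ Sum.inl i) x := by
  apply SLext
  rw [coe_Lw, coe_TV]
  ext r s
  rcases r with r | r <;> rcases s with s | s <;>
    simp [Matrix.transvection, Matrix.single_apply, Matrix.one_apply, Pi.single_apply,
      Subsingleton.elim _ (0 : Fin 1), eq_comm]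

variable {A : Type*} [CommGroup A] (φ : Matrix.SpecialLinearGroup (ι ⊕ Fin 1) R →* A)
  [Nontrivial ι]

theorem map_U (t : ι → R) : φ (U t) = 1 := by
  have h : ∀ s : Finset ι, φ (U (∑ i ∈ s, Pi.single i (t i))) = 1 := by
    intro s
    induction s using Finset.induction_on with
    | empty =>
      rw [Finset.sum_empty]
      have := congrArg φ (U_add (0 : ι → R) 0)
      rw [add_zero, map_mul] at this
      exact left_eq_mul.mp this
    | insert i s hi ih =>
      rw [Finset.sum_insert hi, U_add, map_mul, ih, mul_one, U_single]
      obtain ⟨j, hj⟩ := exists_ne i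
      exact map_transvection φ (k := Sum.inl j) _ (by simpa using hj.symm) (by simp) _
  have := h Finset.univ
  rwa [Finset.univ_sum_single] at this

theorem map_Lw (t : ι → R) : φ (Lw t) = 1 := by
  have h : ∀ s : Finset ι, φ (Lw (∑ i ∈ s, Pi.single i (t i))) = 1 := by
    intro s
    induction s using Finset.induction_on with
    | empty =>
      rw [Finset.sum_empty]
      have := congrArg φ (Lw_add (0 : ι → R) 0)
      rw [add_zero, map_mul] at this
      exact left_eq_mul.mp this
    | insert i s hi ih =>
      rw [Finset.sum_insert hi, Lw_add, map_mul, ih, mul_one, Lw_single]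
      obtain ⟨j, hj⟩ := exists_ne i
      exact map_transvection φ (k := Sum.inl j) _ (by simp) (by simpa using hj) _
  have := h Finset.univ
  rwa [Finset.univ_sum_single] at this

theorem exists_D_of_col (g : Matrix.SpecialLinearGroup (ι ⊕ Fin 1) R)
    (h1 : ∀ i, g (Sum.inl i) (Sum.inr 0) = 0) (h2 : g (Sum.inr 0) (Sum.inr 0) = 1) :
    ∃ M, φ g = φ (D M) := by
  obtain ⟨P, Q, hb⟩ : ∃ (P : Matrix ι ι R) (Q : ι → R),
      (g : Matrix (ι ⊕ Fin 1) (ι ⊕ Fin 1) R) = fromBlocks P 0 (replicateRow (Fin 1) Q) 1 := by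
    refine ⟨fun i j => g (Sum.inl i) (Sum.inl j), fun j => g (Sum.inr 0) (Sum.inl j), ?_⟩
    ext r s
    rcases r with r | r <;> rcases s with s | s
    · rfl
    · rw [Subsingleton.elim s 0, h1]; rfl
    · rw [Subsingleton.elim r 0]
      rfl
    · rw [Subsingleton.elim s 0, Subsingleton.elim r 0, h2]
      exact (Matrix.one_apply_eq (0 : Fin 1)).symm
  have hd : P.det = 1 := by
    have := g.det_coe
    rw [hb] at this
    simpa using this
  obtain ⟨M, hM⟩ : ∃ M : Matrix.SpecialLinearGroup ι R, (M : Matrix ι ι R) = P := ⟨⟨P, hd⟩, rfl⟩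
  refine ⟨M, ?_⟩
  have : g = D M * Lw Q := by
    apply SLext
    rw [Matrix.SpecialLinearGroup.coe_mul, coe_D, coe_Lw, fromBlocks_multiply, hb, hM]
    simp
  rw [this, map_mul, map_Lw, mul_one]

theorem U_mul_inl (t : ι → R) (g : Matrix.SpecialLinearGroup (ι ⊕ Fin 1) R) (i : ι)
    (s : ι ⊕ Fin 1) :
    (U t * g) (Sum.inl i) s = g (Sum.inl i) s + t i * g (Sum.inr 0) s := by
  rw [Matrix.SpecialLinearGroup.coe_mul, Matrix.mul_apply, Fintype.sum_sum_type]
  simp [coe_U, Matrix.one_apply]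

theorem U_mul_inr (t : ι → R) (g : Matrix.SpecialLinearGroup (ι ⊕ Fin 1) R) (s : ι ⊕ Fin 1) :
    (U t * g) (Sum.inr 0) s = g (Sum.inr 0) s := by
  rw [Matrix.SpecialLinearGroup.coe_mul, Matrix.mul_apply, Fintype.sum_sum_type]
  simp [coe_U]

theorem Lw_mul_inl (t : ι → R) (g : Matrix.SpecialLinearGroup (ι ⊕ Fin 1) R) (i : ι)
    (s : ι ⊕ Fin 1) :
    (Lw t * g) (Sum.inl i) s = g (Sum.inl i) s := by
  rw [Matrix.SpecialLinearGroup.coe_mul, Matrix.mul_apply, Fintype.sum_sum_type]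
  simp [coe_Lw, Matrix.one_apply]

theorem Lw_mul_inr (t : ι → R) (g : Matrix.SpecialLinearGroup (ι ⊕ Fin 1) R) (s : ι ⊕ Fin 1) :
    (Lw t * g) (Sum.inr 0) s = ∑ i, t i * g (Sum.inl i) s + g (Sum.inr 0) s := by
  rw [Matrix.SpecialLinearGroup.coe_mul, Matrix.mul_apply, Fintype.sum_sum_type]
  simp [coe_Lw]

theorem exists_D {I : Type*} (φ : Matrix.SpecialLinearGroup (ι ⊕ Fin 1) (I → ℤ) →* A)
    (g : Matrix.SpecialLinearGroup (ι ⊕ Fin 1) (I → ℤ)) : ∃ M, φ g = φ (D M) := by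
  have e : (g⁻¹ * g) (Sum.inr 0) (Sum.inr 0) = 1 := by rw [inv_mul_cancel]; simp
  rw [Matrix.SpecialLinearGroup.coe_mul, Matrix.mul_apply, Fintype.sum_sum_type] at e
  simp only [Finset.univ_unique, Finset.sum_singleton, Fin.default_eq_zero] at e
  obtain ⟨t, w, hw⟩ := pi_unimod _ _ _ _ e
  set z := g (Sum.inr 0) (Sum.inr 0) with hz
  set u : ι → I → ℤ := fun i => g (Sum.inl i) (Sum.inr 0) + t i * z with hu
  have := exists_D_of_col φ (U (-u) * (Lw ((1 - z) • w) * (U t * g))) ?_ ?_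
  · simpa only [map_mul, map_U, map_Lw, one_mul] using this
  · intro i
    have hlast : ∑ i, ((1 - z) • w) i * u i = 1 - z := by
      simp only [Pi.smul_apply, smul_eq_mul, mul_assoc]
      rw [← Finset.mul_sum, hw, mul_one]
    rw [U_mul_inl, Lw_mul_inl, Lw_mul_inr, U_mul_inl, U_mul_inr]
    simp only [U_mul_inl, ← hz]
    rw [hlast, Pi.neg_apply]
    ring
  · have hlast : ∑ i, ((1 - z) • w) i * u i = 1 - z := by
      simp only [Pi.smul_apply, smul_eq_mul, mul_assoc]
      rw [← Finset.mul_sum, hw, mul_one]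
    rw [U_mul_inr, Lw_mul_inr, U_mul_inr]
    simp only [U_mul_inl, ← hz]
    rw [hlast]
    ring

end reduce
end SLBdd

namespace SLBdd

open Matrix

section final

/-- reindexing -/
def rei {ι κ R : Type*} [CommRing R] [Fintype ι] [DecidableEq ι] [Fintype κ] [DecidableEq κ]
    (e : ι ≃ κ) : Matrix.SpecialLinearGroup ι R →* Matrix.SpecialLinearGroup κ R where
  toFun M := ⟨Matrix.reindex e e (M : Matrix ι ι R), by
    rw [Matrix.det_reindex_self]; exact M.det_coe⟩
  map_one' := by
    apply SLext
    change Matrix.reindex e e (1 : Matrix ι ι R) = 1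
    simp
  map_mul' M N := by
    apply SLext
    change Matrix.reindex e e ((M : Matrix ι ι R) * (N : Matrix ι ι R)) =
      Matrix.reindex e e (M : Matrix ι ι R) * Matrix.reindex e e (N : Matrix ι ι R)
    simp [Matrix.submatrix_mul_equiv]

theorem coe_rei {ι κ R : Type*} [CommRing R] [Fintype ι] [DecidableEq ι] [Fintype κ]
    [DecidableEq κ] (e : ι ≃ κ) (M : Matrix.SpecialLinearGroup ι R) (r s : κ) :
    (rei e M) r s = M (e.symm r) (e.symm s) := rfl

theorem rei_surj {ι κ R : Type*} [CommRing R] [Fintype ι] [DecidableEq ι] [Fintype κ]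
    [DecidableEq κ] (e : ι ≃ κ) (g : Matrix.SpecialLinearGroup κ R) :
    rei e (rei e.symm g) = g := by
  apply SLext
  ext r s
  rw [coe_rei, coe_rei]
  simp

theorem perfect {I : Type*} (m : ℕ) :
    ∀ {A : Type _} [CommGroup A]
      (φ : Matrix.SpecialLinearGroup (Fin (m + 3)) (I → ℤ) →* A)
      (g : Matrix.SpecialLinearGroup (Fin (m + 3)) (I → ℤ)), φ g = 1 := by
  induction m with
  | zero =>
    intro A _ φ g
    let e : Fin 2 ⊕ Fin 1 ≃ Fin 3 := finSumFinEquiv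
    obtain ⟨M, hM⟩ := exists_D (φ.comp (rei e)) (rei e.symm g)
    rw [MonoidHom.comp_apply, rei_surj, MonoidHom.comp_apply] at hM
    rw [hM]
    have : rei e (D M) = emb M := by
      apply SLext
      ext r s : 2
      rw [coe_rei, coe_D, coe_emb]
      fin_cases r <;> fin_cases s <;> rfl
    rw [this]
    exact map_emb φ M
  | succ m ih =>
    intro A _ φ g
    let e : Fin (m + 3) ⊕ Fin 1 ≃ Fin (m + 1 + 3) := finSumFinEquiv
    obtain ⟨M, hM⟩ := exists_D (φ.comp (rei e)) (rei e.symm g)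
    rw [MonoidHom.comp_apply, rei_surj] at hM
    rw [hM]
    exact ih ((φ.comp (rei e)).comp D) M

theorem mem_list {G : Type*} [Group G] (g : G) (h : g ∈ commutator G) :
    ∃ l : List G, (∀ x ∈ l, x ∈ commutatorSet G) ∧ l.prod = g := by
  rw [commutator_eq_closure, ← Subgroup.mem_toSubmonoid, Subgroup.closure_toSubmonoid] at h
  obtain ⟨l, hl, hp⟩ := Submonoid.exists_list_of_mem_closure h
  refine ⟨l, fun x hx => ?_, hp⟩
  rcases hl x hx with h | h
  · exact h
  · obtain ⟨a, b, hab⟩ := h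
    refine ⟨b, a, ?_⟩
    rw [← commutatorElement_inv, hab, inv_inv]

theorem bounded (n : ℕ) (hn : 3 ≤ n) :
    ∃ C : ℕ, ∀ g : Matrix.SpecialLinearGroup (Fin n) ℤ,
      ∃ l : List (Matrix.SpecialLinearGroup (Fin n) ℤ),
        (∀ x ∈ l, x ∈ commutatorSet (Matrix.SpecialLinearGroup (Fin n) ℤ)) ∧ l.prod = g ∧
          l.length = C := by
  obtain ⟨m, rfl⟩ : ∃ m, n = m + 3 := ⟨n - 3, by omega⟩
  let T := pack (id : Matrix.SpecialLinearGroup (Fin (m + 3)) ℤ → _)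
  have hT : T ∈ commutator _ := by
    rw [← Abelianization.ker_of, MonoidHom.mem_ker]
    exact perfect m _ T
  obtain ⟨l, hl, hp⟩ := mem_list T hT
  refine ⟨l.length, fun g => ?_⟩
  let ψ := Matrix.SpecialLinearGroup.map (n := Fin (m + 3))
    (Pi.evalRingHom (fun _ : Matrix.SpecialLinearGroup (Fin (m + 3)) ℤ => ℤ) g)
  refine ⟨l.map ψ, ?_, ?_, by simp⟩
  · intro x hx
    obtain ⟨y, hy, rfl⟩ := List.mem_map.mp hx
    obtain ⟨a, b, rfl⟩ := hl y hy
    exact ⟨ψ a, ψ b, (map_commutatorElement ψ a b).symm⟩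
  · rw [List.prod_hom, hp]
    apply SLext
    ext r s
    rfl

end final
end SLBdd

/-- For n ≥ 3, the commutator length is bounded on SL(n,ℤ): there is a constant C
such that every element is a product of at most C commutators; consequently the
stable commutator length scl(g) = lim cl(gᵐ)/m vanishes identically. -/
theorem SLnZ_commutator_length_bounded_and_scl_zero (n : ℕ) (hn : 3 ≤ n) :
    (∃ C : ℕ, ∀ g : Matrix.SpecialLinearGroup (Fin n) ℤ,
      wordNorm (commutatorSet (Matrix.SpecialLinearGroup (Fin n) ℤ)) g ≤ C) ∧
    (∀ g : Matrix.SpecialLinearGroup (Fin n) ℤ,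
      Filter.Tendsto
        (fun m : ℕ =>
          (wordNorm (commutatorSet (Matrix.SpecialLinearGroup (Fin n) ℤ)) (g ^ m) : ℝ) / m)
        Filter.atTop (nhds 0)) := by
  obtain ⟨C, hC⟩ := SLBdd.bounded n hn
  have hle : ∀ g : Matrix.SpecialLinearGroup (Fin n) ℤ,
      wordNorm (commutatorSet (Matrix.SpecialLinearGroup (Fin n) ℤ)) g ≤ C :=
    fun g => Nat.sInf_le (hC g)
  refine ⟨⟨C, hle⟩, fun g => ?_⟩
  refine squeeze_zero (fun m => by positivity) (fun m => ?_)
    (tendsto_const_div_atTop_nhds_zero_nat (C : ℝ))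
  gcongr
  exact hle _
end
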